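/- Let $(M,g)$ be a real four-dimensional Lorentzian spin manifold of signature $(+,-,-,-)$ with Levi-Civita connection $\nabla_a$ (also denoting its extension to spinors), and suppose that $g$ is Einstein: the trace-free Ricci tensor vanishes and $\Lambda=R/24$ is constant. Let $(o^A,\iota^A)$ be a smooth spin dyad with $o_A\iota^A=1$ (where $\xi_B=\xi^A\epsilon_{AB}$), with null tetrad $l^a=o^A\bar o^{A'}$, $n^a=\iota^A\bar\iota^{A'}$, $m^a=o^A\bar\iota^{A'}$, $\bar m^a=\iota^A\bar o^{A'}$, and put $$\rho=o^A\bar m^b\nabla_b o_A,\quad \tau=o^An^b\nabla_b o_A,\quad \varepsilon=\iota^Al^b\nabla_b o_A,\quad \beta=\iota^Am^b\nabla_b o_A,$$ $$\rho'=-\iota^Am^b\nabla_b\iota_A,\quad \tau'=-\iota^Al^b\nabla_b\iota_A,\quad \varepsilon'=-o^An^b\nabla_b\iota_A,\quad \beta'=-o^A\bar m^b\nabla_b\iota_A .$$ Let $\Psi_{ABCD}$ be the Weyl spinor, so that the Weyl tensor is $C_{abcd}=\Psi_{ABCD}\bar\epsilon_{A'B'}\bar\epsilon_{C'D'}+\bar\Psi_{A'B'C'D'}\epsilon_{AB}\epsilon_{CD}$,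 and let $\Psi_2=\Psi_{ABCD}o^Ao^B\iota^C\iota^D$, $\Psi_3=\Psi_{ABCD}o^A\iota^B\iota^C\iota^D$. Assume that $o^A$ is a shear-free ray, $o^Ao^B\nabla_{AA'}o_B=0$, and a repeated principal spinor, $\Psi_{ABCD}o^Bo^Co^D=0$, and that $\Psi_2\neq0$ everywhere. Define the 1-forms $$f_a=\rho n_a+\rho'l_a-\tau'm_a-\tau\bar m_a,\qquad \omega_a=-\varepsilon n_a+\varepsilon'l_a-\beta'm_a+\beta\bar m_a,\qquad B_a=-\rho n_a+\tau\bar m_a,$$ and, for a scalar field $\psi$ of GHP weight $\{p,0\}$ and conformal weight $w$, the conformal-GHP derivative and its projection $$\mathcal C_a\psi=\nabla_a\psi+\bigl(w f_a+p(\omega_a+B_a)\bigr)\psi,\qquad \tilde{\mathcal C}_{A'}\psi=o^A\mathcal C_{AA'}\psi .$$ Let $\eta=\tfrac13\Psi_2^{-1}\Psi_3$, which has weights $p=-2$, $w=-1$, and let $\phi=\Psi_2^{1/3}$ be any continuous branch of the cube root on an open set $U\subseteq M$. Then, on $U$, $$f_{AA'}=\nabla_{AA'}\log\phi-o_A\tilde{\mathcal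 C}_{A'}\eta,$$ where $\nabla_{AA'}\log\phi=\phi^{-1}\nabla_{AA'}\phi$. -/

import Mathlib

open scoped Manifold ContDiff
open Bundle

noncomputable section

namespace GHP

/-- The model space of a four-dimensional manifold. -/
abbrev E4 : Type := EuclideanSpace ℝ (Fin 4)

/-- The model fibre of the spinor bundle. -/
abbrev C2 : Type := Fin 2 → ℂ

/-- The diagonal entries `(+,-,-,-)`. -/
def sgn (i : Fin 4) : ℝ := if i = 0 then 1 else -1

/-! ### Lorentzian metrics, the Levi-Civita connection and its curvature -/

section Metric

variable {M : Type*} [TopologicalSpace M] [ChartedSpace E4 M] [IsManifold (𝓡 4) ∞ M]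

variable (M) in
/-- A smooth metric of signature `(+,-,-,-)` on a four-manifold. -/
structure LorentzMetric where
  val : ∀ x : M, TangentSpace (𝓡 4) x →L[ℝ] TangentSpace (𝓡 4) x →L[ℝ] ℝ
  symm : ∀ x u v, val x u v = val x v u
  signature : ∀ x, ∃ b : Module.Basis (Fin 4) ℝ (TangentSpace (𝓡 4) x),
    ∀ i j, val x (b i) (b j) = if i = j then sgn i else 0
  smooth : ContMDiff (𝓡 4) ((𝓡 4).prod 𝓘(ℝ, E4 →L[ℝ] E4 →L[ℝ] ℝ)) ∞
    (fun x ↦ TotalSpace.mk' (E4 →L[ℝ] E4 →L[ℝ] ℝ)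
      (E := fun x : M ↦ TangentSpace (𝓡 4) x →L[ℝ] TangentSpace (𝓡 4) x →L[ℝ] ℝ) x (val x))

variable (M) in
/-- Affine connections on `M`; `D Y x v` is `∇_v Y` at `x`. -/
abbrev Connection := CovariantDerivative (𝓡 4) E4 (TangentSpace (𝓡 4) : M → Type _)

/-- `D` is the Levi-Civita connection of `g`: torsion-free, and `∇g = 0`. -/
def IsLeviCivita (g : LorentzMetric M) (D : Connection M) : Prop :=
  D.torsion = 0 ∧
  ∀ (X Y : ∀ x : M, TangentSpace (𝓡 4) x) (x : M),
    MDifferentiableAt (𝓡 4) ((𝓡 4).prod 𝓘(ℝ, E4)) (fun y ↦ TotalSpace.mk' E4 y (X y)) x →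
    MDifferentiableAt (𝓡 4) ((𝓡 4).prod 𝓘(ℝ, E4)) (fun y ↦ TotalSpace.mk' E4 y (Y y)) x →
    ∀ v : TangentSpace (𝓡 4) x,
      mvfderiv (𝓡 4) (fun y ↦ g.val y (X y) (Y y)) x v
        = g.val x (D X x v) (Y x) + g.val x (X x) (D Y x v)

/-- `∇_X ∇_Y Z - ∇_Y ∇_X Z - ∇_[X,Y] Z` for vector fields `X, Y, Z`. -/
def curvature (D : Connection M) (X Y Z : ∀ x : M, TangentSpace (𝓡 4) x) (x : M) :
    TangentSpace (𝓡 4) x :=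
  D (fun y ↦ D Z y (Y y)) x (X x) - D (fun y ↦ D Z y (X y)) x (Y x)
    - D Z x (VectorField.mlieBracket (𝓡 4) X Y x)

/-- The Riemann tensor `R_{abcd} = g_{de} R_{abc}^e`, with
`(∇_a ∇_b - ∇_b ∇_a) V^e = R_{abc}^e V^c`, evaluated on tangent vectors by extending them to
vector fields that are smooth near `x` (the value does not depend on the extension). -/
def riemann (g : LorentzMetric M) (D : Connection M) (x : M)
    (a b c d : TangentSpace (𝓡 4) x) : ℝ :=
  g.val x (curvature D (FiberBundle.extend E4 a) (FiberBundle.extend E4 b)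
    (FiberBundle.extend E4 c) x) d

/-- The trace `g^{ab} F_{ab}` of a bilinear form, computed in an orthonormal basis. -/
def mtrace (g : LorentzMetric M) (x : M)
    (F : TangentSpace (𝓡 4) x → TangentSpace (𝓡 4) x → ℝ) : ℝ :=
  ∑ i, sgn i * F ((g.signature x).choose i) ((g.signature x).choose i)

/-- The Ricci tensor `R_{ab} = g^{cd} R_{acbd}`. -/
def ricci (g : LorentzMetric M) (D : Connection M) (x : M) (a b : TangentSpace (𝓡 4) x) : ℝ :=
  mtrace g x (fun c d ↦ riemann g D x a c b d)

/-- The scalar curvature `R = g^{ab} R_{ab}`. -/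
def scalarCurv (g : LorentzMetric M) (D : Connection M) (x : M) : ℝ :=
  mtrace g x (ricci g D x)

/-- The metric is Einstein: the trace-free Ricci tensor vanishes and `Λ = R/24` is constant. -/
def IsEinstein (g : LorentzMetric M) (D : Connection M) : Prop :=
  (∀ x a b, ricci g D x a b = scalarCurv g D x / 4 * g.val x a b) ∧
  ∃ L : ℝ, ∀ x, scalarCurv g D x / 24 = L

/-- The Weyl tensor `C_{abcd}` in dimension four. -/
def weyl (g : LorentzMetric M) (D : Connection M) (x : M)
    (a b c d : TangentSpace (𝓡 4) x) : ℝ :=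
  riemann g D x a b c d
    - (g.val x a c * ricci g D x b d - g.val x a d * ricci g D x b c
        - g.val x b c * ricci g D x a d + g.val x b d * ricci g D x a c) / 2
    + scalarCurv g D x / 6 * (g.val x a c * g.val x b d - g.val x a d * g.val x b c)

/-- Complexified tangent vectors: the pair `(u, w)` stands for `u + i w`. -/
abbrev CTangent (x : M) : Type := TangentSpace (𝓡 4) x × TangentSpace (𝓡 4) x

/-- The complex-linear extension of a real-linear function to complexified tangent vectors. -/
def cext {x : M} (f : TangentSpace (𝓡 4) x → ℂ) (u : CTangent x) : ℂ :=
  f u.1 + Complex.I * f u.2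

end Metric

/-! ### Spin structures, spin connection, spin dyads -/

section Spin

variable {M : Type*} [TopologicalSpace M] [ChartedSpace E4 M] [IsManifold (𝓡 4) ∞ M]
  {S : M → Type*} [TopologicalSpace (TotalSpace C2 S)]
  [∀ x, AddCommGroup (S x)] [∀ x, Module ℂ (S x)] [∀ x, TopologicalSpace (S x)]
  [∀ x, IsTopologicalAddGroup (S x)] [∀ x, ContinuousSMul ℝ (S x)]
  [FiberBundle C2 S] [VectorBundle ℝ C2 S] [ContMDiffVectorBundle ∞ C2 S (𝓡 4)]

/-- The complexified vector `α^A β̄^{A'}`, where `s α β` is its real part;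
its imaginary part is the real part of `-i α^A β̄^{A'} = α^A (iβ)̄^{A'}`. -/
def cvec {x : M} (s : S x →L[ℝ] S x →L[ℝ] TangentSpace (𝓡 4) x) (α β : S x) : CTangent x :=
  (s α β, s α (Complex.I • β))

variable (S) in
/-- A spin structure on `(M, g)`, with spinor bundle `S` (complex of rank two): a smooth complex
symplectic form `ε_{AB}` on `S` and a smooth identification `TM ⊗ ℂ = S ⊗ S̄`, compatible
with complex conjugation, such that `g_{ab} = ε_{AB} ε̄_{A'B'}`.
The identification is given by the real part `sol α β` of the vector `α^A β̄^{A'}`. -/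
structure SpinStructure (g : LorentzMetric M) where
  /-- `eps x α β = ε_{AB} α^A β^B = α_A β^A`. -/
  eps : ∀ x : M, S x →L[ℝ] S x →L[ℝ] ℂ
  eps_smul : ∀ x (c : ℂ) (α β : S x), eps x (c • α) β = c * eps x α β
  eps_alt : ∀ x (α : S x), eps x α α = 0
  eps_nondeg : ∀ x (α : S x), (∀ β, eps x α β = 0) → α = 0
  eps_smooth : ContMDiff (𝓡 4) ((𝓡 4).prod 𝓘(ℝ, C2 →L[ℝ] C2 →L[ℝ] ℂ)) ∞
    (fun x ↦ TotalSpace.mk' (C2 →L[ℝ] C2 →L[ℝ] ℂ)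
      (E := fun x : M ↦ S x →L[ℝ] S x →L[ℝ] ℂ) x (eps x))
  sol : ∀ x : M, S x →L[ℝ] S x →L[ℝ] TangentSpace (𝓡 4) x
  sol_symm : ∀ x (α β : S x), sol x α β = sol x β α
  sol_I : ∀ x (α β : S x), sol x (Complex.I • α) (Complex.I • β) = sol x α β
  sol_metric : ∀ x (α β γ δ : S x),
    cext (fun u ↦ cext (fun v ↦ (g.val x u v : ℂ)) (cvec (sol x) γ δ)) (cvec (sol x) α β)
      = eps x α γ * (starRingEnd ℂ) (eps x β δ)
  sol_smooth : ContMDiff (𝓡 4) ((𝓡 4).prod 𝓘(ℝ, C2 →L[ℝ] C2 →L[ℝ] E4)) ∞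
    (fun x ↦ TotalSpace.mk' (C2 →L[ℝ] C2 →L[ℝ] E4)
      (E := fun x : M ↦ S x →L[ℝ] S x →L[ℝ] TangentSpace (𝓡 4) x) x (sol x))

variable (S) in
/-- Connections on the spinor bundle; `DS ψ x v` is `∇_v ψ` at `x`. -/
abbrev SpinorConnection := CovariantDerivative (𝓡 4) C2 S

/-- `DS` is the spin connection, the extension of the Levi-Civita connection `D` to spinors: it is
complex linear, `∇ε = 0`, and `∇_v (α^A β̄^{A'}) = (∇_v α^A) β̄^{A'} + α^A (∇_v β̄^{A'})`. -/
def IsSpinConnection {g : LorentzMetric M} (σ : SpinStructure S g) (D : Connection M)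
    (DS : SpinorConnection S) : Prop :=
  ∀ (α β : ∀ x : M, S x) (x : M),
    MDifferentiableAt (𝓡 4) ((𝓡 4).prod 𝓘(ℝ, C2)) (fun y ↦ TotalSpace.mk' C2 y (α y)) x →
    MDifferentiableAt (𝓡 4) ((𝓡 4).prod 𝓘(ℝ, C2)) (fun y ↦ TotalSpace.mk' C2 y (β y)) x →
    ∀ v : TangentSpace (𝓡 4) x,
      DS (fun y ↦ Complex.I • α y) x v = Complex.I • DS α x v ∧
      mvfderiv (𝓡 4) (fun y ↦ σ.eps y (α y) (β y)) x v
        = σ.eps x (DS α x v) (β x) + σ.eps x (α x) (DS β x v) ∧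
      D (fun y ↦ σ.sol y (α y) (β y)) x v
        = σ.sol x (DS α x v) (β x) + σ.sol x (α x) (DS β x v)

/-- The derivative `∇_u ψ` of a spinor field in a complexified direction. -/
def nablaC (DS : SpinorConnection S) (ψ : ∀ x : M, S x) {x : M} (u : CTangent x) : S x :=
  DS ψ x u.1 + Complex.I • DS ψ x u.2

/-- A smooth spin dyad `(o^A, ι^A)`, normalised by `o_A ι^A = 1`. -/
structure SpinDyad {g : LorentzMetric M} (σ : SpinStructure S g) where
  o : ∀ x : M, S x
  ι : ∀ x : M, S x
  o_smooth : ContMDiff (𝓡 4) ((𝓡 4).prod 𝓘(ℝ, C2)) ∞ (fun x ↦ TotalSpace.mk' C2 x (o x))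
  ι_smooth : ContMDiff (𝓡 4) ((𝓡 4).prod 𝓘(ℝ, C2)) ∞ (fun x ↦ TotalSpace.mk' C2 x (ι x))
  normalised : ∀ x, σ.eps x (o x) (ι x) = 1

variable {g : LorentzMetric M} {σ : SpinStructure S g}

/-- `o^A o^B ∇_{AA'} o_B = 0`; note `ξ^B η_B = ε(η, ξ)`. -/
def IsShearFreeRay (σ : SpinStructure S g) (DS : SpinorConnection S) (o : ∀ x : M, S x) : Prop :=
  ∀ x (β : S x), σ.eps x (nablaC DS o (cvec (σ.sol x) (o x) β)) (o x) = 0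

namespace SpinDyad

variable (d : SpinDyad σ)

/-! The null tetrad, and the associated complex 1-forms `l_a, n_a, m_a, m̄_a`. -/

/-- `l^a = o^A ō^{A'}` -/
def l (x : M) : CTangent x := cvec (σ.sol x) (d.o x) (d.o x)

/-- `n^a = ι^A ῑ^{A'}` -/
def n (x : M) : CTangent x := cvec (σ.sol x) (d.ι x) (d.ι x)

/-- `m^a = o^A ῑ^{A'}` -/
def m (x : M) : CTangent x := cvec (σ.sol x) (d.o x) (d.ι x)

/-- `m̄^a = ι^A ō^{A'}` -/
def mbar (x : M) : CTangent x := cvec (σ.sol x) (d.ι x) (d.o x)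

variable (g) in
/-- The 1-form `u_a` of a complexified vector `u^a`. -/
def lower {x : M} (u : CTangent x) (v : TangentSpace (𝓡 4) x) : ℂ :=
  cext (fun w ↦ (g.val x w v : ℂ)) u

/-! The spin coefficients. The primed ones arise from the unprimed ones by
`o ↦ iι`, `ι ↦ io`, under which `l ↔ n` and `m ↔ m̄`. -/

variable (DS : SpinorConnection S)

/-- `ρ = o^A m̄^b ∇_b o_A` -/
def rho (x : M) : ℂ := σ.eps x (nablaC DS d.o (d.mbar x)) (d.o x)

/-- `τ = o^A n^b ∇_b o_A` -/
def tau (x : M) : ℂ := σ.eps x (nablaC DS d.o (d.n x)) (d.o x)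

/-- `ε = ι^A l^b ∇_b o_A` -/
def epsilon (x : M) : ℂ := σ.eps x (nablaC DS d.o (d.l x)) (d.ι x)

/-- `β = ι^A m^b ∇_b o_A` -/
def beta (x : M) : ℂ := σ.eps x (nablaC DS d.o (d.m x)) (d.ι x)

/-- `ρ' = -ι^A m^b ∇_b ι_A` -/
def rho' (x : M) : ℂ := -σ.eps x (nablaC DS d.ι (d.m x)) (d.ι x)

/-- `τ' = -ι^A l^b ∇_b ι_A` -/
def tau' (x : M) : ℂ := -σ.eps x (nablaC DS d.ι (d.l x)) (d.ι x)

/-- `ε' = -o^A n^b ∇_b ι_A` -/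
def epsilon' (x : M) : ℂ := -σ.eps x (nablaC DS d.ι (d.n x)) (d.o x)

/-- `β' = -o^A m̄^b ∇_b ι_A` -/
def beta' (x : M) : ℂ := -σ.eps x (nablaC DS d.ι (d.mbar x)) (d.o x)

/-- `f_a = ρ n_a + ρ' l_a - τ' m_a - τ m̄_a` -/
def f (x : M) (v : TangentSpace (𝓡 4) x) : ℂ :=
  d.rho DS x * lower g (d.n x) v + d.rho' DS x * lower g (d.l x) v
    - d.tau' DS x * lower g (d.m x) v - d.tau DS x * lower g (d.mbar x) v

/-- `ω_a = -ε n_a + ε' l_a - β' m_a + β m̄_a` -/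
def omega (x : M) (v : TangentSpace (𝓡 4) x) : ℂ :=
  -d.epsilon DS x * lower g (d.n x) v + d.epsilon' DS x * lower g (d.l x) v
    - d.beta' DS x * lower g (d.m x) v + d.beta DS x * lower g (d.mbar x) v

/-- `B_a = -ρ n_a + τ m̄_a` -/
def B (x : M) (v : TangentSpace (𝓡 4) x) : ℂ :=
  -d.rho DS x * lower g (d.n x) v + d.tau DS x * lower g (d.mbar x) v

/-- The conformal-GHP connection on scalars of GHP weight `{p,0}` and conformal weight `w`:
`C_a φ = ∇_a φ + (w f_a + p (ω_a + B_a)) φ`. -/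
def confGHP (p w : ℤ) (φ : M → ℂ) (x : M) (v : TangentSpace (𝓡 4) x) : ℂ :=
  mvfderiv (𝓡 4) φ x v + (w * d.f DS x v + p * (d.omega DS x v + d.B DS x v)) * φ x

/-- The projected connection: `projC p w φ x β = β̄^{A'} C̃_{A'} φ = o^A β̄^{A'} C_{AA'} φ`. -/
def projC (p w : ℤ) (φ : M → ℂ) (x : M) (β : S x) : ℂ :=
  cext (d.confGHP DS p w φ x) (cvec (σ.sol x) (d.o x) β)

variable (D : Connection M)

/-- The complex-multilinear extension of the Weyl tensor. -/
def weylC (g : LorentzMetric M) (D : Connection M) {x : M} (a b c e : CTangent x) : ℂ :=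
  cext (fun a' ↦ cext (fun b' ↦ cext (fun c' ↦ cext (fun e' ↦
    (weyl g D x a' b' c' e' : ℂ)) e) c) b) a

/-- The Weyl spinor `Ψ_{ABCD} = (1/4) C_{AA'BB'CC'DD'} ε̄^{A'B'} ε̄^{C'D'}`, where
`ε̄^{A'B'} = ō^{A'} ῑ^{B'} - ῑ^{A'} ō^{B'}`. -/
def weylSpinor (x : M) (α β γ δ : S x) : ℂ :=
  let K (a b c e : S x) : ℂ := weylC g D (cvec (σ.sol x) α a) (cvec (σ.sol x) β b)
    (cvec (σ.sol x) γ c) (cvec (σ.sol x) δ e)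
  (K (d.o x) (d.ι x) (d.o x) (d.ι x) - K (d.ι x) (d.o x) (d.o x) (d.ι x)
    - K (d.o x) (d.ι x) (d.ι x) (d.o x) + K (d.ι x) (d.o x) (d.ι x) (d.o x)) / 4

/-- `o^A` is a repeated principal spinor: `Ψ_{ABCD} o^B o^C o^D = 0`. -/
def IsRepeatedPrincipal : Prop :=
  ∀ x (α : S x), d.weylSpinor D x α (d.o x) (d.o x) (d.o x) = 0

/-- `Ψ₂ = Ψ_{ABCD} o^A o^B ι^C ι^D` -/
def Psi2 (x : M) : ℂ := d.weylSpinor D x (d.o x) (d.o x) (d.ι x) (d.ι x)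

/-- `Ψ₃ = Ψ_{ABCD} o^A ι^B ι^C ι^D` -/
def Psi3 (x : M) : ℂ := d.weylSpinor D x (d.o x) (d.ι x) (d.ι x) (d.ι x)

/-- `η = Ψ₃ / (3 Ψ₂)` -/
def eta (x : M) : ℂ := d.Psi3 D x / (3 * d.Psi2 D x)

end SpinDyad

end Spin

end GHP

end

open scoped Manifold ContDiff
open Bundle

noncomputable section

namespace GHP

section Frame

variable {M : Type*} [TopologicalSpace M] [ChartedSpace E4 M] [IsManifold (𝓡 4) ∞ M]

/-- The vector field `X` is of class `C^n` at `x`. -/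
abbrev FieldAt (n : WithTop ℕ∞) (X : ∀ x : M, TangentSpace (𝓡 4) x) (x : M) : Prop :=
  ContMDiffAt (𝓡 4) ((𝓡 4).prod 𝓘(ℝ, E4)) n (fun y ↦ TotalSpace.mk' E4 y (X y)) x

/-- The vector field `X` is differentiable at `x`. -/
abbrev FieldDiffAt (X : ∀ x : M, TangentSpace (𝓡 4) x) (x : M) : Prop :=
  MDifferentiableAt (𝓡 4) ((𝓡 4).prod 𝓘(ℝ, E4)) (fun y ↦ TotalSpace.mk' E4 y (X y)) x

/-- A global smooth frame with constant Gram matrix. -/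
structure ConstFrame (g : LorentzMetric M) where
  vec : Fin 4 → ∀ x : M, TangentSpace (𝓡 4) x
  smooth : ∀ i x, FieldAt ∞ (vec i) x
  gram : Matrix (Fin 4) (Fin 4) ℝ
  gramInv : Matrix (Fin 4) (Fin 4) ℝ
  inv_mul : gramInv * gram = 1
  val_vec : ∀ x i j, g.val x (vec i x) (vec j x) = gram i j

variable {g : LorentzMetric M}

theorem LorentzMetric.contMDiffAt_val {n : WithTop ℕ∞} (hn : n ≤ ∞)
    {X Y : ∀ x : M, TangentSpace (𝓡 4) x} {x : M} (hX : FieldAt n X x) (hY : FieldAt n Y x) :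
    ContMDiffAt (𝓡 4) 𝓘(ℝ) n (fun y ↦ g.val y (X y) (Y y)) x := by
  have : ContMDiffAt (𝓡 4) ((𝓡 4).prod 𝓘(ℝ)) n
      (fun m ↦ TotalSpace.mk' ℝ (E := Bundle.Trivial M ℝ) m (g.val m (X m) (Y m))) x := by
    apply ContMDiffAt.clm_bundle_apply₂ (F₁ := E4) (F₂ := E4)
    · exact (g.smooth x).of_le hn
    · exact hX
    · exact hY
  simp only [contMDiffAt_totalSpace] at this
  exact this.2

theorem LorentzMetric.mdifferentiableAt_val
    {X Y : ∀ x : M, TangentSpace (𝓡 4) x} {x : M} (hX : FieldDiffAt X x) (hY : FieldDiffAt Y x) :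
    MDifferentiableAt (𝓡 4) 𝓘(ℝ) (fun y ↦ g.val y (X y) (Y y)) x := by
  have : MDifferentiableAt (𝓡 4) ((𝓡 4).prod 𝓘(ℝ))
      (fun m ↦ TotalSpace.mk' ℝ (E := Bundle.Trivial M ℝ) m (g.val m (X m) (Y m))) x := by
    apply MDifferentiableAt.clm_bundle_apply₂ (F₁ := E4) (F₂ := E4)
    · exact (g.smooth x).mdifferentiableAt (by simp)
    · exact hX
    · exact hY
  simp only [mdifferentiableAt_totalSpace] at this
  exact this.2

namespace ConstFrame

variable (e : ConstFrame g)

theorem diffAt (i : Fin 4) (x : M) : FieldDiffAt (e.vec i) x :=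
  (e.smooth i x).mdifferentiableAt (by simp)

theorem mul_inv : e.gram * e.gramInv = 1 := mul_eq_one_comm.1 e.inv_mul

theorem gram_symm (x : M) (i j : Fin 4) : e.gram i j = e.gram j i := by
  rw [← e.val_vec x, g.symm, e.val_vec]

/-- The `i`-th coefficient of a tangent vector in the frame. -/
def co (i : Fin 4) {x : M} (v : TangentSpace (𝓡 4) x) : ℝ :=
  ∑ j, g.val x v (e.vec j x) * e.gramInv j i

theorem co_add (i : Fin 4) {x : M} (v w : TangentSpace (𝓡 4) x) :
    e.co i (v + w) = e.co i v + e.co i w := by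
  simp [co, add_mul, Finset.sum_add_distrib]

theorem co_smul (i : Fin 4) {x : M} (r : ℝ) (v : TangentSpace (𝓡 4) x) :
    e.co i (r • v) = r * e.co i v := by
  simp [co, Finset.mul_sum, mul_assoc]

/-- `co` as a linear map. -/
def coL (i : Fin 4) (x : M) : TangentSpace (𝓡 4) x →ₗ[ℝ] ℝ where
  toFun := e.co i
  map_add' := e.co_add i
  map_smul' := e.co_smul i

theorem co_vec (i j : Fin 4) (x : M) : e.co i (e.vec j x) = if j = i then 1 else 0 := by
  have := congrFun (congrFun e.mul_inv j) i
  rw [Matrix.mul_apply, Matrix.one_apply] at this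
  simpa [co, e.val_vec] using this

theorem linearIndependent (x : M) : LinearIndependent ℝ (fun i ↦ e.vec i x) := by
  rw [Fintype.linearIndependent_iff]
  intro c hc i
  have h : e.coL i x (∑ j, c j • e.vec j x) = c i := by
    simp only [map_sum, map_smul, coL, LinearMap.coe_mk, AddHom.coe_mk, e.co_vec]
    simp
  rw [← h, hc, map_zero]

theorem sum_co (x : M) (v : TangentSpace (𝓡 4) x) : ∑ i, e.co i v • e.vec i x = v := by
  have hc : Fintype.card (Fin 4) = Module.finrank ℝ (TangentSpace (𝓡 4) x) := by
    change _ = Module.finrank ℝ E4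
    simp
  let b := basisOfLinearIndependentOfCardEqFinrank (e.linearIndependent x) hc
  have hb : ∀ i, b i = e.vec i x := fun i ↦ by simp [b]
  have hv : v = ∑ j, b.repr v j • e.vec j x := by
    conv_lhs => rw [← b.sum_repr v]
    simp [hb]
  have h : ∀ i, e.co i v = b.repr v i := fun i ↦ by
    have : e.coL i x v = b.repr v i := by
      conv_lhs => rw [hv]
      simp only [map_sum, map_smul, coL, LinearMap.coe_mk, AddHom.coe_mk, e.co_vec]
      simp
    exact this
  simp only [h]
  exact hv.symm

theorem contMDiffAt_co {n : WithTop ℕ∞} (hn : n ≤ ∞) {X : ∀ x : M, TangentSpace (𝓡 4) x} {x : M}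
    (hX : FieldAt n X x) (i : Fin 4) : ContMDiffAt (𝓡 4) 𝓘(ℝ) n (fun y ↦ e.co i (X y)) x :=
  contMDiffAt_finsetSum fun j _ ↦
    (LorentzMetric.contMDiffAt_val hn hX ((e.smooth j x).of_le hn)).mul contMDiffAt_const

theorem mdifferentiableAt_co {X : ∀ x : M, TangentSpace (𝓡 4) x} {x : M}
    (hX : FieldDiffAt X x) (i : Fin 4) :
    MDifferentiableAt (𝓡 4) 𝓘(ℝ) (fun y ↦ e.co i (X y)) x := by
  unfold co
  simp only [Fin.sum_univ_four]
  have h : ∀ j, MDifferentiableAt (𝓡 4) 𝓘(ℝ)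
      (fun y ↦ g.val y (X y) (e.vec j y) * e.gramInv j i) x := fun j ↦
    (LorentzMetric.mdifferentiableAt_val hX (e.diffAt j x)).mul mdifferentiableAt_const
  exact (((h 0).add (h 1)).add (h 2)).add (h 3)

theorem fieldAt_of_co {n : WithTop ℕ∞} (hn : n ≤ ∞) {X : ∀ x : M, TangentSpace (𝓡 4) x} {x : M}
    (h : ∀ i, ContMDiffAt (𝓡 4) 𝓘(ℝ) n (fun y ↦ e.co i (X y)) x) : FieldAt n X x := by
  have : FieldAt n (fun y ↦ ∑ i, e.co i (X y) • e.vec i y) x :=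
    ContMDiffAt.sum_section fun i _ ↦ (h i).smul_section ((e.smooth i x).of_le hn)
  simpa only [e.sum_co] using this

theorem fieldDiffAt_of_co {X : ∀ x : M, TangentSpace (𝓡 4) x} {x : M}
    (h : ∀ i, MDifferentiableAt (𝓡 4) 𝓘(ℝ) (fun y ↦ e.co i (X y)) x) : FieldDiffAt X x := by
  have : FieldDiffAt (fun y ↦ ∑ i, e.co i (X y) • e.vec i y) x :=
    MDifferentiableAt.sum_section fun i _ ↦ (h i).smul_section (e.diffAt i x)
  simpa only [e.sum_co] using this

end ConstFrame

variable (M) in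
theorem isManifold_minSmoothness : IsManifold (𝓡 4) (minSmoothness ℝ 2) M :=
  .of_le (n := ∞) (by
    rw [minSmoothness_of_isRCLikeNormedField]
    exact ENat.LEInfty.out)

theorem FieldAt.mlieBracket {m n : ℕ∞} (hmn : m + 1 ≤ n) {X Y : ∀ x : M, TangentSpace (𝓡 4) x}
    {x : M} (hX : FieldAt n X x) (hY : FieldAt n Y x) :
    FieldAt m (VectorField.mlieBracket (𝓡 4) X Y) x := by
  have := isManifold_minSmoothness M
  have : IsManifold (𝓡 4) ((n : WithTop ℕ∞) + 1) M := .of_le (n := ∞) (by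
    exact_mod_cast (le_top : n + 1 ≤ ⊤))
  refine ContMDiffAt.mlieBracket_vectorField (n := n) hX hY ?_
  simp only [minSmoothness_of_isRCLikeNormedField]
  exact_mod_cast hmn

theorem jacobi_mlieBracket {X Y Z : ∀ x : M, TangentSpace (𝓡 4) x} {x : M}
    (hX : FieldAt 2 X x) (hY : FieldAt 2 Y x) (hZ : FieldAt 2 Z x) :
    VectorField.mlieBracket (𝓡 4) X (VectorField.mlieBracket (𝓡 4) Y Z) x
      = VectorField.mlieBracket (𝓡 4) (VectorField.mlieBracket (𝓡 4) X Y) Z x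
        + VectorField.mlieBracket (𝓡 4) Y (VectorField.mlieBracket (𝓡 4) X Z) x := by
  have : IsManifold (𝓡 4) (minSmoothness ℝ 3) M := .of_le (n := ∞) (by
    rw [minSmoothness_of_isRCLikeNormedField]
    exact ENat.LEInfty.out)
  apply VectorField.leibniz_identity_mlieBracket_apply <;>
    simpa only [minSmoothness_of_isRCLikeNormedField]

namespace ConstFrame

/-- A derivative `X f` is a coefficient of the bracket `[X, f E₀] - f [X, E₀]`. -/
theorem mvfderiv_eq_co (e : ConstFrame g) {f : M → ℝ} {X : ∀ x : M, TangentSpace (𝓡 4) x} {x : M}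
    (hf : MDifferentiableAt (𝓡 4) 𝓘(ℝ) f x) :
    mvfderiv (𝓡 4) f x (X x)
      = e.co 0 (VectorField.mlieBracket (𝓡 4) X (f • e.vec 0) x)
        - f x * e.co 0 (VectorField.mlieBracket (𝓡 4) X (e.vec 0) x) := by
  have := isManifold_minSmoothness M
  rw [VectorField.mlieBracket_smul_right hf (e.diffAt 0 x), e.co_add, e.co_smul, e.co_smul,
    e.co_vec]
  simp

theorem contMDiffAt_mvfderiv (e : ConstFrame g) {m n : ℕ∞} (hmn : m + 1 ≤ n) {f : M → ℝ}
    {X : ∀ x : M, TangentSpace (𝓡 4) x} {x : M}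
    (hf : ContMDiffAt (𝓡 4) 𝓘(ℝ) n f x) (hX : FieldAt n X x) :
    ContMDiffAt (𝓡 4) 𝓘(ℝ) m (fun y ↦ mvfderiv (𝓡 4) f y (X y)) x := by
  have hmn' : (m : WithTop ℕ∞) ≤ n := by exact_mod_cast le_self_add.trans hmn
  have hm : (m : WithTop ℕ∞) ≤ ∞ := by exact_mod_cast le_top
  have hn : (n : WithTop ℕ∞) ≤ ∞ := by exact_mod_cast le_top
  have hn1 : (1 : WithTop ℕ∞) ≤ n := by exact_mod_cast le_add_self.trans hmn
  have h0 : FieldAt n (e.vec 0) x := (e.smooth 0 x).of_le hn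
  have key : ContMDiffAt (𝓡 4) 𝓘(ℝ) m (fun y ↦
      e.co 0 (VectorField.mlieBracket (𝓡 4) X (f • e.vec 0) y)
        - f y * e.co 0 (VectorField.mlieBracket (𝓡 4) X (e.vec 0) y)) x :=
    (e.contMDiffAt_co hm (FieldAt.mlieBracket hmn hX (hf.smul_section h0)) 0).sub
      ((hf.of_le hmn').mul (e.contMDiffAt_co hm (FieldAt.mlieBracket hmn hX h0) 0))
  refine key.congr_of_eventuallyEq ?_
  filter_upwards [(contMDiffAt_iff_contMDiffAt_nhds (by simp)).1 (hf.of_le hn1)] with y hy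
  exact e.mvfderiv_eq_co (hy.mdifferentiableAt one_ne_zero)

theorem mvfderiv_mlieBracket (e : ConstFrame g) {f : M → ℝ}
    {X Y : ∀ x : M, TangentSpace (𝓡 4) x} {x : M}
    (hf : ContMDiffAt (𝓡 4) 𝓘(ℝ) 2 f x) (hX : FieldAt 2 X x) (hY : FieldAt 2 Y x) :
    mvfderiv (𝓡 4) f x (VectorField.mlieBracket (𝓡 4) X Y x)
      = mvfderiv (𝓡 4) (fun y ↦ mvfderiv (𝓡 4) f y (Y y)) x (X x)
        - mvfderiv (𝓡 4) (fun y ↦ mvfderiv (𝓡 4) f y (X y)) x (Y x) := by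
  have := isManifold_minSmoothness M
  have h2 : (2 : WithTop ℕ∞) ≤ ∞ := by exact ENat.LEInfty.out
  have h0 : FieldAt 2 (e.vec 0) x := (e.smooth 0 x).of_le h2
  have hd : MDifferentiableAt (𝓡 4) 𝓘(ℝ) f x := hf.mdifferentiableAt (by simp)
  have h12 : (1 : ℕ∞) + 1 ≤ 2 := by norm_num
  have hbr : ∀ {Z : ∀ x : M, TangentSpace (𝓡 4) x}, FieldAt 2 Z x →
      FieldDiffAt (VectorField.mlieBracket (𝓡 4) Z (e.vec 0)) x := fun hZ ↦
    (FieldAt.mlieBracket h12 hZ h0).mdifferentiableAt one_ne_zero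
  have hdf : ∀ {Z : ∀ x : M, TangentSpace (𝓡 4) x}, FieldAt 2 Z x →
      MDifferentiableAt (𝓡 4) 𝓘(ℝ) (fun y ↦ mvfderiv (𝓡 4) f y (Z y)) x := fun hZ ↦
    (e.contMDiffAt_mvfderiv h12 hf hZ).mdifferentiableAt one_ne_zero
  have hloc : ∀ Z : ∀ x : M, TangentSpace (𝓡 4) x,
      VectorField.mlieBracket (𝓡 4) Z (f • e.vec 0) =ᶠ[nhds x]
        (fun y ↦ mvfderiv (𝓡 4) f y (Z y)) • e.vec 0
          + f • VectorField.mlieBracket (𝓡 4) Z (e.vec 0) := fun Z ↦ by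
    filter_upwards [(contMDiffAt_iff_contMDiffAt_nhds (by simp)).1 (hf.of_le one_le_two)] with y hy
    exact VectorField.mlieBracket_smul_right (hy.mdifferentiableAt one_ne_zero) (e.diffAt 0 y)
  have expand : ∀ {Z W : ∀ x : M, TangentSpace (𝓡 4) x}, FieldAt 2 Z x → FieldAt 2 W x →
      VectorField.mlieBracket (𝓡 4) Z (VectorField.mlieBracket (𝓡 4) W (f • e.vec 0)) x
        = mvfderiv (𝓡 4) (fun y ↦ mvfderiv (𝓡 4) f y (W y)) x (Z x) • e.vec 0 x
          + mvfderiv (𝓡 4) f x (W x) • VectorField.mlieBracket (𝓡 4) Z (e.vec 0) x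
          + (mvfderiv (𝓡 4) f x (Z x) • VectorField.mlieBracket (𝓡 4) W (e.vec 0) x
            + f x • VectorField.mlieBracket (𝓡 4) Z
                (VectorField.mlieBracket (𝓡 4) W (e.vec 0)) x) := fun {Z W} hZ hW ↦ by
    rw [Filter.EventuallyEq.mlieBracket_vectorField_eq (Filter.EventuallyEq.refl _ Z) (hloc W),
      VectorField.mlieBracket_add_right ((hdf hW).smul_section (e.diffAt 0 x))
        (hd.smul_section (hbr hW)),
      VectorField.mlieBracket_smul_right (hdf hW) (e.diffAt 0 x),
      VectorField.mlieBracket_smul_right hd (hbr hW)]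
  have J0 := jacobi_mlieBracket hX hY h0
  have J := jacobi_mlieBracket hX hY (hf.smul_section h0)
  rw [expand hX hY, expand hY hX, VectorField.mlieBracket_smul_right hd (e.diffAt 0 x), J0] at J
  have := congrArg (e.co 0) J
  simp only [e.co_add, e.co_smul, e.co_vec] at this
  simp only [if_true, mul_one] at this
  linear_combination -this

end ConstFrame

end Frame

section Connection

variable {M : Type*} [TopologicalSpace M] [ChartedSpace E4 M] [IsManifold (𝓡 4) ∞ M]
  {g : LorentzMetric M} {D : Connection M}

theorem IsLeviCivita.torsion_free (hD : IsLeviCivita g D) {X Y : ∀ x : M, TangentSpace (𝓡 4) x}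
    {x : M} (hX : FieldDiffAt X x) (hY : FieldDiffAt Y x) :
    D Y x (X x) - D X x (Y x) = VectorField.mlieBracket (𝓡 4) X Y x :=
  (CovariantDerivative.torsion_eq_zero_iff D).1 hD.1 hX hY

theorem FieldAt.eventually_diffAt {n : WithTop ℕ∞} (hn : 1 ≤ n)
    {X : ∀ x : M, TangentSpace (𝓡 4) x} {x : M} (hX : FieldAt n X x) :
    ∀ᶠ y in nhds x, FieldDiffAt X y :=
  ((contMDiffAt_iff_contMDiffAt_nhds (by simp)).1 (hX.of_le hn)).mono
    fun _ hy ↦ hy.mdifferentiableAt one_ne_zero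

namespace ConstFrame

variable (e : ConstFrame g)

theorem mvfderiv_gram {i j : Fin 4} (x : M) (v : TangentSpace (𝓡 4) x) :
    mvfderiv (𝓡 4) (fun y ↦ g.val y (e.vec i y) (e.vec j y)) x v = 0 := by
  simp only [e.val_vec, mvfderiv_const]
  rfl

theorem val_cov_skew (hD : IsLeviCivita g D) (i j : Fin 4) (x : M) (v : TangentSpace (𝓡 4) x) :
    g.val x (D (e.vec i) x v) (e.vec j x) = - g.val x (D (e.vec j) x v) (e.vec i x) := by
  have := hD.2 (e.vec i) (e.vec j) x (e.diffAt i x) (e.diffAt j x) v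
  rw [e.mvfderiv_gram, g.symm x (e.vec i x)] at this
  linarith

theorem koszul (hD : IsLeviCivita g D) (i j k : Fin 4) (x : M) :
    2 * g.val x (D (e.vec j) x (e.vec i x)) (e.vec k x)
      = g.val x (VectorField.mlieBracket (𝓡 4) (e.vec i) (e.vec j) x) (e.vec k x)
        - g.val x (VectorField.mlieBracket (𝓡 4) (e.vec j) (e.vec k) x) (e.vec i x)
        + g.val x (VectorField.mlieBracket (𝓡 4) (e.vec k) (e.vec i) x) (e.vec j x) := by
  have ht : ∀ a b, VectorField.mlieBracket (𝓡 4) (e.vec a) (e.vec b) x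
      = D (e.vec b) x (e.vec a x) - D (e.vec a) x (e.vec b x) := fun a b ↦
    (hD.torsion_free (e.diffAt a x) (e.diffAt b x)).symm
  have s := fun a b ↦ e.val_cov_skew hD a b x
  simp only [ht, map_sub, sub_apply]
  linarith [s i j (e.vec k x), s i k (e.vec j x), s j k (e.vec i x)]

theorem fieldAt_cov_vec (hD : IsLeviCivita g D) (i j : Fin 4) (x : M) :
    FieldAt ∞ (fun y ↦ D (e.vec j) y (e.vec i y)) x := by
  have hbr : ∀ a b c, ContMDiffAt (𝓡 4) 𝓘(ℝ) ∞ (fun y ↦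
      g.val y (VectorField.mlieBracket (𝓡 4) (e.vec a) (e.vec b) y) (e.vec c y)) x := fun a b c ↦
    LorentzMetric.contMDiffAt_val le_rfl
      (FieldAt.mlieBracket (m := ⊤) (n := ⊤) le_rfl (e.smooth a x) (e.smooth b x)) (e.smooth c x)
  have hA : ∀ k, ContMDiffAt (𝓡 4) 𝓘(ℝ) ∞
      (fun y ↦ g.val y (D (e.vec j) y (e.vec i y)) (e.vec k y)) x := fun k ↦ by
    have h2 : (fun y ↦ g.val y (D (e.vec j) y (e.vec i y)) (e.vec k y)) = fun y ↦
        (g.val y (VectorField.mlieBracket (𝓡 4) (e.vec i) (e.vec j) y) (e.vec k y)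
        - g.val y (VectorField.mlieBracket (𝓡 4) (e.vec j) (e.vec k) y) (e.vec i y)
        + g.val y (VectorField.mlieBracket (𝓡 4) (e.vec k) (e.vec i) y) (e.vec j y)) * 2⁻¹ := by
      funext y
      rw [← e.koszul hD]
      ring
    rw [h2]
    exact (((hbr i j k).sub (hbr j k i)).add (hbr k i j)).mul contMDiffAt_const
  exact e.fieldAt_of_co le_rfl fun k ↦
    contMDiffAt_finsetSum fun m _ ↦ (hA m).mul contMDiffAt_const

/-- The connection in terms of the frame. -/
theorem cov_eq_sum {Z : ∀ x : M, TangentSpace (𝓡 4) x} {x : M} (hZ : FieldDiffAt Z x)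
    (v : TangentSpace (𝓡 4) x) :
    D Z x v = ∑ k, (mvfderiv (𝓡 4) (fun y ↦ e.co k (Z y)) x v • e.vec k x
      + e.co k (Z x) • D (e.vec k) x v) := by
  have hZ' : Z = (fun y ↦ e.co 0 (Z y)) • e.vec 0 + (fun y ↦ e.co 1 (Z y)) • e.vec 1
      + (fun y ↦ e.co 2 (Z y)) • e.vec 2 + (fun y ↦ e.co 3 (Z y)) • e.vec 3 := by
    funext y
    have := e.sum_co y (Z y)
    rw [Fin.sum_univ_four] at this
    exact this.symm
  have hc := fun i ↦ e.mdifferentiableAt_co hZ i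
  have hs : ∀ i, FieldDiffAt ((fun y ↦ e.co i (Z y)) • e.vec i) x := fun i ↦
    (hc i).smul_section (e.diffAt i x)
  have hl : ∀ i, D ((fun y ↦ e.co i (Z y)) • e.vec i) x v
      = mvfderiv (𝓡 4) (fun y ↦ e.co i (Z y)) x v • e.vec i x
        + e.co i (Z x) • D (e.vec i) x v := fun i ↦ by
    rw [D.isCovariantDerivativeOnUniv.leibniz (e.diffAt i x) (hc i)]
    simp [add_comm]
  have h1 := D.isCovariantDerivativeOnUniv.add (hs 0) (hs 1)
  have h2 := D.isCovariantDerivativeOnUniv.add (mdifferentiableAt_add_section (hs 0) (hs 1)) (hs 2)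
  have h3 := D.isCovariantDerivativeOnUniv.add (mdifferentiableAt_add_section
    (mdifferentiableAt_add_section (hs 0) (hs 1)) (hs 2)) (hs 3)
  conv_lhs => rw [hZ']
  rw [h3, h2, h1, Fin.sum_univ_four, ← hl, ← hl, ← hl, ← hl]
  rfl

theorem co_sum (k : Fin 4) {x : M} {ι : Type*} (s : Finset ι)
    (v : ι → TangentSpace (𝓡 4) x) : e.co k (∑ i ∈ s, v i) = ∑ i ∈ s, e.co k (v i) :=
  map_sum (e.coL k x) v s

theorem map_eq_sum {x : M} {V : Type*} [AddCommGroup V] [Module ℝ V]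
    (f : TangentSpace (𝓡 4) x →ₗ[ℝ] V) (v : TangentSpace (𝓡 4) x) :
    f v = ∑ i, e.co i v • f (e.vec i x) := by
  conv_lhs => rw [← e.sum_co x v]
  simp

theorem co_cov {Z : ∀ x : M, TangentSpace (𝓡 4) x} {x : M} (hZ : FieldDiffAt Z x) (k : Fin 4)
    (X : ∀ x : M, TangentSpace (𝓡 4) x) :
    e.co k (D Z x (X x)) = ∑ i, e.co i (X x) * (mvfderiv (𝓡 4) (fun y ↦ e.co k (Z y)) x (e.vec i x)
      + ∑ j, e.co j (Z x) * e.co k (D (e.vec j) x (e.vec i x))) := by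
  have h : ∀ v, e.co k (D Z x v) = mvfderiv (𝓡 4) (fun y ↦ e.co k (Z y)) x v
      + ∑ j, e.co j (Z x) * e.co k (D (e.vec j) x v) := fun v ↦ by
    rw [e.cov_eq_sum hZ v, e.co_sum]
    simp only [e.co_add, e.co_smul, e.co_vec, Finset.sum_add_distrib]
    simp
  have h' := e.map_eq_sum ((e.coL k x).comp (D Z x : _ →ₗ[ℝ] _)) (X x)
  change e.co k (D Z x (X x)) = ∑ i, e.co i (X x) • e.co k (D Z x (e.vec i x)) at h'
  rw [h']
  simp only [h, smul_eq_mul]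

end ConstFrame

theorem ConstFrame.fieldAt_cov (e : ConstFrame g) (hD : IsLeviCivita g D) {X Z : ∀ x : M, TangentSpace (𝓡 4) x} {x : M}
    {m n : ℕ∞} (hmn : m + 1 ≤ n) (hX : FieldAt m X x) (hZ : FieldAt n Z x) :
    FieldAt m (fun y ↦ D Z y (X y)) x := by
  have hmn' : (m : WithTop ℕ∞) ≤ n := by exact_mod_cast le_self_add.trans hmn
  have hm : (m : WithTop ℕ∞) ≤ ∞ := by exact_mod_cast le_top
  have hn : (n : WithTop ℕ∞) ≤ ∞ := by exact_mod_cast le_top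
  have hn1 : (1 : WithTop ℕ∞) ≤ n := by exact_mod_cast le_add_self.trans hmn
  refine e.fieldAt_of_co hm fun k ↦ ?_
  have key : ContMDiffAt (𝓡 4) 𝓘(ℝ) m (fun y ↦ ∑ i, e.co i (X y) *
      (mvfderiv (𝓡 4) (fun y ↦ e.co k (Z y)) y (e.vec i y)
      + ∑ j, e.co j (Z y) * e.co k (D (e.vec j) y (e.vec i y)))) x := by
    refine contMDiffAt_finsetSum fun i _ ↦ (e.contMDiffAt_co hm hX i).mul
      (ContMDiffAt.add ?_ (contMDiffAt_finsetSum fun j _ ↦ ?_))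
    · exact e.contMDiffAt_mvfderiv hmn (e.contMDiffAt_co hn hZ k) ((e.smooth i x).of_le hn)
    · exact ((e.contMDiffAt_co hn hZ j).of_le hmn').mul
        (e.contMDiffAt_co hm ((e.fieldAt_cov_vec hD i j x).of_le hm) k)
  refine key.congr_of_eventuallyEq ?_
  filter_upwards [hZ.eventually_diffAt hn1] with y hy
  exact e.co_cov hy k X

theorem ConstFrame.fieldDiffAt_cov (e : ConstFrame g) (hD : IsLeviCivita g D)
    {X Z : ∀ x : M, TangentSpace (𝓡 4) x} {x : M} (hX : FieldDiffAt X x) (hZ : FieldAt 2 Z x) :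
    FieldDiffAt (fun y ↦ D Z y (X y)) x := by
  refine e.fieldDiffAt_of_co fun k ↦ ?_
  have h2 : (2 : WithTop ℕ∞) ≤ ∞ := ENat.LEInfty.out
  have key : MDifferentiableAt (𝓡 4) 𝓘(ℝ) (fun y ↦ ∑ i, e.co i (X y) *
      (mvfderiv (𝓡 4) (fun y ↦ e.co k (Z y)) y (e.vec i y)
      + ∑ j, e.co j (Z y) * e.co k (D (e.vec j) y (e.vec i y)))) x := by
    have h : ∀ i, MDifferentiableAt (𝓡 4) 𝓘(ℝ) (fun y ↦ e.co i (X y) *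
      (mvfderiv (𝓡 4) (fun y ↦ e.co k (Z y)) y (e.vec i y)
      + ∑ j, e.co j (Z y) * e.co k (D (e.vec j) y (e.vec i y)))) x := fun i ↦ by
      refine (e.mdifferentiableAt_co hX i).mul (ContMDiffAt.mdifferentiableAt (n := 1) ?_ (by simp))
      refine ContMDiffAt.add ?_ (contMDiffAt_finsetSum fun j _ ↦ ?_)
      · exact e.contMDiffAt_mvfderiv (m := 1) (n := 2) (by norm_num) (e.contMDiffAt_co h2 hZ k)
          ((e.smooth i x).of_le h2)
      · exact ((e.contMDiffAt_co h2 hZ j).of_le one_le_two).mul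
          (e.contMDiffAt_co ENat.LEInfty.out ((e.fieldAt_cov_vec hD i j x).of_le ENat.LEInfty.out) k)
    simp only [Fin.sum_univ_four (f := fun i ↦ e.co i (X _) * _)]
    exact (((h 0).add (h 1)).add (h 2)).add (h 3)
  refine key.congr_of_eventuallyEq ?_
  filter_upwards [hZ.eventually_diffAt one_le_two] with y hy
  exact e.co_cov hy k X

end Connection

section Bianchi

variable {M : Type*} [TopologicalSpace M] [ChartedSpace E4 M] [IsManifold (𝓡 4) ∞ M]
  {g : LorentzMetric M} {D : Connection M}

variable (M) in
/-- Smooth vector fields. -/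
abbrev SmoothField := Cₛ^∞⟮𝓡 4; E4, (TangentSpace (𝓡 4) : M → Type _)⟯

theorem SmoothField.diffAt (X : SmoothField M) (x : M) : FieldDiffAt X x :=
  (X.contMDiff x).mdifferentiableAt (by simp)

theorem SmoothField.fieldAt_two (X : SmoothField M) (x : M) : FieldAt 2 X x :=
  (X.contMDiff x).of_le ENat.LEInfty.out

namespace ConstFrame

/-- The frame, as smooth vector fields. -/
def field (e : ConstFrame g) (i : Fin 4) : SmoothField M := ⟨e.vec i, e.smooth i⟩

@[simp] theorem field_apply (e : ConstFrame g) (i : Fin 4) (x : M) : e.field i x = e.vec i x := rfl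

variable (e : ConstFrame g) (hD : IsLeviCivita g D)

/-- The covariant derivative `∇_X Y` on smooth vector fields. -/
def nab (X Y : SmoothField M) : SmoothField M :=
  ⟨fun y ↦ D Y y (X y), fun x ↦
    e.fieldAt_cov hD (m := ⊤) (n := ⊤) le_rfl (X.contMDiff x) (Y.contMDiff x)⟩

@[simp] theorem nab_apply (X Y : SmoothField M) (x : M) : e.nab hD X Y x = D Y x (X x) := rfl

theorem nab_add_left (X Y Z : SmoothField M) :
    e.nab hD (X + Y) Z = e.nab hD X Z + e.nab hD Y Z := by
  ext x : 1
  simp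

theorem nab_add_right (X Y Z : SmoothField M) :
    e.nab hD X (Y + Z) = e.nab hD X Y + e.nab hD X Z := by
  ext x : 1
  have := D.isCovariantDerivativeOnUniv.add (Y.diffAt x) (Z.diffAt x)
  simp only [nab_apply, ContMDiffSection.coe_add, Pi.add_apply]
  rw [this]
  rfl

theorem nab_smul_left (r : ℝ) (X Y : SmoothField M) :
    e.nab hD (r • X) Y = r • e.nab hD X Y := by
  ext x : 1
  simp

theorem nab_smul_right (r : ℝ) (X Y : SmoothField M) :
    e.nab hD X (r • Y) = r • e.nab hD X Y := by
  ext x : 1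
  have := D.isCovariantDerivativeOnUniv.smul_const r (Y.diffAt x)
  simp only [nab_apply, ContMDiffSection.coe_smul, Pi.smul_apply]
  rw [this]
  rfl

/-- The covariant derivative as a bilinear map. -/
def nabHom : SmoothField M →ₗ[ℝ] SmoothField M →ₗ[ℝ] SmoothField M :=
  LinearMap.mk₂ ℝ (e.nab hD) (e.nab_add_left hD) (e.nab_smul_left hD) (e.nab_add_right hD)
    (fun r X Y ↦ e.nab_smul_right hD r X Y)

@[simp] theorem nabHom_apply (X Y : SmoothField M) (x : M) :
    e.nabHom hD X Y x = D Y x (X x) := rfl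

/-- The Lie bracket of smooth vector fields. -/
def br (X Y : SmoothField M) : SmoothField M := e.nabHom hD X Y - e.nabHom hD Y X

theorem br_apply (X Y : SmoothField M) (x : M) :
    e.br hD X Y x = VectorField.mlieBracket (𝓡 4) X Y x :=
  hD.torsion_free (X.diffAt x) (Y.diffAt x)

theorem coe_br (X Y : SmoothField M) :
    ⇑(e.br hD X Y) = VectorField.mlieBracket (𝓡 4) X Y :=
  funext (e.br_apply hD X Y)

theorem br_jacobi (X Y Z : SmoothField M) :
    e.br hD X (e.br hD Y Z) = e.br hD (e.br hD X Y) Z + e.br hD Y (e.br hD X Z) := by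
  ext x : 1
  simp only [ContMDiffSection.coe_add, Pi.add_apply, br_apply, coe_br]
  exact jacobi_mlieBracket (X.fieldAt_two x) (Y.fieldAt_two x) (Z.fieldAt_two x)

/-- The curvature on smooth vector fields. -/
def curv (X Y Z : SmoothField M) : SmoothField M :=
  e.nabHom hD X (e.nabHom hD Y Z) - e.nabHom hD Y (e.nabHom hD X Z)
    - e.nabHom hD (e.br hD X Y) Z

theorem curv_apply (X Y Z : SmoothField M) (x : M) :
    e.curv hD X Y Z x = curvature D X Y Z x := by
  simp only [curv, ContMDiffSection.coe_sub, Pi.sub_apply, nabHom_apply, br_apply]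
  rfl

theorem curv_swap (X Y Z : SmoothField M) : e.curv hD X Y Z = -e.curv hD Y X Z := by
  simp only [curv, br, map_sub, LinearMap.sub_apply]
  module

theorem curv_add_left (X X' Y Z : SmoothField M) :
    e.curv hD (X + X') Y Z = e.curv hD X Y Z + e.curv hD X' Y Z := by
  simp only [curv, br, map_sub, map_add, LinearMap.sub_apply, LinearMap.add_apply]
  module

theorem curv_smul_left (r : ℝ) (X Y Z : SmoothField M) :
    e.curv hD (r • X) Y Z = r • e.curv hD X Y Z := by
  simp only [curv, br, map_sub, map_smul, LinearMap.sub_apply, LinearMap.smul_apply]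
  module

theorem curv_first_bianchi (X Y Z : SmoothField M) :
    e.curv hD X Y Z + e.curv hD Y Z X + e.curv hD Z X Y = 0 := by
  have J := e.br_jacobi hD X Y Z
  simp only [curv, br, map_sub, LinearMap.sub_apply] at J ⊢
  linear_combination (norm := module) J

theorem curv_second_bianchi (X Y Z W : SmoothField M) :
    (e.nabHom hD Z (e.curv hD X Y W) - e.curv hD (e.nabHom hD Z X) Y W
        - e.curv hD X (e.nabHom hD Z Y) W - e.curv hD X Y (e.nabHom hD Z W))
      + (e.nabHom hD X (e.curv hD Y Z W) - e.curv hD (e.nabHom hD X Y) Z W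
        - e.curv hD Y (e.nabHom hD X Z) W - e.curv hD Y Z (e.nabHom hD X W))
      + (e.nabHom hD Y (e.curv hD Z X W) - e.curv hD (e.nabHom hD Y Z) X W
        - e.curv hD Z (e.nabHom hD Y X) W - e.curv hD Z X (e.nabHom hD Y W)) = 0 := by
  have J := congrArg (fun V ↦ e.nabHom hD V W) (e.br_jacobi hD X Y Z)
  simp only [curv, br, map_sub, map_add, LinearMap.sub_apply, LinearMap.add_apply] at J ⊢
  linear_combination (norm := module) (-1 : ℤ) • J

end ConstFrame

end Bianchi

section Tensoriality

variable {M : Type*} [TopologicalSpace M] [ChartedSpace E4 M] [IsManifold (𝓡 4) ∞ M]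
  {g : LorentzMetric M} {D : Connection M}

theorem curvature_swap (X Y Z : ∀ x : M, TangentSpace (𝓡 4) x) (x : M) :
    curvature D X Y Z x = -curvature D Y X Z x := by
  simp only [curvature]
  rw [VectorField.mlieBracket_swap_apply]
  simp only [map_neg]
  module

namespace ConstFrame

variable (e : ConstFrame g) (hD : IsLeviCivita g D)

theorem tensorialAt_curvature (e : ConstFrame g) (hD : IsLeviCivita g D)
    {Y Z : ∀ x : M, TangentSpace (𝓡 4) x} {x : M} (hZ : FieldAt 2 Z x) :
    TensorialAt (𝓡 4) E4 (fun X ↦ curvature D X Y Z x) x where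
  smul {f X} hf hX := by
    have := isManifold_minSmoothness M
    have h1 : (fun y ↦ D Z y ((f • X) y)) = f • fun y ↦ D Z y (X y) := by
      funext y
      simp
    simp only [curvature]
    rw [h1, D.isCovariantDerivativeOnUniv.leibniz (e.fieldDiffAt_cov hD hX hZ) hf,
      VectorField.mlieBracket_smul_left hf hX]
    simp
    module
  add {X X'} hX hX' := by
    have := isManifold_minSmoothness M
    have h1 : (fun y ↦ D Z y ((X + X') y)) = (fun y ↦ D Z y (X y)) + fun y ↦ D Z y (X' y) := by
      funext y
      simp
    simp only [curvature]
    rw [h1, D.isCovariantDerivativeOnUniv.add (e.fieldDiffAt_cov hD hX hZ)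
      (e.fieldDiffAt_cov hD hX' hZ), VectorField.mlieBracket_add_left hX hX']
    simp
    module

theorem curvature_congr (e : ConstFrame g) (hD : IsLeviCivita g D)
    {X X' Y Y' Z : ∀ x : M, TangentSpace (𝓡 4) x} {x : M} (hX : FieldDiffAt X x)
    (hX' : FieldDiffAt X' x) (hY : FieldDiffAt Y x) (hY' : FieldDiffAt Y' x) (hZ : FieldAt 2 Z x)
    (hXX : X x = X' x) (hYY : Y x = Y' x) : curvature D X Y Z x = curvature D X' Y' Z x := by
  rw [(e.tensorialAt_curvature hD hZ).pointwise hX hX' hXX, curvature_swap,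
    (e.tensorialAt_curvature hD hZ).pointwise hY hY' hYY, ← curvature_swap]

theorem curvature_add (e : ConstFrame g) (hD : IsLeviCivita g D) (X Y : SmoothField M)
    {Z Z' : ∀ x : M, TangentSpace (𝓡 4) x} {x : M} (hZ : FieldAt 2 Z x) (hZ' : FieldAt 2 Z' x) :
    curvature D X Y (Z + Z') x = curvature D X Y Z x + curvature D X Y Z' x := by
  have hS : FieldAt 2 (Z + Z') x := hZ.add_section hZ'
  have h : ∀ V W : SmoothField M, D (fun y ↦ D (Z + Z') y (V y)) x (W x)
      = D (fun y ↦ D Z y (V y)) x (W x) + D (fun y ↦ D Z' y (V y)) x (W x) := fun V W ↦ by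
    have hd := e.fieldDiffAt_cov hD (V.diffAt x) hZ
    have hd' := e.fieldDiffAt_cov hD (V.diffAt x) hZ'
    rw [D.isCovariantDerivativeOnUniv.congr_of_eventuallyEq
      (σ' := (fun y ↦ D Z y (V y)) + fun y ↦ D Z' y (V y))
      (e.fieldDiffAt_cov hD (V.diffAt x) hS) (mdifferentiableAt_add_section hd hd')
      Filter.univ_mem ?_, D.isCovariantDerivativeOnUniv.add hd hd']
    · rfl
    · filter_upwards [hZ.eventually_diffAt one_le_two, hZ'.eventually_diffAt one_le_two]
        with y hy hy'
      rw [D.isCovariantDerivativeOnUniv.add hy hy']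
      rfl
  simp only [curvature]
  rw [h, h, D.isCovariantDerivativeOnUniv.add (hZ.mdifferentiableAt (by simp))
    (hZ'.mdifferentiableAt (by simp))]
  simp
  module

theorem curvature_smul (e : ConstFrame g) (hD : IsLeviCivita g D) (X Y : SmoothField M)
    {f : M → ℝ} {Z : ∀ x : M, TangentSpace (𝓡 4) x} {x : M}
    (hf : ContMDiffAt (𝓡 4) 𝓘(ℝ) 2 f x) (hZ : FieldAt 2 Z x) :
    curvature D X Y (f • Z) x = f x • curvature D X Y Z x := by
  have hS : FieldAt 2 (f • Z) x := hf.smul_section hZ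
  have hf1 : MDifferentiableAt (𝓡 4) 𝓘(ℝ) f x := hf.mdifferentiableAt (by simp)
  have hZ1 : FieldDiffAt Z x := hZ.mdifferentiableAt (by simp)
  have h : ∀ V W : SmoothField M, D (fun y ↦ D (f • Z) y (V y)) x (W x)
      = (f x • D (fun y ↦ D Z y (V y)) x (W x) + mvfderiv (𝓡 4) f x (W x) • D Z x (V x))
        + (mvfderiv (𝓡 4) f x (V x) • D Z x (W x)
          + mvfderiv (𝓡 4) (fun y ↦ mvfderiv (𝓡 4) f y (V y)) x (W x) • Z x) := fun V W ↦ by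
    have hd := e.fieldDiffAt_cov hD (V.diffAt x) hZ
    have hVf : MDifferentiableAt (𝓡 4) 𝓘(ℝ) (fun y ↦ mvfderiv (𝓡 4) f y (V y)) x :=
      (e.contMDiffAt_mvfderiv (m := 1) (n := 2) (by norm_num) hf
        (V.fieldAt_two x)).mdifferentiableAt (by simp)
    rw [D.isCovariantDerivativeOnUniv.congr_of_eventuallyEq
      (σ' := (f • fun y ↦ D Z y (V y)) + (fun y ↦ mvfderiv (𝓡 4) f y (V y)) • Z)
      (e.fieldDiffAt_cov hD (V.diffAt x) hS)
      (mdifferentiableAt_add_section (hf1.smul_section hd) (hVf.smul_section hZ1))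
      Filter.univ_mem ?_,
      D.isCovariantDerivativeOnUniv.add (hf1.smul_section hd) (hVf.smul_section hZ1),
      D.isCovariantDerivativeOnUniv.leibniz hd hf1, D.isCovariantDerivativeOnUniv.leibniz hZ1 hVf]
    · rfl
    · filter_upwards [hZ.eventually_diffAt one_le_two,
        (contMDiffAt_iff_contMDiffAt_nhds (by simp)).1 (hf.of_le one_le_two)] with y hy hfy
      rw [D.isCovariantDerivativeOnUniv.leibniz hy (hfy.mdifferentiableAt one_ne_zero)]
      rfl
  simp only [curvature]
  rw [h, h, D.isCovariantDerivativeOnUniv.leibniz hZ1 hf1]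
  have hc := e.mvfderiv_mlieBracket hf (X.fieldAt_two x) (Y.fieldAt_two x)
  simp only [add_apply, smul_apply, ContinuousLinearMap.smulRight_apply]
  rw [hc]
  module

theorem curvature_eq_sum (e : ConstFrame g) (hD : IsLeviCivita g D) (X Y : SmoothField M)
    {Z : ∀ x : M, TangentSpace (𝓡 4) x} {x : M} (hZ : FieldAt 2 Z x) :
    curvature D X Y Z x = ∑ k, e.co k (Z x) • curvature D X Y (e.vec k) x := by
  have h2 : (2 : WithTop ℕ∞) ≤ ∞ := ENat.LEInfty.out
  have hZ' : Z = (fun y ↦ e.co 0 (Z y)) • e.vec 0 + (fun y ↦ e.co 1 (Z y)) • e.vec 1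
      + (fun y ↦ e.co 2 (Z y)) • e.vec 2 + (fun y ↦ e.co 3 (Z y)) • e.vec 3 := by
    funext y
    have := e.sum_co y (Z y)
    rw [Fin.sum_univ_four] at this
    exact this.symm
  have hc := fun i ↦ e.contMDiffAt_co h2 hZ i
  have hv := fun i ↦ (e.smooth i x).of_le h2
  have hs : ∀ i, FieldAt 2 ((fun y ↦ e.co i (Z y)) • e.vec i) x := fun i ↦
    (hc i).smul_section (hv i)
  conv_lhs => rw [hZ']
  rw [e.curvature_add hD X Y (((hs 0).add_section (hs 1)).add_section (hs 2)) (hs 3),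
    e.curvature_add hD X Y ((hs 0).add_section (hs 1)) (hs 2),
    e.curvature_add hD X Y (hs 0) (hs 1), e.curvature_smul hD X Y (hc 0) (hv 0),
    e.curvature_smul hD X Y (hc 1) (hv 1), e.curvature_smul hD X Y (hc 2) (hv 2),
    e.curvature_smul hD X Y (hc 3) (hv 3), Fin.sum_univ_four]

theorem curvature_congr_right (e : ConstFrame g) (hD : IsLeviCivita g D) (X Y : SmoothField M)
    {Z Z' : ∀ x : M, TangentSpace (𝓡 4) x} {x : M} (hZ : FieldAt 2 Z x) (hZ' : FieldAt 2 Z' x)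
    (h : Z x = Z' x) : curvature D X Y Z x = curvature D X Y Z' x := by
  rw [e.curvature_eq_sum hD X Y hZ, e.curvature_eq_sum hD X Y hZ', h]

theorem fieldAt_extend {x : M} (a : TangentSpace (𝓡 4) x) :
    FieldAt 2 (FiberBundle.extend E4 a) x :=
  FiberBundle.contMDiffAt_extend (𝓡 4) E4 a

theorem diffAt_extend {x : M} (a : TangentSpace (𝓡 4) x) :
    FieldDiffAt (FiberBundle.extend E4 a) x :=
  FiberBundle.mdifferentiableAt_extend (𝓡 4) E4 a

/-- The Riemann tensor in terms of smooth vector fields. -/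
theorem riemann_eq (X Y Z : SmoothField M) (x : M) (d : TangentSpace (𝓡 4) x) :
    riemann g D x (X x) (Y x) (Z x) d = g.val x (e.curv hD X Y Z x) d := by
  rw [curv_apply, riemann,
    e.curvature_congr hD (diffAt_extend _) (X.diffAt x) (diffAt_extend _) (Y.diffAt x)
      (fieldAt_extend _) (FiberBundle.extend_apply_self ..) (FiberBundle.extend_apply_self ..),
    e.curvature_congr_right hD X Y (fieldAt_extend _) (Z.fieldAt_two x)
      (FiberBundle.extend_apply_self ..)]

/-- The field with constant coefficients that extends a tangent vector. -/
def const {x : M} (v : TangentSpace (𝓡 4) x) : SmoothField M := ∑ i, e.co i v • e.field i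

theorem const_apply {x : M} (v : TangentSpace (𝓡 4) x) : e.const v x = v := by
  conv_rhs => rw [← e.sum_co x v]
  simp [const, Fin.sum_univ_four]

theorem const_add {x : M} (v w : TangentSpace (𝓡 4) x) :
    e.const (v + w) = e.const v + e.const w := by
  simp [const, co_add, add_smul, Finset.sum_add_distrib]

theorem const_smul {x : M} (r : ℝ) (v : TangentSpace (𝓡 4) x) :
    e.const (r • v) = r • e.const v := by
  simp [const, co_smul, mul_smul, Finset.smul_sum]

theorem riemann_const {x : M} (a b c d : TangentSpace (𝓡 4) x) :
    riemann g D x a b c d = g.val x (e.curv hD (e.const a) (e.const b) (e.const c) x) d := by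
  have := e.riemann_eq hD (e.const a) (e.const b) (e.const c) x d
  simpa only [e.const_apply] using this

end ConstFrame

/-- Multilinearity and symmetries of the Riemann tensor. -/
structure IsCurvatureLike {V : Type*} [AddCommGroup V] [Module ℝ V] (R : V → V → V → V → ℝ) :
    Prop where
  add_left : ∀ a a' b c d, R (a + a') b c d = R a b c d + R a' b c d
  smul_left : ∀ (r : ℝ) a b c d, R (r • a) b c d = r * R a b c d
  swap_left : ∀ a b c d, R b a c d = -R a b c d
  swap_right : ∀ a b c d, R a b d c = -R a b c d
  cyclic : ∀ a b c d, R a b c d + R b c a d + R c a b d = 0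

namespace IsCurvatureLike

variable {V : Type*} [AddCommGroup V] [Module ℝ V] {R : V → V → V → V → ℝ}

theorem pair_symm (h : IsCurvatureLike R) (a b c d : V) : R c d a b = R a b c d := by
  have := h.cyclic a b c d
  have := h.cyclic b c d a
  have := h.cyclic c d a b
  have := h.cyclic d a b c
  linarith [h.swap_left a b c d, h.swap_left b c a d, h.swap_left c a b d, h.swap_left c d b a,
    h.swap_right a b c d, h.swap_right b c a d, h.swap_right c a b d, h.swap_right c d a b,
    h.swap_right d b c a, h.swap_right a d b c, h.swap_right b d c a, h.swap_right d a b c,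
    h.swap_left d b c a, h.swap_left d a b c, h.swap_left a c b d, h.swap_right a c b d,
    h.swap_left a c d b, h.swap_left b d a c, h.swap_right b d a c, h.swap_left c d a b]

end IsCurvatureLike

namespace ConstFrame

theorem val_const_eq (e : ConstFrame g) {x : M} (v w : TangentSpace (𝓡 4) x) (y : M) :
    g.val y (e.const v y) (e.const w y) = g.val x v w := by
  have h : ∀ z, g.val z (e.const v z) (e.const w z)
      = ∑ i, ∑ j, e.co i v * (e.co j w * e.gram i j) := fun z ↦ by
    have : ∀ u : TangentSpace (𝓡 4) x, e.const u z = ∑ i, e.co i u • e.vec i z := fun u ↦ by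
      simp [const, Fin.sum_univ_four]
    rw [this, this]
    simp only [Fin.sum_univ_four, map_add, map_smul, add_apply, smul_apply, smul_eq_mul,
      e.val_vec]
    ring
  have hx := h x
  rw [e.const_apply, e.const_apply] at hx
  rw [h, hx]

theorem val_curv_skew (e : ConstFrame g) (hD : IsLeviCivita g D) (X Y W V : SmoothField M)
    (hc : ∃ r : ℝ, ∀ y, g.val y (W y) (V y) = r) (x : M) :
    g.val x (e.curv hD X Y W x) (V x) + g.val x (W x) (e.curv hD X Y V x) = 0 := by
  obtain ⟨r, hr⟩ := hc
  have h1 : ∀ (y : M) (v : TangentSpace (𝓡 4) y),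
      g.val y (D W y v) (V y) + g.val y (W y) (D V y v) = 0 := fun y v ↦ by
    rw [← hD.2 W V y (W.diffAt y) (V.diffAt y) v]
    simp only [hr, mvfderiv_const]
    rfl
  have h2 : ∀ A B : SmoothField M,
      g.val x (D (e.nabHom hD A W) x (B x)) (V x) + g.val x (D W x (A x)) (D V x (B x))
        + (g.val x (D W x (B x)) (D V x (A x)) + g.val x (W x) (D (e.nabHom hD A V) x (B x)))
        = 0 := fun A B ↦ by
    have k1 := hD.2 (e.nabHom hD A W) V x ((e.nabHom hD A W).diffAt x) (V.diffAt x) (B x)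
    have k2 := hD.2 W (e.nabHom hD A V) x (W.diffAt x) ((e.nabHom hD A V).diffAt x) (B x)
    simp only [nabHom_apply] at k1 k2
    rw [← k1, ← k2, ← add_apply, ← mvfderiv_fun_add]
    · simp only [h1, mvfderiv_const]
      rfl
    · exact LorentzMetric.mdifferentiableAt_val ((e.nabHom hD A W).diffAt x) (V.diffAt x)
    · exact LorentzMetric.mdifferentiableAt_val (W.diffAt x) ((e.nabHom hD A V).diffAt x)
  have h3 := h2 Y X
  have h4 := h2 X Y
  have h5 := h1 x (e.br hD X Y x)
  simp only [curv, ContMDiffSection.coe_sub, Pi.sub_apply, map_sub, sub_apply, nabHom_apply] at *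
  linarith

theorem isCurvatureLike_riemann (e : ConstFrame g) (hD : IsLeviCivita g D) (x : M) :
    IsCurvatureLike (riemann g D x) where
  add_left a a' b c d := by
    simp only [e.riemann_const hD, const_add, curv_add_left]
    simp
  smul_left r a b c d := by
    simp only [e.riemann_const hD, const_smul, curv_smul_left]
    simp
  swap_left a b c d := by
    rw [e.riemann_const hD, e.riemann_const hD, curv_swap]
    simp
  swap_right a b c d := by
    have := e.val_curv_skew hD (e.const a) (e.const b) (e.const c) (e.const d)
      ⟨_, e.val_const_eq c d⟩ x
    rw [e.const_apply, e.const_apply, g.symm x c] at this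
    rw [e.riemann_const hD, e.riemann_const hD]
    linarith
  cyclic a b c d := by
    simp only [e.riemann_const hD]
    rw [← add_apply, ← add_apply, ← map_add, ← map_add]
    have := congrArg (fun X : SmoothField M ↦ X x)
      (e.curv_first_bianchi hD (e.const a) (e.const b) (e.const c))
    simp only [ContMDiffSection.coe_add, Pi.add_apply] at this
    rw [this]
    simp

end ConstFrame

end Tensoriality

section Weyl

variable {M : Type*} [TopologicalSpace M] [ChartedSpace E4 M] [IsManifold (𝓡 4) ∞ M]
  {g : LorentzMetric M} {D : Connection M}

/-- The covariant derivative `(∇_Z T)(X, Y, W, V)` of a four-tensor `T`, on vector fields. -/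
def nablaTensor (D : Connection M)
    (T : ∀ x : M, TangentSpace (𝓡 4) x → TangentSpace (𝓡 4) x → TangentSpace (𝓡 4) x →
      TangentSpace (𝓡 4) x → ℝ) (Z X Y W V : ∀ x : M, TangentSpace (𝓡 4) x) (x : M) : ℝ :=
  mvfderiv (𝓡 4) (fun y ↦ T y (X y) (Y y) (W y) (V y)) x (Z x)
    - T x (D X x (Z x)) (Y x) (W x) (V x) - T x (X x) (D Y x (Z x)) (W x) (V x)
    - T x (X x) (Y x) (D W x (Z x)) (V x) - T x (X x) (Y x) (W x) (D V x (Z x))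

theorem ConstFrame.nablaTensor_riemann (e : ConstFrame g) (hD : IsLeviCivita g D)
    (X Y Z W V : SmoothField M) (x : M) :
    nablaTensor D (riemann g D) Z X Y W V x
      = g.val x ((e.nabHom hD Z (e.curv hD X Y W) - e.curv hD (e.nabHom hD Z X) Y W
        - e.curv hD X (e.nabHom hD Z Y) W - e.curv hD X Y (e.nabHom hD Z W) : SmoothField M) x)
        (V x) := by
  have k := hD.2 (e.curv hD X Y W) V x ((e.curv hD X Y W).diffAt x) (V.diffAt x) (Z x)
  have r1 := e.riemann_eq hD (e.nabHom hD Z X) Y W x (V x)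
  have r2 := e.riemann_eq hD X (e.nabHom hD Z Y) W x (V x)
  have r3 := e.riemann_eq hD X Y (e.nabHom hD Z W) x (V x)
  have r4 := e.riemann_eq hD X Y W x (D V x (Z x))
  simp only [nabHom_apply] at r1 r2 r3
  simp only [nablaTensor, e.riemann_eq hD X Y W, r1, r2, r3, k, ContMDiffSection.coe_sub,
    Pi.sub_apply, map_sub, sub_apply, nabHom_apply]
  ring

theorem ConstFrame.riemann_second_bianchi (e : ConstFrame g) (hD : IsLeviCivita g D)
    (X Y Z W V : SmoothField M) (x : M) :
    nablaTensor D (riemann g D) Z X Y W V x + nablaTensor D (riemann g D) X Y Z W V x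
      + nablaTensor D (riemann g D) Y Z X W V x = 0 := by
  rw [e.nablaTensor_riemann hD, e.nablaTensor_riemann hD, e.nablaTensor_riemann hD, ← add_apply,
    ← add_apply, ← map_add, ← map_add]
  have := congrArg (fun A : SmoothField M ↦ A x) (e.curv_second_bianchi hD X Y Z W)
  simp only [ContMDiffSection.coe_add, Pi.add_apply] at this
  rw [this]
  simp

theorem ConstFrame.contMDiffAt_riemann (e : ConstFrame g) (hD : IsLeviCivita g D)
    (X Y W V : SmoothField M) (x : M) :
    ContMDiffAt (𝓡 4) 𝓘(ℝ) ∞ (fun y ↦ riemann g D y (X y) (Y y) (W y) (V y)) x := by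
  simp only [e.riemann_eq hD X Y W]
  exact LorentzMetric.contMDiffAt_val le_rfl ((e.curv hD X Y W).contMDiff x) (V.contMDiff x)

theorem IsEinstein.weyl_eq (hE : IsEinstein g D) : ∃ L : ℝ, (∀ x a b c d, weyl g D x a b c d
      = riemann g D x a b c d
        - 2 * L * (g.val x a c * g.val x b d - g.val x a d * g.val x b c)) ∧
    ∀ x a b, ricci g D x a b = 6 * L * g.val x a b := by
  obtain ⟨h, L, hL⟩ := hE
  refine ⟨L, fun x a b c d ↦ ?_, fun x a b ↦ ?_⟩
  · simp only [weyl, h]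
    linear_combination (2 * (g.val x a d * g.val x b c - g.val x a c * g.val x b d)) * hL x
  · rw [h]
    linear_combination (6 * g.val x a b) * hL x

theorem LorentzMetric.sum_signature (x : M) (u v : TangentSpace (𝓡 4) x) :
    ∑ k, sgn k * (g.val x u ((g.signature x).choose k) * g.val x v ((g.signature x).choose k))
      = g.val x u v := by
  set b := (g.signature x).choose with hb
  have hbb : ∀ i j, g.val x (b i) (b j) = if i = j then sgn i else 0 := (g.signature x).choose_spec
  have hs : ∀ k, sgn k * sgn k = 1 := fun k ↦ by unfold sgn; split_ifs <;> norm_num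
  have hu : ∀ w k, g.val x w (b k) = b.repr w k * sgn k := fun w k ↦ by
    have hw := b.sum_repr w
    rw [Fin.sum_univ_four] at hw
    conv_lhs => rw [← hw]
    simp only [map_add, map_smul, add_apply, smul_apply, smul_eq_mul, hbb]
    fin_cases k <;> simp
  have huv : g.val x u v = ∑ k, b.repr v k * (b.repr u k * sgn k) := by
    have hv := b.sum_repr v
    rw [Fin.sum_univ_four] at hv
    conv_lhs => rw [← hv]
    simp only [map_add, map_smul, smul_eq_mul, hu, Fin.sum_univ_four]
  rw [huv]
  refine Finset.sum_congr rfl fun k _ ↦ ?_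
  rw [hu, hu]
  linear_combination (b.repr v k * b.repr u k * sgn k) * hs k

theorem IsEinstein.mtrace_weyl (hE : IsEinstein g D) (x : M) (a c : TangentSpace (𝓡 4) x) :
    mtrace g x (fun b d ↦ weyl g D x a b c d) = 0 := by
  obtain ⟨L, hw, hr⟩ := hE.weyl_eq
  have h1 := hr x a c
  have h2 := g.sum_signature x a c
  have hbb := (g.signature x).choose_spec
  have hs : ∀ k, sgn k * sgn k = 1 := fun k ↦ by unfold sgn; split_ifs <;> norm_num
  simp only [ricci, mtrace, hw] at *
  have hbc : ∀ k, g.val x ((g.signature x).choose k) c = g.val x c ((g.signature x).choose k) :=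
    fun k ↦ g.symm x _ _
  simp only [Fin.sum_univ_four, hbb, hbc, if_true] at *
  linear_combination h1 + 2 * L * h2 - 2 * L * g.val x a c * (hs 0 + hs 1 + hs 2 + hs 3)

namespace ConstFrame

theorem mtrace_eq (e : ConstFrame g) (x : M)
    (F : TangentSpace (𝓡 4) x →ₗ[ℝ] TangentSpace (𝓡 4) x →ₗ[ℝ] ℝ) :
    mtrace g x (fun b d ↦ F b d) = ∑ i, ∑ j, e.gramInv i j * F (e.vec i x) (e.vec j x) := by
  set b := (g.signature x).choose with hb
  have hF : ∀ k, F (b k) (b k)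
      = ∑ i, ∑ j, e.co i (b k) * e.co j (b k) * F (e.vec i x) (e.vec j x) := fun k ↦ by
    have hv := e.sum_co x (b k)
    rw [Fin.sum_univ_four] at hv
    conv_lhs => rw [← hv]
    simp only [map_add, map_smul, LinearMap.add_apply, LinearMap.smul_apply, smul_eq_mul,
      Fin.sum_univ_four]
    ring
  have hgi : ∀ i j, ∑ k, sgn k * (e.co i (b k) * e.co j (b k)) = e.gramInv i j := fun i j ↦ by
    have h1 : ∀ m n, ∑ k, sgn k * (g.val x (b k) (e.vec m x) * g.val x (b k) (e.vec n x))
        = e.gram m n := fun m n ↦ by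
      rw [← e.val_vec x, ← g.sum_signature x]
      exact Finset.sum_congr rfl fun k _ ↦ by rw [g.symm x (b k), g.symm x (b k)]
    have h2 : e.gramInv i j = ∑ m, ∑ n, e.gramInv m i * e.gramInv n j * e.gram m n := by
      have h3 : (e.gramInv.transpose * (e.gram * e.gramInv)) = e.gramInv := by
        have ht : e.gram.transpose = e.gram := Matrix.ext fun a c ↦ e.gram_symm x c a
        rw [← Matrix.mul_assoc]
        have h4 := congrArg Matrix.transpose e.mul_inv
        rw [Matrix.transpose_mul, ht, Matrix.transpose_one] at h4
        rw [h4, Matrix.one_mul]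
      conv_lhs => rw [← h3]
      simp only [Matrix.mul_apply, Matrix.transpose_apply, Finset.mul_sum]
      exact Finset.sum_congr rfl fun m _ ↦ Finset.sum_congr rfl fun n _ ↦ by ring
    rw [h2]
    simp only [← h1, co, Fin.sum_univ_four]
    ring
  simp only [mtrace, ← hb, hF, ← hgi]
  simp only [Finset.mul_sum, Finset.sum_mul]
  rw [Finset.sum_comm]
  refine Finset.sum_congr rfl fun i _ ↦ ?_
  rw [Finset.sum_comm]
  exact Finset.sum_congr rfl fun j _ ↦ Finset.sum_congr rfl fun k _ ↦ by ring

end ConstFrame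

end Weyl

section Components

/-- The linear form on `ℂ⁴` with coefficients `F`. -/
def lin (F u : Fin 4 → ℂ) : ℂ := ∑ i, u i * F i

theorem lin_add (F G u : Fin 4 → ℂ) : lin (fun i ↦ F i + G i) u = lin F u + lin G u := by
  simp [lin, mul_add, Finset.sum_add_distrib]

theorem lin_sub (F G u : Fin 4 → ℂ) : lin (fun i ↦ F i - G i) u = lin F u - lin G u := by
  simp [lin, mul_sub, Finset.sum_sub_distrib]

theorem lin_zero (u : Fin 4 → ℂ) : lin (fun _ ↦ 0) u = 0 := by simp [lin]

theorem lin_vec_add (F u v : Fin 4 → ℂ) : lin F (u + v) = lin F u + lin F v := by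
  simp [lin, add_mul, Finset.sum_add_distrib]

theorem lin_vec_smul (F : Fin 4 → ℂ) (r : ℂ) (u : Fin 4 → ℂ) : lin F (r • u) = r * lin F u := by
  simp [lin, Finset.mul_sum, mul_assoc]

theorem lin_mul (r : ℂ) (F u : Fin 4 → ℂ) : lin (fun i ↦ r * F i) u = r * lin F u := by
  simp only [lin, Finset.mul_sum]
  exact Finset.sum_congr rfl fun i _ ↦ by ring

theorem lin_comm (F : Fin 4 → Fin 4 → ℂ) (u v : Fin 4 → ℂ) :
    lin (fun i ↦ lin (fun j ↦ F i j) v) u = lin (fun j ↦ lin (fun i ↦ F i j) u) v := by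
  simp only [lin, Finset.mul_sum]
  rw [Finset.sum_comm]
  exact Finset.sum_congr rfl fun i _ ↦ Finset.sum_congr rfl fun j _ ↦ by ring

theorem lin_sum (F : Fin 4 → Fin 4 → ℂ) (u : Fin 4 → ℂ) :
    lin (fun i ↦ ∑ r, F i r) u = ∑ r, lin (fun i ↦ F i r) u := by
  simp only [lin, Finset.mul_sum]
  exact Finset.sum_comm

/-- The multilinear form on `ℂ⁴` with components `c`. -/
def mul4 (c : Fin 4 → Fin 4 → Fin 4 → Fin 4 → ℂ) (u v w s : Fin 4 → ℂ) : ℂ :=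
  lin (fun i ↦ lin (fun j ↦ lin (fun p ↦ lin (fun q ↦ c i j p q) s) w) v) u

/-- The derivative of a vector with constant components. -/
def conn (Γ : Fin 4 → Fin 4 → Fin 4 → ℂ) (z u : Fin 4 → ℂ) : Fin 4 → ℂ := fun r ↦
  lin (fun k ↦ lin (fun i ↦ Γ k i r) u) z

theorem lin_conn (Γ : Fin 4 → Fin 4 → Fin 4 → ℂ) (F z u : Fin 4 → ℂ) :
    lin F (conn Γ z u) = lin (fun k ↦ lin (fun i ↦ ∑ r, Γ k i r * F r) u) z := by
  simp only [lin_sum]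
  simp only [lin, conn, Finset.sum_mul, Finset.mul_sum]
  exact Finset.sum_congr rfl fun r _ ↦ Finset.sum_congr rfl fun k _ ↦
    Finset.sum_congr rfl fun i _ ↦ by ring

/-- Components of a covariant derivative. -/
def nablaComp (c : Fin 4 → Fin 4 → Fin 4 → Fin 4 → ℂ)
    (dc : Fin 4 → Fin 4 → Fin 4 → Fin 4 → Fin 4 → ℂ) (Γ : Fin 4 → Fin 4 → Fin 4 → ℂ)
    (k i j p q : Fin 4) : ℂ :=
  dc k i j p q - ∑ r, Γ k i r * c r j p q - ∑ r, Γ k j r * c i r p q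
    - ∑ r, Γ k p r * c i j r q - ∑ r, Γ k q r * c i j p r

/-- The covariant derivative on vectors with constant components. -/
def nablaMul (c : Fin 4 → Fin 4 → Fin 4 → Fin 4 → ℂ)
    (dc : Fin 4 → Fin 4 → Fin 4 → Fin 4 → Fin 4 → ℂ) (Γ : Fin 4 → Fin 4 → Fin 4 → ℂ)
    (z u v w s : Fin 4 → ℂ) : ℂ :=
  lin (fun k ↦ mul4 (dc k) u v w s) z - mul4 c (conn Γ z u) v w s - mul4 c u (conn Γ z v) w s
    - mul4 c u v (conn Γ z w) s - mul4 c u v w (conn Γ z s)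

variable {c : Fin 4 → Fin 4 → Fin 4 → Fin 4 → ℂ}
  {dc : Fin 4 → Fin 4 → Fin 4 → Fin 4 → Fin 4 → ℂ} {Γ : Fin 4 → Fin 4 → Fin 4 → ℂ}

theorem nablaMul_eq (z u v w s : Fin 4 → ℂ) : nablaMul c dc Γ z u v w s
    = lin (fun k ↦ mul4 (nablaComp c dc Γ k) u v w s) z := by
  have h1 : mul4 c (conn Γ z u) v w s
      = lin (fun k ↦ mul4 (fun i j p q ↦ ∑ r, Γ k i r * c r j p q) u v w s) z := by
    simp only [mul4, lin_conn, lin_sum, lin_mul]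
  have h2 : mul4 c u (conn Γ z v) w s
      = lin (fun k ↦ mul4 (fun i j p q ↦ ∑ r, Γ k j r * c i r p q) u v w s) z := by
    simp only [mul4, lin_conn]
    rw [lin_comm]
    simp only [lin_sum, lin_mul]
  have h3 : mul4 c u v (conn Γ z w) s
      = lin (fun k ↦ mul4 (fun i j p q ↦ ∑ r, Γ k p r * c i j r q) u v w s) z := by
    simp only [mul4, lin_conn]
    rw [lin_comm (u := z)]
    refine congrArg (lin · u) (funext fun i ↦ ?_)
    rw [lin_comm]
    simp only [lin_sum, lin_mul]
  have h4 : mul4 c u v w (conn Γ z s)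
      = lin (fun k ↦ mul4 (fun i j p q ↦ ∑ r, Γ k q r * c i j p r) u v w s) z := by
    simp only [mul4, lin_conn]
    rw [lin_comm (u := z)]
    refine congrArg (lin · u) (funext fun i ↦ ?_)
    rw [lin_comm (u := z)]
    refine congrArg (lin · v) (funext fun i ↦ ?_)
    rw [lin_comm]
  rw [nablaMul, h1, h2, h3, h4]
  simp only [← lin_sub, mul4]
  rfl

theorem nablaMul_cyclic
    (h : ∀ k i j p q, nablaComp c dc Γ k i j p q + nablaComp c dc Γ i j k p q
      + nablaComp c dc Γ j k i p q = 0) (z u v w s : Fin 4 → ℂ) :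
    nablaMul c dc Γ z u v w s + nablaMul c dc Γ u v z w s + nablaMul c dc Γ v z u w s = 0 := by
  have h2 : nablaMul c dc Γ u v z w s = lin (fun k ↦ lin (fun i ↦ lin (fun j ↦ lin (fun p ↦
      lin (fun q ↦ nablaComp c dc Γ i j k p q) s) w) v) u) z := by
    rw [nablaMul_eq]
    simp only [mul4]
    rw [lin_comm (u := z)]
    refine congrArg (lin · u) (funext fun i ↦ ?_)
    rw [lin_comm]
  have h3 : nablaMul c dc Γ v z u w s = lin (fun k ↦ lin (fun i ↦ lin (fun j ↦ lin (fun p ↦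
      lin (fun q ↦ nablaComp c dc Γ j k i p q) s) w) v) u) z := by
    rw [nablaMul_eq]
    simp only [mul4]
    rw [lin_comm]
    refine congrArg (lin · z) (funext fun i ↦ ?_)
    rw [lin_comm]
  rw [h2, h3, nablaMul_eq]
  simp only [mul4, ← lin_add, h, lin_zero]

end Components

section Tetrad

theorem mul4_add₁ (c : Fin 4 → Fin 4 → Fin 4 → Fin 4 → ℂ) (u u' v w s : Fin 4 → ℂ) :
    mul4 c (u + u') v w s = mul4 c u v w s + mul4 c u' v w s := by
  simp only [mul4, lin_vec_add]

theorem mul4_add₂ (c : Fin 4 → Fin 4 → Fin 4 → Fin 4 → ℂ) (u v v' w s : Fin 4 → ℂ) :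
    mul4 c u (v + v') w s = mul4 c u v w s + mul4 c u v' w s := by
  simp only [mul4, lin_vec_add, lin_add]

theorem mul4_add₃ (c : Fin 4 → Fin 4 → Fin 4 → Fin 4 → ℂ) (u v w w' s : Fin 4 → ℂ) :
    mul4 c u v (w + w') s = mul4 c u v w s + mul4 c u v w' s := by
  simp only [mul4, lin_vec_add, lin_add]

theorem mul4_add₄ (c : Fin 4 → Fin 4 → Fin 4 → Fin 4 → ℂ) (u v w s s' : Fin 4 → ℂ) :
    mul4 c u v w (s + s') = mul4 c u v w s + mul4 c u v w s' := by
  simp only [mul4, lin_vec_add, lin_add]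

theorem mul4_smul₁ (c : Fin 4 → Fin 4 → Fin 4 → Fin 4 → ℂ) (r : ℂ) (u v w s : Fin 4 → ℂ) :
    mul4 c (r • u) v w s = r * mul4 c u v w s := by
  simp only [mul4, lin_vec_smul]

theorem mul4_smul₂ (c : Fin 4 → Fin 4 → Fin 4 → Fin 4 → ℂ) (r : ℂ) (u v w s : Fin 4 → ℂ) :
    mul4 c u (r • v) w s = r * mul4 c u v w s := by
  simp only [mul4, lin_vec_smul, lin_mul]

theorem mul4_smul₃ (c : Fin 4 → Fin 4 → Fin 4 → Fin 4 → ℂ) (r : ℂ) (u v w s : Fin 4 → ℂ) :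
    mul4 c u v (r • w) s = r * mul4 c u v w s := by
  simp only [mul4, lin_vec_smul, lin_mul]

theorem mul4_smul₄ (c : Fin 4 → Fin 4 → Fin 4 → Fin 4 → ℂ) (r : ℂ) (u v w s : Fin 4 → ℂ) :
    mul4 c u v w (r • s) = r * mul4 c u v w s := by
  simp only [mul4, lin_vec_smul, lin_mul]

/-- The components `c` of a tensor with the symmetries of a Weyl tensor, trace-free with respect to
the null tetrad `l, n, m, m̄`. -/
structure IsWeylLike (c : Fin 4 → Fin 4 → Fin 4 → Fin 4 → ℂ) (l n m k : Fin 4 → ℂ) : Prop where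
  swap_left : ∀ u v w s, mul4 c v u w s = -mul4 c u v w s
  swap_right : ∀ u v w s, mul4 c u v s w = -mul4 c u v w s
  pair : ∀ u v w s, mul4 c w s u v = mul4 c u v w s
  cyclic : ∀ u v w s, mul4 c u v w s + mul4 c v w u s + mul4 c w u v s = 0
  trace : ∀ u w, mul4 c u l w n + mul4 c u n w l - mul4 c u m w k - mul4 c u k w m = 0

namespace IsWeylLike

variable {c : Fin 4 → Fin 4 → Fin 4 → Fin 4 → ℂ} {l n m k : Fin 4 → ℂ} (h : IsWeylLike c l n m k)

include h

theorem self_left (u w s : Fin 4 → ℂ) : mul4 c u u w s = 0 := by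
  linear_combination (1 / 2 : ℂ) * h.swap_left u u w s

theorem self_right (u v w : Fin 4 → ℂ) : mul4 c u v w w = 0 := by
  linear_combination (1 / 2 : ℂ) * h.swap_right u v w w


theorem swap_mul4 : (∀ w s, mul4 c m l w s = -mul4 c l m w s) ∧
    (∀ w s, mul4 c k l w s = -mul4 c l k w s) ∧ (∀ w s, mul4 c n l w s = -mul4 c l n w s) ∧
    (∀ w s, mul4 c m k w s = -mul4 c k m w s) ∧ (∀ w s, mul4 c n k w s = -mul4 c k n w s) ∧
    (∀ w s, mul4 c n m w s = -mul4 c m n w s) ∧ (∀ u v, mul4 c u v m l = -mul4 c u v l m) ∧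
    (∀ u v, mul4 c u v k l = -mul4 c u v l k) ∧ (∀ u v, mul4 c u v n l = -mul4 c u v l n) ∧
    (∀ u v, mul4 c u v m k = -mul4 c u v k m) ∧ (∀ u v, mul4 c u v n k = -mul4 c u v k n) ∧
    (∀ u v, mul4 c u v n m = -mul4 c u v m n) :=
  ⟨h.swap_left _ _, h.swap_left _ _, h.swap_left _ _, h.swap_left _ _, h.swap_left _ _,
    h.swap_left _ _, fun _ _ ↦ h.swap_right _ _ _ _, fun _ _ ↦ h.swap_right _ _ _ _,
    fun _ _ ↦ h.swap_right _ _ _ _, fun _ _ ↦ h.swap_right _ _ _ _,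
    fun _ _ ↦ h.swap_right _ _ _ _, fun _ _ ↦ h.swap_right _ _ _ _⟩

/-- The values on the null tetrad with `l ∧ m` in the second pair, when `Ψ₁ = 0`. -/
theorem lm_values (h₁ : mul4 c l n l m = 0) : mul4 c l k l m = 0 ∧ mul4 c m n l m = 0 ∧
    mul4 c k m l m = 0 ∧ mul4 c k n l m = mul4 c l m k n := by
  obtain ⟨_, _, _, _, _, _, _, _, _, _, _, _⟩ := h.swap_mul4
  have t1 := h.trace l l
  have t2 := h.trace m m
  have t3 := h.trace l m
  have p1 := h.pair l m l k
  have p2 := h.pair l m m n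
  have p3 := h.pair l m k m
  have p4 := h.pair l m l n
  simp only [*, h.self_left, h.self_right] at t1 t2 t3 p1 p2 p3 p4
  refine ⟨?_, ?_, ?_, h.pair l m k n⟩ <;> grind

/-- The values on the null tetrad with `m̄ ∧ n` in the second pair. -/
theorem kn_values : mul4 c k m k n = mul4 c l n k n ∧ mul4 c l k k n = 0 ∧
    mul4 c m n k n = 0 := by
  obtain ⟨_, _, _, _, _, _, _, _, _, _, _, _⟩ := h.swap_mul4
  have t1 := h.trace k k
  have t2 := h.trace n n
  have t3 := h.trace n k
  have p1 := h.pair l k k n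
  have p2 := h.pair m n k n
  have p3 := h.pair k m k n
  have p4 := h.pair l n k n
  simp only [*, h.self_left, h.self_right] at t1 t2 t3 p1 p2 p3 p4
  refine ⟨?_, ?_, ?_⟩ <;> grind

/-- The values on the null tetrad with `m̄ ∧ m` in the second pair, when `Ψ₁ = 0`. -/
theorem km_values (h₁ : mul4 c l n l m = 0) :
    mul4 c l n k m = 2 * mul4 c l m k n - mul4 c l n l n ∧
    mul4 c k m k m = 2 * mul4 c l m k n - mul4 c k m l n ∧
    mul4 c k n k m = mul4 c l n k n ∧ mul4 c k n l n = mul4 c l n k n ∧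
    mul4 c l k k m = -mul4 c l k l n ∧ mul4 c m n k m = -mul4 c m n l n ∧
    mul4 c l m l n = 0 ∧ mul4 c l m k m = 0 := by
  have hl := h.lm_values h₁
  have hk := h.kn_values
  obtain ⟨_, _, _, _, _, _, _, _, _, _, _, _⟩ := h.swap_mul4
  have t1 := h.trace l n
  have t2 := h.trace m k
  have t3 := h.trace l k
  have t4 := h.trace n m
  have y := h.cyclic l n k m
  have p1 := h.pair l n k m
  have p2 := h.pair k n k m
  have p3 := h.pair k n l n
  have p4 := h.pair l k k m
  have p5 := h.pair m n k m
  have p6 := h.pair l m l n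
  have p7 := h.pair l m k m
  have p8 := h.pair m n l k
  have p9 := h.pair l k l n
  have p10 := h.pair m n l n
  have p11 := h.pair l m k n
  simp only [*, h.self_left, h.self_right] at t1 t2 t3 t4 y p1 p2 p3 p4 p5 p6 p7 p8 p9 p10 p11
  refine ⟨?_, ?_, ?_, ?_, ?_, ?_, ?_, ?_⟩ <;> grind

end IsWeylLike

end Tetrad

section Bianchi

/-- The derivatives of the null tetrad of a spin dyad with `∇_z o = a o + b ι`,
`∇_z ι = e o - a ι`; the functions `a', b', e'` are the conjugate coefficients. -/
structure IsDyadConn (Γ : Fin 4 → Fin 4 → Fin 4 → ℂ) (l n m k : Fin 4 → ℂ)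
    (a b e a' b' e' : (Fin 4 → ℂ) → ℂ) : Prop where
  conn_l : ∀ z, conn Γ z l = (a z + a' z) • l + b z • k + b' z • m
  conn_m : ∀ z, conn Γ z m = (a z - a' z) • m + b z • n + e' z • l
  conn_k : ∀ z, conn Γ z k = (a' z - a z) • k + b' z • n + e z • l
  conn_n : ∀ z, conn Γ z n = (-(a z + a' z)) • n + e z • m + e' z • k

/-- Trace-free Weyl-like components `c` and their derivatives `dc` in the frame, with
`Ψ₀ = Ψ₁ = 0` and satisfying the second Bianchi identity. -/
structure IsTypeII (c : Fin 4 → Fin 4 → Fin 4 → Fin 4 → ℂ)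
    (dc : Fin 4 → Fin 4 → Fin 4 → Fin 4 → Fin 4 → ℂ) (Γ : Fin 4 → Fin 4 → Fin 4 → ℂ)
    (l n m k : Fin 4 → ℂ) : Prop where
  weyl : IsWeylLike c l n m k
  dweyl : ∀ i, IsWeylLike (dc i) l n m k
  psi₀ : mul4 c l m l m = 0
  psi₁ : mul4 c l n l m = 0
  dpsi₀ : ∀ i, mul4 (dc i) l m l m = 0
  dpsi₁ : ∀ i, mul4 (dc i) l n l m = 0
  bianchi : ∀ i j r p q, nablaComp c dc Γ i j r p q + nablaComp c dc Γ j r i p q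
      + nablaComp c dc Γ r i j p q = 0

theorem lin_neg (F u : Fin 4 → ℂ) : lin (fun i ↦ -F i) u = -lin F u := by
  simp [lin]

namespace IsTypeII

variable {c : Fin 4 → Fin 4 → Fin 4 → Fin 4 → ℂ}
  {dc : Fin 4 → Fin 4 → Fin 4 → Fin 4 → Fin 4 → ℂ} {Γ : Fin 4 → Fin 4 → Fin 4 → ℂ}
  {l n m k : Fin 4 → ℂ} {a b e a' b' e' : (Fin 4 → ℂ) → ℂ}

/-- The Bianchi identities for `Ψ₂` along the shear-free congruence. -/
theorem bianchi_psi₂ (h : IsTypeII c dc Γ l n m k) (hΓ : IsDyadConn Γ l n m k a b e a' b' e')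
    (hl : b l = 0) (hm : b m = 0) :
    lin (fun i ↦ mul4 (dc i) l m k n) l = -3 * b k * mul4 c l m k n ∧
    lin (fun i ↦ mul4 (dc i) l m k n) m = -3 * b n * mul4 c l m k n := by
  have B1 := nablaMul_cyclic h.bianchi l k n l m
  have B2 := nablaMul_cyclic h.bianchi m n k l m
  have h₀ := h.psi₀
  have h₁ := h.psi₁
  have d₀ := h.dpsi₀
  have d₁ := h.dpsi₁
  have dl i := (h.dweyl i).lm_values (d₁ i)
  have ds i := (h.dweyl i).swap_mul4
  have dsl i := (h.dweyl i).self_left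
  have dsr i := (h.dweyl i).self_right
  simp only [forall_and] at dl ds
  obtain ⟨_, _, _, _⟩ := dl
  obtain ⟨_, _, _, _, _, _, _, _, _, _, _, _⟩ := ds
  obtain ⟨_, _, _, _⟩ := h.weyl.lm_values h₁
  obtain ⟨_, _, _⟩ := h.weyl.kn_values
  obtain ⟨_, _, _, _, _, _, _, _⟩ := h.weyl.km_values h₁
  obtain ⟨_, _, _, _, _, _, _, _, _, _, _, _⟩ := h.weyl.swap_mul4
  have sl := h.weyl.self_left
  have sr := h.weyl.self_right
  simp only [nablaMul, hΓ.conn_l, hΓ.conn_m, hΓ.conn_k, hΓ.conn_n, hl, hm, mul4_add₁, mul4_add₂,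
    mul4_add₃, mul4_add₄, mul4_smul₁, mul4_smul₂, mul4_smul₃, mul4_smul₄] at B1 B2
  simp only [*, lin_zero, lin_neg] at B1 B2
  constructor
  · linear_combination B1
  · linear_combination -B2

/-- The Bianchi identities for the derivatives of `Ψ₃` along the shear-free congruence. -/
theorem bianchi_psi₃ (h : IsTypeII c dc Γ l n m k) (hΓ : IsDyadConn Γ l n m k a b e a' b' e')
    (hl : b l = 0) (hm : b m = 0) :
    lin (fun i ↦ mul4 (dc i) l n k n) l + 2 * a l * mul4 c l n k n
        - lin (fun i ↦ mul4 (dc i) l m k n) k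
      = 3 * e l * mul4 c l m k n - 2 * b k * mul4 c l n k n ∧
    lin (fun i ↦ mul4 (dc i) l m k n) n - lin (fun i ↦ mul4 (dc i) l n k n) m
        - 2 * a m * mul4 c l n k n
      = 2 * b n * mul4 c l n k n - 3 * e m * mul4 c l m k n := by
  have B1 := nablaMul_cyclic h.bianchi l k m k n
  have B2 := nablaMul_cyclic h.bianchi m n l k n
  have h₀ := h.psi₀
  have h₁ := h.psi₁
  have d₁ := h.dpsi₁
  have dl i := (h.dweyl i).kn_values
  have ds i := (h.dweyl i).swap_mul4
  have dsl i := (h.dweyl i).self_left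
  have dsr i := (h.dweyl i).self_right
  simp only [forall_and] at dl ds
  obtain ⟨_, _, _⟩ := dl
  obtain ⟨_, _, _, _, _, _, _, _, _, _, _, _⟩ := ds
  obtain ⟨_, _, _, _⟩ := h.weyl.lm_values h₁
  obtain ⟨_, _, _⟩ := h.weyl.kn_values
  obtain ⟨_, _, _, _, _, _, _, _⟩ := h.weyl.km_values h₁
  obtain ⟨_, _, _, _, _, _, _, _, _, _, _, _⟩ := h.weyl.swap_mul4
  have sl := h.weyl.self_left
  have sr := h.weyl.self_right
  simp only [nablaMul, hΓ.conn_l, hΓ.conn_m, hΓ.conn_k, hΓ.conn_n, hl, hm, mul4_add₁, mul4_add₂,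
    mul4_add₃, mul4_add₄, mul4_smul₁, mul4_smul₂, mul4_smul₃, mul4_smul₄] at B1 B2
  simp only [*, lin_zero, lin_neg] at B1 B2
  constructor
  · linear_combination B1
  · linear_combination B2

end IsTypeII

end Bianchi

section Derivative

variable {M : Type*} [TopologicalSpace M] [ChartedSpace E4 M]
  {V W : Type*} [NormedAddCommGroup V] [NormedSpace ℝ V] [NormedAddCommGroup W] [NormedSpace ℝ W]

theorem mvfderiv_comp_fderiv {Φ : V → W} {F : M → V} {x : M} (hΦ : DifferentiableAt ℝ Φ (F x))
    (hF : MDifferentiableAt (𝓡 4) 𝓘(ℝ, V) F x) (v : TangentSpace (𝓡 4) x) :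
    mvfderiv (𝓡 4) (fun y ↦ Φ (F y)) x v = fderiv ℝ Φ (F x) (mvfderiv (𝓡 4) F x v) := by
  have := mfderiv_comp_apply x hΦ.mdifferentiableAt hF v
  rw [mfderiv_eq_fderiv] at this
  exact this

theorem mdifferentiableAt_clm (L : V →L[ℝ] W) {F : M → V} {x : M}
    (hF : MDifferentiableAt (𝓡 4) 𝓘(ℝ, V) F x) :
    MDifferentiableAt (𝓡 4) 𝓘(ℝ, W) (fun y ↦ L (F y)) x :=
  L.mdifferentiableAt.comp x hF

theorem mvfderiv_clm (L : V →L[ℝ] W) {F : M → V} {x : M}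
    (hF : MDifferentiableAt (𝓡 4) 𝓘(ℝ, V) F x) (v : TangentSpace (𝓡 4) x) :
    mvfderiv (𝓡 4) (fun y ↦ L (F y)) x v = L (mvfderiv (𝓡 4) F x v) := by
  rw [mvfderiv_comp_fderiv L.differentiableAt hF, L.fderiv]

/-- Real-linear operations commute with derivatives. -/
theorem mvfderiv_lin {F : M → Fin 4 → ℂ} {x : M}
    (hF : ∀ i, MDifferentiableAt (𝓡 4) 𝓘(ℝ, ℂ) (fun y ↦ F y i) x) (u : Fin 4 → ℂ) :
    MDifferentiableAt (𝓡 4) 𝓘(ℝ, ℂ) (fun y ↦ lin (F y) u) x ∧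
      ∀ v, mvfderiv (𝓡 4) (fun y ↦ lin (F y) u) x v
        = lin (fun i ↦ mvfderiv (𝓡 4) (fun y ↦ F y i) x v) u := by
  have hm : ∀ i, MDifferentiableAt (𝓡 4) 𝓘(ℝ, ℂ) (fun y ↦ u i * F y i) x := fun i ↦
    mdifferentiableAt_clm (ContinuousLinearMap.mul ℝ ℂ (u i)) (hF i)
  have hd : ∀ i v, mvfderiv (𝓡 4) (fun y ↦ u i * F y i) x v
      = u i * mvfderiv (𝓡 4) (fun y ↦ F y i) x v := fun i ↦
    mvfderiv_clm (ContinuousLinearMap.mul ℝ ℂ (u i)) (hF i)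
  have he : (fun y ↦ lin (F y) u) = (fun y ↦ u 0 * F y 0) + (fun y ↦ u 1 * F y 1)
      + (fun y ↦ u 2 * F y 2) + fun y ↦ u 3 * F y 3 := by
    funext y
    simp [lin, Fin.sum_univ_four]
  have h2 := (hm 0).add (hm 1)
  have h3 := h2.add (hm 2)
  rw [he]
  refine ⟨h3.add (hm 3), fun v ↦ ?_⟩
  rw [mvfderiv_add h3 (hm 3), mvfderiv_add h2 (hm 2), mvfderiv_add (hm 0) (hm 1)]
  simp only [add_apply, hd, lin, Fin.sum_univ_four]

theorem mvfderiv_mul4 {c : M → Fin 4 → Fin 4 → Fin 4 → Fin 4 → ℂ} {x : M}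
    (hc : ∀ i j p q, MDifferentiableAt (𝓡 4) 𝓘(ℝ, ℂ) (fun y ↦ c y i j p q) x)
    (u v w s : Fin 4 → ℂ) :
    MDifferentiableAt (𝓡 4) 𝓘(ℝ, ℂ) (fun y ↦ mul4 (c y) u v w s) x ∧
      ∀ z, mvfderiv (𝓡 4) (fun y ↦ mul4 (c y) u v w s) x z
        = mul4 (fun i j p q ↦ mvfderiv (𝓡 4) (fun y ↦ c y i j p q) x z) u v w s := by
  have h1 i j p := mvfderiv_lin (hc i j p) s
  have h2 i j := mvfderiv_lin (fun p ↦ (h1 i j p).1) w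
  have h3 i := mvfderiv_lin (fun j ↦ (h2 i j).1) v
  have h4 := mvfderiv_lin (fun i ↦ (h3 i).1) u
  refine ⟨h4.1, fun z ↦ ?_⟩
  simp only [mul4, h4.2, h3, h2, h1]

theorem mvfderiv_ofReal {f : M → ℝ} {x : M} (hf : MDifferentiableAt (𝓡 4) 𝓘(ℝ) f x) :
    MDifferentiableAt (𝓡 4) 𝓘(ℝ, ℂ) (fun y ↦ (f y : ℂ)) x ∧
      ∀ v, mvfderiv (𝓡 4) (fun y ↦ (f y : ℂ)) x v = (mvfderiv (𝓡 4) f x v : ℝ) :=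
  ⟨mdifferentiableAt_clm Complex.ofRealCLM hf, mvfderiv_clm Complex.ofRealCLM hf⟩

end Derivative

section WeylComponents

/-- The vector `l` in the frame of real and imaginary parts of a null tetrad. -/
def tetL : Fin 4 → ℂ := ![1, 0, 0, 0]

/-- The vector `n` in the frame of real and imaginary parts of a null tetrad. -/
def tetN : Fin 4 → ℂ := ![0, 1, 0, 0]

/-- The vector `m` in the frame of real and imaginary parts of a null tetrad. -/
def tetM : Fin 4 → ℂ := ![0, 0, 1, Complex.I]

/-- The vector `m̄` in the frame of real and imaginary parts of a null tetrad. -/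
def tetK : Fin 4 → ℂ := ![0, 0, 1, -Complex.I]

/-- The algebraic identities of a Weyl tensor, in the frame of real and imaginary parts of a null
tetrad. -/
structure IsWeylComp (c : Fin 4 → Fin 4 → Fin 4 → Fin 4 → ℂ) : Prop where
  swap_left : ∀ i j p q, c j i p q = -c i j p q
  swap_right : ∀ i j p q, c i j q p = -c i j p q
  pair : ∀ i j p q, c p q i j = c i j p q
  cyclic : ∀ i j p q, c i j p q + c j p i q + c p i j q = 0
  trace : ∀ i p, c i 0 p 1 + c i 1 p 0 - 2 * c i 2 p 2 - 2 * c i 3 p 3 = 0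

theorem IsWeylComp.isWeylLike {c : Fin 4 → Fin 4 → Fin 4 → Fin 4 → ℂ} (h : IsWeylComp c) :
    IsWeylLike c tetL tetN tetM tetK where
  swap_left u v w s := by
    simp only [mul4, ← lin_neg, ← h.swap_left]
    rw [lin_comm]
  swap_right u v w s := by
    simp only [mul4, ← lin_neg, ← h.swap_right]
    refine congrArg (lin · u) (funext fun i ↦ congrArg (lin · v) (funext fun j ↦ ?_))
    rw [lin_comm]
  pair u v w s := by
    simp only [mul4]
    have h1 : ∀ i, lin (fun j ↦ lin (fun p ↦ lin (fun q ↦ c i j p q) v) u) s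
        = lin (fun p ↦ lin (fun q ↦ lin (fun j ↦ c i j p q) s) v) u := fun i ↦ by
      rw [lin_comm]
      refine congrArg (lin · u) (funext fun p ↦ ?_)
      rw [lin_comm]
    simp only [h1]
    rw [lin_comm]
    refine congrArg (lin · u) (funext fun p ↦ ?_)
    rw [lin_comm]
    refine congrArg (lin · v) (funext fun q ↦ ?_)
    simp only [h.pair p q]
  cyclic u v w s := by
    have h1 : mul4 c v w u s
        = lin (fun i ↦ lin (fun j ↦ lin (fun p ↦ lin (fun q ↦ c j p i q) s) w) v) u := by
      simp only [mul4]
      rw [lin_comm (u := u)]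
      refine congrArg (lin · v) (funext fun j ↦ ?_)
      rw [lin_comm]
    have h2 : mul4 c w u v s
        = lin (fun i ↦ lin (fun j ↦ lin (fun p ↦ lin (fun q ↦ c p i j q) s) w) v) u := by
      simp only [mul4]
      rw [lin_comm]
      refine congrArg (lin · u) (funext fun j ↦ ?_)
      rw [lin_comm]
    rw [h1, h2]
    simp only [mul4, ← lin_add, h.cyclic, lin_zero]
  trace u w := by
    have h1 : ∀ v s, mul4 c u v w s
        = lin (fun i ↦ lin (fun p ↦ lin (fun j ↦ lin (fun q ↦ c i j p q) s) v) w) u := fun v s ↦ by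
      refine congrArg (lin · u) (funext fun i ↦ ?_)
      rw [lin_comm]
    rw [h1, h1, h1, h1, ← lin_add, ← lin_sub, ← lin_sub]
    simp only [← lin_add, ← lin_sub]
    rw [← lin_zero u]
    refine congrArg (lin · u) (funext fun i ↦ ?_)
    rw [← lin_zero w]
    refine congrArg (lin · w) (funext fun p ↦ ?_)
    simp [lin, Fin.sum_univ_four, tetL, tetN, tetM, tetK]
    linear_combination h.trace i p + 2 * c i 3 p 3 * Complex.I_sq

end WeylComponents

namespace IsCurvatureLike

variable {V : Type*} [AddCommGroup V] [Module ℝ V] {R : V → V → V → V → ℝ}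

theorem add₂ (h : IsCurvatureLike R) (a b b' c d : V) :
    R a (b + b') c d = R a b c d + R a b' c d := by
  rw [h.swap_left, h.add_left, h.swap_left a b, h.swap_left a b']
  ring

theorem smul₂ (h : IsCurvatureLike R) (r : ℝ) (a b c d : V) :
    R a (r • b) c d = r * R a b c d := by
  rw [h.swap_left, h.smul_left, h.swap_left a b]
  ring

theorem add₃ (h : IsCurvatureLike R) (a b c c' d : V) :
    R a b (c + c') d = R a b c d + R a b c' d := by
  rw [h.pair_symm, h.add_left, h.pair_symm a b c, h.pair_symm a b c']

theorem smul₃ (h : IsCurvatureLike R) (r : ℝ) (a b c d : V) :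
    R a b (r • c) d = r * R a b c d := by
  rw [h.pair_symm, h.smul_left, h.pair_symm a b c]

theorem add₄ (h : IsCurvatureLike R) (a b c d d' : V) :
    R a b c (d + d') = R a b c d + R a b c d' := by
  rw [h.pair_symm, h.add₂, h.pair_symm a b c, h.pair_symm a b c]

theorem smul₄ (h : IsCurvatureLike R) (r : ℝ) (a b c d : V) :
    R a b c (r • d) = r * R a b c d := by
  rw [h.pair_symm, h.smul₂, h.pair_symm a b c]

end IsCurvatureLike

section Frame

variable {M : Type*} [TopologicalSpace M] [ChartedSpace E4 M] [IsManifold (𝓡 4) ∞ M]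
  {g : LorentzMetric M} {D : Connection M}

theorem ConstFrame.isCurvatureLike_weyl (e : ConstFrame g) (hD : IsLeviCivita g D)
    (hE : IsEinstein g D) (x : M) : IsCurvatureLike (weyl g D x) := by
  obtain ⟨L, hw, -⟩ := hE.weyl_eq
  have h := e.isCurvatureLike_riemann hD x
  constructor
  · intro a a' b c d
    simp only [hw, h.add_left, map_add, add_apply]
    ring
  · intro r a b c d
    simp only [hw, h.smul_left, map_smul, smul_apply, smul_eq_mul]
    ring
  · intro a b c d
    rw [hw, hw, h.swap_left]
    ring
  · intro a b c d
    rw [hw, hw, h.swap_right]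
    ring
  · intro a b c d
    simp only [hw]
    rw [g.symm x b a, g.symm x c a, g.symm x c b]
    linear_combination h.cyclic a b c d

/-- The second Bianchi identity for the Weyl tensor of an Einstein metric. -/
theorem ConstFrame.weyl_second_bianchi (e : ConstFrame g) (hD : IsLeviCivita g D)
    (hE : IsEinstein g D) (k i j p q : Fin 4) (x : M) :
    nablaTensor D (weyl g D) (e.vec k) (e.vec i) (e.vec j) (e.vec p) (e.vec q) x
      + nablaTensor D (weyl g D) (e.vec i) (e.vec j) (e.vec k) (e.vec p) (e.vec q) x
      + nablaTensor D (weyl g D) (e.vec j) (e.vec k) (e.vec i) (e.vec p) (e.vec q) x = 0 := by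
  obtain ⟨L, hw, -⟩ := hE.weyl_eq
  have key : ∀ k i j p q,
      nablaTensor D (weyl g D) (e.vec k) (e.vec i) (e.vec j) (e.vec p) (e.vec q) x
        = nablaTensor D (riemann g D) (e.vec k) (e.vec i) (e.vec j) (e.vec p) (e.vec q) x := by
    intro k i j p q
    have hr := (e.contMDiffAt_riemann hD (e.field i) (e.field j) (e.field p) (e.field q)
      x).mdifferentiableAt (by simp)
    have hd : mvfderiv (𝓡 4) (fun y ↦ weyl g D y (e.vec i y) (e.vec j y) (e.vec p y) (e.vec q y))
        x = mvfderiv (𝓡 4) (fun y ↦ riemann g D y (e.vec i y) (e.vec j y) (e.vec p y) (e.vec q y))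
        x := by
      simp only [hw, e.val_vec]
      have := mvfderiv_sub hr (mdifferentiableAt_const
        (c := 2 * L * (e.gram i p * e.gram j q - e.gram i q * e.gram j p)))
      rw [mvfderiv_const, sub_zero] at this
      exact this
    have s := fun a b ↦ e.val_cov_skew hD a b x (e.vec k x)
    rw [nablaTensor, nablaTensor, hd]
    simp only [hw, g.symm x (e.vec _ x) (D _ _ _), e.val_vec]
    have s1 := s i p
    have s2 := s i q
    have s3 := s j p
    have s4 := s j q
    rw [s1, s2, s3, s4]
    ring
  rw [key, key, key]
  exact e.riemann_second_bianchi hD (e.field i) (e.field j) (e.field k) (e.field p) (e.field q) x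

namespace ConstFrame

variable (e : ConstFrame g)

/-- The components of the Weyl tensor in the frame. -/
def weylComp (D : Connection M) (x : M) (i j p q : Fin 4) : ℂ :=
  (weyl g D x (e.vec i x) (e.vec j x) (e.vec p x) (e.vec q x) : ℝ)

/-- The derivatives of the components of the Weyl tensor. -/
def dweylComp (D : Connection M) (x : M) (k i j p q : Fin 4) : ℂ :=
  mvfderiv (𝓡 4) (fun y ↦ e.weylComp D y i j p q) x (e.vec k x)

/-- The connection coefficients of the frame. -/
def christoffel (D : Connection M) (x : M) (k i r : Fin 4) : ℂ :=
  (e.co r (D (e.vec i) x (e.vec k x)) : ℝ)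

/-- The components of a complexified vector. -/
def coC {x : M} (u : CTangent x) (i : Fin 4) : ℂ := e.co i u.1 + Complex.I * e.co i u.2

theorem cext_eq_lin {x : M} {f : TangentSpace (𝓡 4) x → ℂ} (hadd : ∀ u v, f (u + v) = f u + f v)
    (hsmul : ∀ (r : ℝ) u, f (r • u) = r * f u) (u : CTangent x) :
    cext f u = lin (fun i ↦ f (e.vec i x)) (e.coC u) := by
  let F : TangentSpace (𝓡 4) x →ₗ[ℝ] ℂ :=
    { toFun := f, map_add' := hadd, map_smul' := fun r u ↦ by rw [hsmul]; simp }
  have h : ∀ v, f v = ∑ i, (e.co i v : ℂ) * f (e.vec i x) := fun v ↦ by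
    have := e.map_eq_sum F v
    simpa [F] using this
  rw [cext, h u.1, h u.2]
  simp only [lin, coC, add_mul, Finset.sum_add_distrib, Finset.mul_sum, mul_assoc]

theorem weylC_eq (hD : IsLeviCivita g D) (hE : IsEinstein g D) {x : M} (a b c d : CTangent x) :
    SpinDyad.weylC g D a b c d
      = mul4 (e.weylComp D x) (e.coC a) (e.coC b) (e.coC c) (e.coC d) := by
  have h := e.isCurvatureLike_weyl hD hE x
  unfold SpinDyad.weylC mul4
  simp only [weylComp]
  have h4 : ∀ a' b' c', cext (fun e' ↦ (weyl g D x a' b' c' e' : ℂ)) d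
      = lin (fun q ↦ (weyl g D x a' b' c' (e.vec q x) : ℂ)) (e.coC d) := fun a' b' c' ↦
    e.cext_eq_lin (fun u v ↦ by rw [h.add₄]; push_cast; rfl)
      (fun r u ↦ by rw [h.smul₄]; push_cast; rfl) d
  simp only [h4]
  have h3 : ∀ a' b', cext (fun c' ↦ lin (fun q ↦ (weyl g D x a' b' c' (e.vec q x) : ℂ)) (e.coC d)) c
      = lin (fun p ↦ lin (fun q ↦ (weyl g D x a' b' (e.vec p x) (e.vec q x) : ℂ)) (e.coC d))
        (e.coC c) := fun a' b' ↦
    e.cext_eq_lin (fun u v ↦ by simp only [h.add₃, Complex.ofReal_add, lin_add])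
      (fun r u ↦ by simp only [h.smul₃, Complex.ofReal_mul, lin_mul]) c
  simp only [h3]
  have h2 : ∀ a', cext (fun b' ↦ lin (fun p ↦ lin (fun q ↦
        (weyl g D x a' b' (e.vec p x) (e.vec q x) : ℂ)) (e.coC d)) (e.coC c)) b
      = lin (fun j ↦ lin (fun p ↦ lin (fun q ↦
        (weyl g D x a' (e.vec j x) (e.vec p x) (e.vec q x) : ℂ)) (e.coC d)) (e.coC c))
        (e.coC b) := fun a' ↦
    e.cext_eq_lin (fun u v ↦ by simp only [h.add₂, Complex.ofReal_add, lin_add])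
      (fun r u ↦ by simp only [h.smul₂, Complex.ofReal_mul, lin_mul]) b
  simp only [h2]
  exact e.cext_eq_lin (fun u v ↦ by simp only [h.add_left, Complex.ofReal_add, lin_add])
      (fun r u ↦ by simp only [h.smul_left, Complex.ofReal_mul, lin_mul]) a

theorem mdifferentiableAt_weylComp (hD : IsLeviCivita g D) (hE : IsEinstein g D) (x : M)
    (i j p q : Fin 4) :
    MDifferentiableAt (𝓡 4) 𝓘(ℝ) (fun y ↦ weyl g D y (e.vec i y) (e.vec j y) (e.vec p y)
      (e.vec q y)) x := by
  obtain ⟨L, hw, -⟩ := hE.weyl_eq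
  simp only [hw, e.val_vec]
  exact ((e.contMDiffAt_riemann hD (e.field i) (e.field j) (e.field p) (e.field q)
      x).mdifferentiableAt (by simp)).sub mdifferentiableAt_const

theorem nablaComp_weylComp (hD : IsLeviCivita g D) (hE : IsEinstein g D) (x : M)
    (k i j p q : Fin 4) :
    nablaComp (e.weylComp D x) (e.dweylComp D x) (e.christoffel D x) k i j p q
      = (nablaTensor D (weyl g D) (e.vec k) (e.vec i) (e.vec j) (e.vec p) (e.vec q) x : ℝ) := by
  have h := e.isCurvatureLike_weyl hD hE x
  have hs : ∀ {f : TangentSpace (𝓡 4) x → ℝ} (_ : ∀ u v, f (u + v) = f u + f v)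
      (_ : ∀ (r : ℝ) u, f (r • u) = r * f u) (u : TangentSpace (𝓡 4) x),
      f u = ∑ i, e.co i u * f (e.vec i x) := fun {f} hadd hsmul u ↦ by
    let F : TangentSpace (𝓡 4) x →ₗ[ℝ] ℝ :=
      { toFun := f, map_add' := hadd, map_smul' := fun r u ↦ by rw [hsmul]; simp }
    exact e.map_eq_sum F u
  have h1 := hs (f := fun u ↦ weyl g D x u (e.vec j x) (e.vec p x) (e.vec q x))
    (fun _ _ ↦ h.add_left _ _ _ _ _) (fun _ _ ↦ h.smul_left _ _ _ _ _) (D (e.vec i) x (e.vec k x))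
  have h2 := hs (f := fun u ↦ weyl g D x (e.vec i x) u (e.vec p x) (e.vec q x))
    (fun _ _ ↦ h.add₂ _ _ _ _ _) (fun _ _ ↦ h.smul₂ _ _ _ _ _) (D (e.vec j) x (e.vec k x))
  have h3 := hs (f := fun u ↦ weyl g D x (e.vec i x) (e.vec j x) u (e.vec q x))
    (fun _ _ ↦ h.add₃ _ _ _ _ _) (fun _ _ ↦ h.smul₃ _ _ _ _ _) (D (e.vec p) x (e.vec k x))
  have h4 := hs (f := fun u ↦ weyl g D x (e.vec i x) (e.vec j x) (e.vec p x) u)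
    (fun _ _ ↦ h.add₄ _ _ _ _ _) (fun _ _ ↦ h.smul₄ _ _ _ _ _) (D (e.vec q) x (e.vec k x))
  rw [nablaTensor, h1, h2, h3, h4]
  simp only [nablaComp, dweylComp, christoffel, weylComp,
    (mvfderiv_ofReal (e.mdifferentiableAt_weylComp hD hE x i j p q)).2]
  push_cast
  rfl

/-- The inverse Gram matrix of the real and imaginary parts of a null tetrad. -/
def nullGramInv : Matrix (Fin 4) (Fin 4) ℝ :=
  !![0, 1, 0, 0; 1, 0, 0, 0; 0, 0, -2, 0; 0, 0, 0, -2]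

theorem isWeylComp_weylComp (hD : IsLeviCivita g D) (hE : IsEinstein g D)
    (hG : e.gramInv = nullGramInv) (x : M) : IsWeylComp (e.weylComp D x) := by
  have h := e.isCurvatureLike_weyl hD hE x
  constructor
  · intro i j p q
    simp only [weylComp]
    rw [h.swap_left]
    push_cast
    rfl
  · intro i j p q
    simp only [weylComp]
    rw [h.swap_right]
    push_cast
    rfl
  · intro i j p q
    simp only [weylComp]
    rw [h.pair_symm]
  · intro i j p q
    simp only [weylComp]
    exact_mod_cast h.cyclic _ _ _ _
  · intro i p
    have ht := hE.mtrace_weyl x (e.vec i x) (e.vec p x)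
    have hm := e.mtrace_eq x (LinearMap.mk₂ ℝ
      (fun b d ↦ weyl g D x (e.vec i x) b (e.vec p x) d) (fun _ _ _ ↦ h.add₂ _ _ _ _ _)
      (fun _ _ _ ↦ h.smul₂ _ _ _ _ _) (fun _ _ _ ↦ h.add₄ _ _ _ _ _)
      (fun _ _ _ ↦ h.smul₄ _ _ _ _ _))
    simp only [LinearMap.mk₂_apply] at hm
    rw [ht, hG] at hm
    simp [Fin.sum_univ_four, nullGramInv] at hm
    simp only [weylComp]
    norm_cast
    linarith

theorem isWeylComp_dweylComp (hD : IsLeviCivita g D) (hE : IsEinstein g D)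
    (hG : e.gramInv = nullGramInv) (x : M) (k : Fin 4) : IsWeylComp (e.dweylComp D x k) := by
  have h := e.isWeylComp_weylComp hD hE hG
  have hd : ∀ i j p q, MDifferentiableAt (𝓡 4) 𝓘(ℝ, ℂ) (fun y ↦ e.weylComp D y i j p q) x :=
    fun i j p q ↦ (mvfderiv_ofReal (e.mdifferentiableAt_weylComp hD hE x i j p q)).1
  have hneg : ∀ f : M → ℂ, mvfderiv (𝓡 4) (fun y ↦ -f y) x = -mvfderiv (𝓡 4) f x :=
    fun f ↦ mvfderiv_neg
  constructor
  · intro i j p q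
    simp only [dweylComp, fun y ↦ (h y).swap_left i j p q, hneg]
    rfl
  · intro i j p q
    simp only [dweylComp, fun y ↦ (h y).swap_right i j p q, hneg]
    rfl
  · intro i j p q
    simp only [dweylComp, fun y ↦ (h y).pair i j p q]
  · intro i j p q
    have h1 := mvfderiv_add ((hd i j p q).add (hd j p i q)) (hd p i j q)
    rw [mvfderiv_add (hd i j p q) (hd j p i q)] at h1
    have h2 : ((fun y ↦ e.weylComp D y i j p q) + fun y ↦ e.weylComp D y j p i q)
        + (fun y ↦ e.weylComp D y p i j q) = fun _ ↦ 0 := funext fun y ↦ (h y).cyclic i j p q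
    rw [h2, mvfderiv_const] at h1
    exact (congrArg (fun L ↦ L (e.vec k x)) h1).symm
  · intro i p
    have hm : ∀ j, mvfderiv (𝓡 4) (fun y ↦ 2 * e.weylComp D y i j p j) x (e.vec k x)
        = 2 * e.dweylComp D x k i j p j := fun j ↦
      mvfderiv_clm (ContinuousLinearMap.mul ℝ ℂ 2) (hd i j p j) _
    have hm' : ∀ j, MDifferentiableAt (𝓡 4) 𝓘(ℝ, ℂ) (fun y ↦ 2 * e.weylComp D y i j p j) x :=
      fun j ↦ mdifferentiableAt_clm (ContinuousLinearMap.mul ℝ ℂ 2) (hd i j p j)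
    have d1 := (hd i 0 p 1).add (hd i 1 p 0)
    have h1 := mvfderiv_sub (d1.sub (hm' 2)) (hm' 3)
    rw [mvfderiv_sub d1 (hm' 2), mvfderiv_add (hd i 0 p 1) (hd i 1 p 0)] at h1
    have h2 : ((fun y ↦ e.weylComp D y i 0 p 1) + fun y ↦ e.weylComp D y i 1 p 0)
        - (fun y ↦ 2 * e.weylComp D y i 2 p 2) - (fun y ↦ 2 * e.weylComp D y i 3 p 3)
        = fun _ ↦ 0 := funext fun y ↦ (h y).trace i p
    rw [h2, mvfderiv_const] at h1
    rw [← hm, ← hm]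
    exact (congrArg (fun L ↦ L (e.vec k x)) h1).symm

/-- In a null frame in which `Ψ₀ = Ψ₁ = 0`, the Weyl tensor of an Einstein metric satisfies the
Bianchi identities of type II. -/
theorem isTypeII (hD : IsLeviCivita g D) (hE : IsEinstein g D) (hG : e.gramInv = nullGramInv)
    (h₀ : ∀ x, mul4 (e.weylComp D x) tetL tetM tetL tetM = 0)
    (h₁ : ∀ x, mul4 (e.weylComp D x) tetL tetN tetL tetM = 0) (x : M) :
    IsTypeII (e.weylComp D x) (e.dweylComp D x) (e.christoffel D x) tetL tetN tetM tetK where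
  weyl := (e.isWeylComp_weylComp hD hE hG x).isWeylLike
  dweyl i := (e.isWeylComp_dweylComp hD hE hG x i).isWeylLike
  psi₀ := h₀ x
  psi₁ := h₁ x
  dpsi₀ i := by
    have h := (mvfderiv_mul4 (c := e.weylComp D) (fun i j p q ↦
      (mvfderiv_ofReal (e.mdifferentiableAt_weylComp hD hE x i j p q)).1)
      tetL tetM tetL tetM).2 (e.vec i x)
    exact h.symm.trans (by simp only [h₀, mvfderiv_const]; rfl)
  dpsi₁ i := by
    have h := (mvfderiv_mul4 (c := e.weylComp D) (fun i j p q ↦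
      (mvfderiv_ofReal (e.mdifferentiableAt_weylComp hD hE x i j p q)).1)
      tetL tetN tetL tetM).2 (e.vec i x)
    exact h.symm.trans (by simp only [h₁, mvfderiv_const]; rfl)
  bianchi i j r p q := by
    rw [e.nablaComp_weylComp hD hE, e.nablaComp_weylComp hD hE, e.nablaComp_weylComp hD hE]
    exact_mod_cast e.weyl_second_bianchi hD hE i j r p q x

end ConstFrame

end Frame

set_option linter.unusedSectionVars false

section Spin

variable {M : Type*} [TopologicalSpace M] [ChartedSpace E4 M] [IsManifold (𝓡 4) ∞ M]
  {S : M → Type*} [TopologicalSpace (TotalSpace C2 S)]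
  [∀ x, AddCommGroup (S x)] [∀ x, Module ℂ (S x)] [∀ x, TopologicalSpace (S x)]
  [∀ x, IsTopologicalAddGroup (S x)] [∀ x, ContinuousSMul ℝ (S x)]
  [FiberBundle C2 S] [VectorBundle ℝ C2 S] [ContMDiffVectorBundle ∞ C2 S (𝓡 4)]
  {g : LorentzMetric M} {σ : SpinStructure S g}

namespace SpinStructure

theorem eps_skew (σ : SpinStructure S g) (x : M) (α β : S x) : σ.eps x α β = -σ.eps x β α := by
  have h := σ.eps_alt x (α + β)
  simp only [map_add, add_apply, σ.eps_alt] at h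
  linear_combination h

theorem eps_smul_right (σ : SpinStructure S g) (x : M) (c : ℂ) (α β : S x) :
    σ.eps x α (c • β) = c * σ.eps x α β := by
  rw [σ.eps_skew, σ.eps_smul, σ.eps_skew x β]
  ring

end SpinStructure

variable (S) in
theorem finrank_spinor (x : M) : Module.finrank ℂ (S x) = 2 := by
  have h1 := finrank_real_of_complex (S x)
  have e := ((trivializationAt C2 S x).continuousLinearEquivAt ℝ x
    (FiberBundle.mem_baseSet_trivializationAt' x)).toLinearEquiv.finrank_eq
  have h2 := finrank_real_of_complex C2
  rw [Module.finrank_fin_fun] at h2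
  omega

namespace SpinDyad

variable (d : SpinDyad σ)

theorem eps_ι_o (x : M) : σ.eps x (d.ι x) (d.o x) = -1 := by
  rw [σ.eps_skew, d.normalised]

theorem expand (x : M) (s : S x) :
    s = σ.eps x s (d.ι x) • d.o x - σ.eps x s (d.o x) • d.ι x := by
  have hli : LinearIndependent ℂ ![d.o x, d.ι x] := by
    rw [LinearIndependent.pair_iff]
    intro a b hab
    have h1 : σ.eps x (a • d.o x + b • d.ι x) (d.ι x) = 0 := by rw [hab]; simp
    have h2 : σ.eps x (a • d.o x + b • d.ι x) (d.o x) = 0 := by rw [hab]; simp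
    simp only [map_add, add_apply, σ.eps_smul, σ.eps_alt, d.normalised, d.eps_ι_o] at h1 h2
    constructor
    · simpa using h1
    · simpa using h2
  have : FiniteDimensional ℂ (S x) :=
    Module.finite_of_finrank_pos (by rw [finrank_spinor S x]; norm_num)
  have hspan := hli.span_eq_top_of_card_eq_finrank' (by simp [finrank_spinor S x])
  have hs : s ∈ Submodule.span ℂ (Set.range ![d.o x, d.ι x]) := by rw [hspan]; trivial
  simp only [Matrix.range_cons, Matrix.range_empty, Set.union_empty, Set.singleton_union,
    Submodule.mem_span_pair] at hs
  obtain ⟨a, b, rfl⟩ := hs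
  simp only [map_add, add_apply, σ.eps_smul, σ.eps_alt, d.normalised, d.eps_ι_o]
  simp

/-- A spinor field is smooth as soon as its components in a smooth dyad are. -/
theorem contMDiffAt_of_eps {s : ∀ x : M, S x} {x : M}
    (ho : ContMDiffAt (𝓡 4) 𝓘(ℝ, ℂ) ∞ (fun y ↦ σ.eps y (d.o y) (s y)) x)
    (hι : ContMDiffAt (𝓡 4) 𝓘(ℝ, ℂ) ∞ (fun y ↦ σ.eps y (d.ι y) (s y)) x) :
    ContMDiffAt (𝓡 4) ((𝓡 4).prod 𝓘(ℝ, C2)) ∞ (fun y ↦ TotalSpace.mk' C2 y (s y)) x := by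
  rw [contMDiffAt_section]
  set t := trivializationAt C2 S x with ht
  have hx : x ∈ t.baseSet := FiberBundle.mem_baseSet_trivializationAt' x
  let Q : ∀ α : (∀ y : M, S y), M → C2 →L[ℝ] ℂ := fun α y ↦
    ContinuousLinearMap.inCoordinates C2 S ℂ (Bundle.Trivial M ℂ) x y x y (σ.eps y (α y))
  have hQ : ∀ α : (∀ y : M, S y), ContMDiff (𝓡 4) ((𝓡 4).prod 𝓘(ℝ, C2)) ∞
      (fun y ↦ TotalSpace.mk' C2 y (α y)) → ContMDiffAt (𝓡 4) 𝓘(ℝ, C2 →L[ℝ] ℂ) ∞ (Q α) x := by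
    intro α hα
    have h : ContMDiffAt (𝓡 4) ((𝓡 4).prod 𝓘(ℝ, C2 →L[ℝ] ℂ)) ∞
        (fun y ↦ TotalSpace.mk' (C2 →L[ℝ] ℂ) (E := fun y ↦ S y →L[ℝ] Bundle.Trivial M ℂ y) y
          (σ.eps y (α y))) x :=
      ContMDiffAt.clm_bundle_apply (F₁ := C2) (F₂ := C2 →L[ℝ] ℂ)
        (E₂ := fun y ↦ S y →L[ℝ] Bundle.Trivial M ℂ y) (σ.eps_smooth x) (hα x)
    rw [contMDiffAt_hom_bundle] at h
    exact h.2
  have hQa : ∀ (α : ∀ y : M, S y) (y : M), y ∈ t.baseSet → ∀ u : S y,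
      Q α y (t ⟨y, u⟩).2 = σ.eps y (α y) u := by
    intro α y hy u
    simp only [Q]
    rw [ContinuousLinearMap.inCoordinates_eq hy (by simp)]
    have : (t.continuousLinearEquivAt ℝ y hy).symm (t ⟨y, u⟩).2 = u :=
      (t.continuousLinearEquivAt ℝ y hy).symm_apply_apply u
    exact congrArg (σ.eps y (α y)) this
  let P : M → C2 →L[ℝ] ℂ × ℂ := fun y ↦
    ContinuousLinearMap.compL ℝ C2 ℂ (ℂ × ℂ) (ContinuousLinearMap.inl ℝ ℂ ℂ) (Q d.o y)
      + ContinuousLinearMap.compL ℝ C2 ℂ (ℂ × ℂ) (ContinuousLinearMap.inr ℝ ℂ ℂ) (Q d.ι y)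
  have hPa : ∀ y ∈ t.baseSet, ∀ u : S y,
      P y (t ⟨y, u⟩).2 = (σ.eps y (d.o y) u, σ.eps y (d.ι y) u) := by
    intro y hy u
    simp [P, hQa _ y hy]
  have hP : ContMDiffAt (𝓡 4) 𝓘(ℝ, C2 →L[ℝ] ℂ × ℂ) ∞ P x :=
    ((ContinuousLinearMap.contMDiff _).contMDiffAt.comp x (hQ _ d.o_smooth)).add
      ((ContinuousLinearMap.contMDiff _).contMDiffAt.comp x (hQ _ d.ι_smooth))
  have hinv : ∀ y ∈ t.baseSet, (P y).IsInvertible := by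
    intro y hy
    have hinj : Function.Injective (P y : C2 →ₗ[ℝ] ℂ × ℂ) := by
      rw [← LinearMap.ker_eq_bot, LinearMap.ker_eq_bot']
      intro v hv
      let E := t.continuousLinearEquivAt ℝ y hy
      have hv' : (t ⟨y, E.symm v⟩).2 = v := E.apply_symm_apply v
      have h := hPa y hy (E.symm v)
      rw [hv'] at h
      have h0 := h.symm.trans hv
      rw [Prod.mk_eq_zero] at h0
      have hz := d.expand y (E.symm v)
      rw [σ.eps_skew y (E.symm v), σ.eps_skew y (E.symm v), h0.1, h0.2] at hz
      simp only [neg_zero, zero_smul, sub_zero] at hz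
      simpa using congrArg E hz
    have hf : Module.finrank ℝ C2 = Module.finrank ℝ (ℂ × ℂ) := by
      rw [finrank_real_of_complex, finrank_real_of_complex]
      simp
    exact ⟨(LinearEquiv.ofInjectiveOfFinrankEq _ hinj hf).toContinuousLinearEquiv, rfl⟩
  have hP' := (hinv x hx).contDiffAt_map_inverse (n := ∞)
  have h1 : ContMDiffAt (𝓡 4) 𝓘(ℝ, ℂ × ℂ →L[ℝ] C2) ∞ (fun y ↦ (P y).inverse) x :=
    hP'.contMDiffAt.comp x hP
  have h2 := h1.clm_apply (ho.prodMk_space hι)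
  refine h2.congr_of_eventuallyEq ?_
  filter_upwards [t.open_baseSet.mem_nhds hx] with y hy
  exact ((hinv y hy).inverse_apply_eq.2 (hPa y hy (s y)).symm).symm

theorem smooth_I_smul_ι : ContMDiff (𝓡 4) ((𝓡 4).prod 𝓘(ℝ, C2)) ∞
    (fun x ↦ TotalSpace.mk' C2 x (Complex.I • d.ι x)) := fun x ↦ by
  refine d.contMDiffAt_of_eps ?_ ?_
  · simp only [σ.eps_smul_right, d.normalised]
    exact contMDiffAt_const
  · simp only [σ.eps_smul_right, σ.eps_alt]
    exact contMDiffAt_const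

end SpinDyad

end Spin

section Spin

variable {M : Type*} [TopologicalSpace M] [ChartedSpace E4 M] [IsManifold (𝓡 4) ∞ M]
  {S : M → Type*} [TopologicalSpace (TotalSpace C2 S)]
  [∀ x, AddCommGroup (S x)] [∀ x, Module ℂ (S x)] [∀ x, TopologicalSpace (S x)]
  [∀ x, IsTopologicalAddGroup (S x)] [∀ x, ContinuousSMul ℝ (S x)]
  [FiberBundle C2 S] [VectorBundle ℝ C2 S] [ContMDiffVectorBundle ∞ C2 S (𝓡 4)]
  {g : LorentzMetric M} {σ : SpinStructure S g}

namespace SpinStructure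

theorem sol_I_right (σ : SpinStructure S g) (x : M) (α β : S x) :
    σ.sol x α (Complex.I • β) = -σ.sol x (Complex.I • α) β := by
  rw [← σ.sol_I x α, smul_smul, Complex.I_mul_I, neg_one_smul, map_neg]

theorem sol_I_self (σ : SpinStructure S g) (x : M) (α : S x) :
    σ.sol x α (Complex.I • α) = 0 := by
  have h := σ.sol_I_right x α α
  rw [σ.sol_symm x (Complex.I • α)] at h
  have h2 : (2 : ℝ) • σ.sol x α (Complex.I • α) = 0 := by
    rw [two_smul]
    exact eq_neg_iff_add_eq_zero.1 h
  exact (smul_eq_zero.1 h2).resolve_left two_ne_zero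

/-- The metric on the vectors `Re (α^A β̄^{A'})`. -/
theorem val_sol (σ : SpinStructure S g) (x : M) (α β γ δ : S x) :
    g.val x (σ.sol x α β) (σ.sol x γ δ)
      = (σ.eps x α γ * (starRingEnd ℂ) (σ.eps x β δ)
        + σ.eps x α δ * (starRingEnd ℂ) (σ.eps x β γ)).re / 2 := by
  have h1 := congrArg Complex.re (σ.sol_metric x α β γ δ)
  have h2 := congrArg Complex.re (σ.sol_metric x α β δ γ)
  have h3 : σ.sol x δ (Complex.I • γ) = -σ.sol x γ (Complex.I • δ) := by
    rw [σ.sol_I_right, σ.sol_symm]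
  rw [Complex.add_re, ← h1, ← h2]
  simp only [cext, cvec, h3, σ.sol_symm x δ γ, map_neg]
  simp
  ring

theorem fieldAt_sol (σ : SpinStructure S g) {α β : ∀ x : M, S x}
    (hα : ContMDiff (𝓡 4) ((𝓡 4).prod 𝓘(ℝ, C2)) ∞ (fun x ↦ TotalSpace.mk' C2 x (α x)))
    (hβ : ContMDiff (𝓡 4) ((𝓡 4).prod 𝓘(ℝ, C2)) ∞ (fun x ↦ TotalSpace.mk' C2 x (β x)))
    (x : M) : FieldAt ∞ (fun y ↦ σ.sol y (α y) (β y)) x := by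
  apply ContMDiffAt.clm_bundle_apply₂ (F₁ := C2) (F₂ := C2)
  · exact σ.sol_smooth x
  · exact hα x
  · exact hβ x

end SpinStructure

theorem complex_smul_eq {V : Type*} [AddCommGroup V] [Module ℂ V] (c : ℂ) (v : V) :
    c • v = c.re • v + c.im • (Complex.I • v) := by
  conv_lhs => rw [← Complex.re_add_im c, add_smul, mul_smul]
  rfl

namespace ConstFrame

variable (e : ConstFrame g)

/-- The components of `α^A β̄^{A'}`. -/
def cv (σ : SpinStructure S g) {x : M} (α β : S x) : Fin 4 → ℂ := e.coC (cvec (σ.sol x) α β)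

theorem cv_add_left {x : M} (α α' β : S x) : e.cv σ (α + α') β = e.cv σ α β + e.cv σ α' β := by
  funext i
  simp only [cv, coC, cvec, map_add, add_apply, co_add, Complex.ofReal_add, Pi.add_apply]
  ring

theorem cv_add_right {x : M} (α β β' : S x) : e.cv σ α (β + β') = e.cv σ α β + e.cv σ α β' := by
  funext i
  simp only [cv, coC, cvec, smul_add, map_add, co_add, Complex.ofReal_add, Pi.add_apply]
  ring

theorem co_neg (i : Fin 4) {x : M} (v : TangentSpace (𝓡 4) x) : e.co i (-v) = -e.co i v := by
  simpa using e.co_smul i (-1) v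

theorem cv_I_smul_left {x : M} (α β : S x) :
    e.cv σ (Complex.I • α) β = Complex.I • e.cv σ α β := by
  funext i
  simp only [cv, coC, cvec, σ.sol_I, σ.sol_I_right x α, co_neg, Pi.smul_apply, smul_eq_mul]
  push_cast
  linear_combination (e.co i (σ.sol x (Complex.I • α) β) : ℂ) * Complex.I_sq

theorem cv_I_smul_right {x : M} (α β : S x) :
    e.cv σ α (Complex.I • β) = -Complex.I • e.cv σ α β := by
  funext i
  simp only [cv, coC, cvec, smul_smul, Complex.I_mul_I, neg_one_smul, map_neg, co_neg,
    Pi.smul_apply, smul_eq_mul]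
  push_cast
  linear_combination (e.co i (σ.sol x α (Complex.I • β)) : ℂ) * Complex.I_sq

theorem cv_real_smul_left {x : M} (r : ℝ) (α β : S x) :
    e.cv σ (r • α) β = (r : ℂ) • e.cv σ α β := by
  funext i
  simp only [cv, coC, cvec, map_smul, smul_apply, co_smul, Complex.ofReal_mul, Pi.smul_apply,
    smul_eq_mul]
  ring

theorem cv_real_smul_right {x : M} (r : ℝ) (α β : S x) :
    e.cv σ α (r • β) = (r : ℂ) • e.cv σ α β := by
  funext i
  simp only [cv, coC, cvec, smul_comm Complex.I r, map_smul, co_smul, Complex.ofReal_mul,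
    Pi.smul_apply, smul_eq_mul]
  ring

theorem cv_smul_left {x : M} (c : ℂ) (α β : S x) : e.cv σ (c • α) β = c • e.cv σ α β := by
  rw [complex_smul_eq c α, cv_add_left, cv_real_smul_left, cv_real_smul_left, cv_I_smul_left,
    smul_smul, ← add_smul, Complex.re_add_im]

theorem cv_smul_right {x : M} (c : ℂ) (α β : S x) :
    e.cv σ α (c • β) = (starRingEnd ℂ) c • e.cv σ α β := by
  rw [complex_smul_eq c β, cv_add_right, cv_real_smul_right, cv_real_smul_right, cv_I_smul_right,
    smul_smul, ← add_smul]
  congr 1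
  apply Complex.ext <;> simp

end ConstFrame

namespace SpinDyad

variable (d : SpinDyad σ)

/-- The frame of real and imaginary parts of the null tetrad. -/
def frame : ConstFrame g where
  vec i x := (![σ.sol x (d.o x) (d.o x), σ.sol x (d.ι x) (d.ι x), σ.sol x (d.o x) (d.ι x),
    σ.sol x (d.o x) (Complex.I • d.ι x)] : Fin 4 → TangentSpace (𝓡 4) x) i
  smooth i x := by
    fin_cases i
    · exact σ.fieldAt_sol d.o_smooth d.o_smooth x
    · exact σ.fieldAt_sol d.ι_smooth d.ι_smooth x
    · exact σ.fieldAt_sol d.o_smooth d.ι_smooth x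
    · exact σ.fieldAt_sol d.o_smooth d.smooth_I_smul_ι x
  gram := !![0, 1, 0, 0; 1, 0, 0, 0; 0, 0, -1 / 2, 0; 0, 0, 0, -1 / 2]
  gramInv := ConstFrame.nullGramInv
  inv_mul := by
    ext i j
    fin_cases i <;> fin_cases j <;>
      simp [Matrix.mul_apply, Fin.sum_univ_four, ConstFrame.nullGramInv]
    all_goals norm_num
  val_vec x i j := by
    fin_cases i <;> fin_cases j <;>
      simp [σ.val_sol, σ.eps_smul, σ.eps_smul_right, σ.eps_alt, d.normalised, d.eps_ι_o]

theorem cv_o_o (x : M) : d.frame.cv σ (d.o x) (d.o x) = tetL := by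
  have h : cvec (σ.sol x) (d.o x) (d.o x) = (d.frame.vec 0 x, 0) := by
    rw [cvec, σ.sol_I_self]
    rfl
  funext i
  have h0 : d.frame.co i (0 : TangentSpace (𝓡 4) x) = 0 := (d.frame.coL i x).map_zero
  rw [ConstFrame.cv, h, ConstFrame.coC, d.frame.co_vec, h0]
  fin_cases i <;> simp [tetL]

theorem cv_ι_ι (x : M) : d.frame.cv σ (d.ι x) (d.ι x) = tetN := by
  have h : cvec (σ.sol x) (d.ι x) (d.ι x) = (d.frame.vec 1 x, 0) := by
    rw [cvec, σ.sol_I_self]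
    rfl
  funext i
  have h0 : d.frame.co i (0 : TangentSpace (𝓡 4) x) = 0 := (d.frame.coL i x).map_zero
  rw [ConstFrame.cv, h, ConstFrame.coC, d.frame.co_vec, h0]
  fin_cases i <;> simp [tetN]

theorem cv_o_ι (x : M) : d.frame.cv σ (d.o x) (d.ι x) = tetM := by
  have h : cvec (σ.sol x) (d.o x) (d.ι x) = (d.frame.vec 2 x, d.frame.vec 3 x) := rfl
  funext i
  rw [ConstFrame.cv, h, ConstFrame.coC, d.frame.co_vec, d.frame.co_vec]
  fin_cases i <;> simp [tetM]

theorem cv_ι_o (x : M) : d.frame.cv σ (d.ι x) (d.o x) = tetK := by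
  have h : cvec (σ.sol x) (d.ι x) (d.o x) = (d.frame.vec 2 x, -d.frame.vec 3 x) := by
    rw [cvec, σ.sol_I_right, σ.sol_symm x (d.ι x), σ.sol_symm x (Complex.I • d.ι x)]
    rfl
  funext i
  rw [ConstFrame.cv, h, ConstFrame.coC, ConstFrame.co_neg, d.frame.co_vec, d.frame.co_vec]
  fin_cases i <;> simp [tetK]

end SpinDyad

end Spin

section Spin

variable {M : Type*} [TopologicalSpace M] [ChartedSpace E4 M] [IsManifold (𝓡 4) ∞ M]
  {S : M → Type*} [TopologicalSpace (TotalSpace C2 S)]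
  [∀ x, AddCommGroup (S x)] [∀ x, Module ℂ (S x)] [∀ x, TopologicalSpace (S x)]
  [∀ x, IsTopologicalAddGroup (S x)] [∀ x, ContinuousSMul ℝ (S x)]
  [FiberBundle C2 S] [VectorBundle ℝ C2 S] [ContMDiffVectorBundle ∞ C2 S (𝓡 4)]
  {g : LorentzMetric M} {σ : SpinStructure S g} {D : Connection M} {DS : SpinorConnection S}

theorem lin_mul_right (F : Fin 4 → ℂ) (r : ℂ) (u : Fin 4 → ℂ) :
    lin (fun i ↦ F i * r) u = lin F u * r := by
  simp only [lin, Finset.sum_mul, mul_assoc]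

namespace SpinDyad

variable (d : SpinDyad σ)

/-- The coefficient of `o` in `∇_z o`. -/
def coefA (DS : SpinorConnection S) (x : M) (z : Fin 4 → ℂ) : ℂ :=
  lin (fun k ↦ σ.eps x (DS d.o x (d.frame.vec k x)) (d.ι x)) z

/-- The coefficient of `ι` in `∇_z o`. -/
def coefB (DS : SpinorConnection S) (x : M) (z : Fin 4 → ℂ) : ℂ :=
  lin (fun k ↦ -σ.eps x (DS d.o x (d.frame.vec k x)) (d.o x)) z

/-- The coefficient of `o` in `∇_z ι`. -/
def coefE (DS : SpinorConnection S) (x : M) (z : Fin 4 → ℂ) : ℂ :=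
  lin (fun k ↦ σ.eps x (DS d.ι x (d.frame.vec k x)) (d.ι x)) z

/-- The conjugate coefficient of `coefA`. -/
def coefA' (DS : SpinorConnection S) (x : M) (z : Fin 4 → ℂ) : ℂ :=
  lin (fun k ↦ (starRingEnd ℂ) (σ.eps x (DS d.o x (d.frame.vec k x)) (d.ι x))) z

/-- The conjugate coefficient of `coefB`. -/
def coefB' (DS : SpinorConnection S) (x : M) (z : Fin 4 → ℂ) : ℂ :=
  lin (fun k ↦ (starRingEnd ℂ) (-σ.eps x (DS d.o x (d.frame.vec k x)) (d.o x))) z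

/-- The conjugate coefficient of `coefE`. -/
def coefE' (DS : SpinorConnection S) (x : M) (z : Fin 4 → ℂ) : ℂ :=
  lin (fun k ↦ (starRingEnd ℂ) (σ.eps x (DS d.ι x (d.frame.vec k x)) (d.ι x))) z

theorem o_diffAt (x : M) :
    MDifferentiableAt (𝓡 4) ((𝓡 4).prod 𝓘(ℝ, C2)) (fun y ↦ TotalSpace.mk' C2 y (d.o y)) x :=
  (d.o_smooth x).mdifferentiableAt (by simp)

theorem ι_diffAt (x : M) :
    MDifferentiableAt (𝓡 4) ((𝓡 4).prod 𝓘(ℝ, C2)) (fun y ↦ TotalSpace.mk' C2 y (d.ι y)) x :=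
  (d.ι_smooth x).mdifferentiableAt (by simp)

theorem eps_nabla_ι_o (hDS : IsSpinConnection σ D DS) (x : M) (v : TangentSpace (𝓡 4) x) :
    σ.eps x (DS d.ι x v) (d.o x) = σ.eps x (DS d.o x v) (d.ι x) := by
  have h := (hDS d.o d.ι x (d.o_diffAt x) (d.ι_diffAt x) v).2.1
  simp only [d.normalised, mvfderiv_const] at h
  rw [σ.eps_skew x (d.o x)] at h
  have h0 : (0 : TangentSpace (𝓡 4) x →L[ℝ] ℂ) v = 0 := rfl
  rw [h0] at h
  linear_combination h

theorem nabla_o (x : M) (v : TangentSpace (𝓡 4) x) :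
    DS d.o x v = σ.eps x (DS d.o x v) (d.ι x) • d.o x
      + (-σ.eps x (DS d.o x v) (d.o x)) • d.ι x := by
  rw [neg_smul, ← sub_eq_add_neg]
  exact d.expand x _

theorem nabla_ι (hDS : IsSpinConnection σ D DS) (x : M) (v : TangentSpace (𝓡 4) x) :
    DS d.ι x v = σ.eps x (DS d.ι x v) (d.ι x) • d.o x
      + (-σ.eps x (DS d.o x v) (d.ι x)) • d.ι x := by
  rw [neg_smul, ← sub_eq_add_neg, ← d.eps_nabla_ι_o hDS]
  exact d.expand x _

theorem co_cov_l (hDS : IsSpinConnection σ D DS) (x : M) (v : TangentSpace (𝓡 4) x) (r : Fin 4) :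
    (d.frame.co r (D (d.frame.vec 0) x v) : ℂ)
      = d.frame.cv σ (DS d.o x v) (d.o x) r + d.frame.cv σ (d.o x) (DS d.o x v) r := by
  have h : D (d.frame.vec 0) x v = _ := (hDS d.o d.o x (d.o_diffAt x) (d.o_diffAt x) v).2.2
  rw [h]
  simp only [ConstFrame.cv, ConstFrame.coC, cvec, ConstFrame.co_add, σ.sol_I_right x (DS d.o x v),
    σ.sol_symm x (Complex.I • DS d.o x v), ConstFrame.co_neg]
  push_cast
  ring

theorem co_cov_n (hDS : IsSpinConnection σ D DS) (x : M) (v : TangentSpace (𝓡 4) x) (r : Fin 4) :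
    (d.frame.co r (D (d.frame.vec 1) x v) : ℂ)
      = d.frame.cv σ (DS d.ι x v) (d.ι x) r + d.frame.cv σ (d.ι x) (DS d.ι x v) r := by
  have h : D (d.frame.vec 1) x v = _ := (hDS d.ι d.ι x (d.ι_diffAt x) (d.ι_diffAt x) v).2.2
  rw [h]
  simp only [ConstFrame.cv, ConstFrame.coC, cvec, ConstFrame.co_add, σ.sol_I_right x (DS d.ι x v),
    σ.sol_symm x (Complex.I • DS d.ι x v), ConstFrame.co_neg]
  push_cast
  ring

theorem cov_vec_three (hDS : IsSpinConnection σ D DS) (x : M) (v : TangentSpace (𝓡 4) x) :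
    D (d.frame.vec 3) x v = σ.sol x (DS d.o x v) (Complex.I • d.ι x)
      + σ.sol x (d.o x) (Complex.I • DS d.ι x v) := by
  have hI := (hDS d.ι d.ι x (d.ι_diffAt x) (d.ι_diffAt x) v).1
  have h : D (d.frame.vec 3) x v = _ := (hDS d.o (fun y ↦ Complex.I • d.ι y) x (d.o_diffAt x)
    ((d.smooth_I_smul_ι x).mdifferentiableAt (by simp)) v).2.2
  rw [h, hI]

theorem co_cov_m (hDS : IsSpinConnection σ D DS) (x : M) (v : TangentSpace (𝓡 4) x) (r : Fin 4) :
    (d.frame.co r (D (d.frame.vec 2) x v) : ℂ)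
        + Complex.I * d.frame.co r (D (d.frame.vec 3) x v)
      = d.frame.cv σ (DS d.o x v) (d.ι x) r + d.frame.cv σ (d.o x) (DS d.ι x v) r := by
  have h : D (d.frame.vec 2) x v = _ := (hDS d.o d.ι x (d.o_diffAt x) (d.ι_diffAt x) v).2.2
  rw [h, d.cov_vec_three hDS]
  simp only [ConstFrame.cv, ConstFrame.coC, cvec, ConstFrame.co_add]
  push_cast
  ring

theorem co_cov_mbar (hDS : IsSpinConnection σ D DS) (x : M) (v : TangentSpace (𝓡 4) x)
    (r : Fin 4) :
    (d.frame.co r (D (d.frame.vec 2) x v) : ℂ)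
        - Complex.I * d.frame.co r (D (d.frame.vec 3) x v)
      = d.frame.cv σ (DS d.ι x v) (d.o x) r + d.frame.cv σ (d.ι x) (DS d.o x v) r := by
  have h : D (d.frame.vec 2) x v = _ := (hDS d.o d.ι x (d.o_diffAt x) (d.ι_diffAt x) v).2.2
  rw [h, d.cov_vec_three hDS]
  have h1 : σ.sol x (DS d.ι x v) (Complex.I • d.o x)
      = -σ.sol x (d.o x) (Complex.I • DS d.ι x v) := by rw [σ.sol_I_right, σ.sol_symm]
  have h2 : σ.sol x (d.ι x) (Complex.I • DS d.o x v)
      = -σ.sol x (DS d.o x v) (Complex.I • d.ι x) := by rw [σ.sol_I_right, σ.sol_symm]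
  simp only [ConstFrame.cv, ConstFrame.coC, cvec, ConstFrame.co_add, h1, h2, ConstFrame.co_neg,
    σ.sol_symm x (DS d.ι x v) (d.o x), σ.sol_symm x (d.ι x) (DS d.o x v)]
  push_cast
  ring

theorem isDyadConn (hDS : IsSpinConnection σ D DS) (x : M) :
    IsDyadConn (d.frame.christoffel D x) tetL tetN tetM tetK (d.coefA DS x) (d.coefB DS x)
      (d.coefE DS x) (d.coefA' DS x) (d.coefB' DS x) (d.coefE' DS x) := by
  have hL : ∀ k r, lin (fun i ↦ d.frame.christoffel D x k i r) tetL
      = (d.frame.co r (D (d.frame.vec 0) x (d.frame.vec k x)) : ℂ) := fun k r ↦ by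
    simp [lin, tetL, Fin.sum_univ_four, ConstFrame.christoffel]
  have hN : ∀ k r, lin (fun i ↦ d.frame.christoffel D x k i r) tetN
      = (d.frame.co r (D (d.frame.vec 1) x (d.frame.vec k x)) : ℂ) := fun k r ↦ by
    simp [lin, tetN, Fin.sum_univ_four, ConstFrame.christoffel]
  have hM : ∀ k r, lin (fun i ↦ d.frame.christoffel D x k i r) tetM
      = (d.frame.co r (D (d.frame.vec 2) x (d.frame.vec k x)) : ℂ)
        + Complex.I * d.frame.co r (D (d.frame.vec 3) x (d.frame.vec k x)) := fun k r ↦ by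
    simp [lin, tetM, Fin.sum_univ_four, ConstFrame.christoffel]
  have hK : ∀ k r, lin (fun i ↦ d.frame.christoffel D x k i r) tetK
      = (d.frame.co r (D (d.frame.vec 2) x (d.frame.vec k x)) : ℂ)
        - Complex.I * d.frame.co r (D (d.frame.vec 3) x (d.frame.vec k x)) := fun k r ↦ by
    simp [lin, tetK, Fin.sum_univ_four, ConstFrame.christoffel]
    ring
  have hcv : ∀ (p q p' q' : ℂ) (α β : S x) (r : Fin 4), d.frame.cv σ (p • d.o x + q • d.ι x) β r
      + d.frame.cv σ α (p' • d.o x + q' • d.ι x) r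
      = p * d.frame.cv σ (d.o x) β r + q * d.frame.cv σ (d.ι x) β r
        + ((starRingEnd ℂ) p' * d.frame.cv σ α (d.o x) r
          + (starRingEnd ℂ) q' * d.frame.cv σ α (d.ι x) r) := fun p q p' q' α β r ↦ by
    simp [ConstFrame.cv_add_left, ConstFrame.cv_add_right, ConstFrame.cv_smul_left,
      ConstFrame.cv_smul_right]
  constructor
  · intro z
    funext r
    have h : ∀ v, d.frame.cv σ (DS d.o x v) (d.o x) r + d.frame.cv σ (d.o x) (DS d.o x v) r
        = σ.eps x (DS d.o x v) (d.ι x) * tetL r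
          + (starRingEnd ℂ) (σ.eps x (DS d.o x v) (d.ι x)) * tetL r
          + -σ.eps x (DS d.o x v) (d.o x) * tetK r
          + (starRingEnd ℂ) (-σ.eps x (DS d.o x v) (d.o x)) * tetM r := fun v ↦ by
      have h1 := d.nabla_o (DS := DS) x v
      generalize σ.eps x (DS d.o x v) (d.ι x) = p at *
      generalize -σ.eps x (DS d.o x v) (d.o x) = q at *
      rw [h1, hcv, d.cv_o_o, d.cv_ι_o, d.cv_o_ι]
      ring
    simp only [conn, hL, d.co_cov_l hDS, h, lin_add, lin_mul_right, Pi.add_apply, Pi.smul_apply,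
      smul_eq_mul, coefA, coefB, coefA', coefB']
    ring
  · intro z
    funext r
    have h : ∀ v, d.frame.cv σ (DS d.o x v) (d.ι x) r + d.frame.cv σ (d.o x) (DS d.ι x v) r
        = σ.eps x (DS d.o x v) (d.ι x) * tetM r
          - (starRingEnd ℂ) (σ.eps x (DS d.o x v) (d.ι x)) * tetM r
          + -σ.eps x (DS d.o x v) (d.o x) * tetN r
          + (starRingEnd ℂ) (σ.eps x (DS d.ι x v) (d.ι x)) * tetL r := fun v ↦ by
      have h1 := d.nabla_o (DS := DS) x v
      have h2 := d.nabla_ι hDS x v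
      generalize σ.eps x (DS d.o x v) (d.ι x) = p at *
      generalize -σ.eps x (DS d.o x v) (d.o x) = q at *
      generalize σ.eps x (DS d.ι x v) (d.ι x) = s at *
      rw [h1, h2, hcv, d.cv_o_o, d.cv_ι_ι, d.cv_o_ι, map_neg]
      ring
    simp only [conn, hM, d.co_cov_m hDS, h, lin_add, lin_sub, lin_mul_right, Pi.add_apply,
      Pi.smul_apply, smul_eq_mul, coefA, coefB, coefA', coefE']
    ring
  · intro z
    funext r
    have h : ∀ v, d.frame.cv σ (DS d.ι x v) (d.o x) r + d.frame.cv σ (d.ι x) (DS d.o x v) r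
        = (starRingEnd ℂ) (σ.eps x (DS d.o x v) (d.ι x)) * tetK r
          - σ.eps x (DS d.o x v) (d.ι x) * tetK r
          + (starRingEnd ℂ) (-σ.eps x (DS d.o x v) (d.o x)) * tetN r
          + σ.eps x (DS d.ι x v) (d.ι x) * tetL r := fun v ↦ by
      have h1 := d.nabla_o (DS := DS) x v
      have h2 := d.nabla_ι hDS x v
      generalize σ.eps x (DS d.o x v) (d.ι x) = p at *
      generalize -σ.eps x (DS d.o x v) (d.o x) = q at *
      generalize σ.eps x (DS d.ι x v) (d.ι x) = s at *
      rw [h1, h2, hcv, d.cv_o_o, d.cv_ι_ι, d.cv_ι_o]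
      ring
    simp only [conn, hK, d.co_cov_mbar hDS, h, lin_add, lin_sub, lin_mul_right, Pi.add_apply,
      Pi.smul_apply, smul_eq_mul, coefA, coefB', coefA', coefE]
    ring
  · intro z
    funext r
    have h : ∀ v, d.frame.cv σ (DS d.ι x v) (d.ι x) r + d.frame.cv σ (d.ι x) (DS d.ι x v) r
        = σ.eps x (DS d.ι x v) (d.ι x) * tetM r
          + (starRingEnd ℂ) (σ.eps x (DS d.ι x v) (d.ι x)) * tetK r
          - σ.eps x (DS d.o x v) (d.ι x) * tetN r
          - (starRingEnd ℂ) (σ.eps x (DS d.o x v) (d.ι x)) * tetN r := fun v ↦ by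
      have h2 := d.nabla_ι hDS x v
      generalize σ.eps x (DS d.o x v) (d.ι x) = p at *
      generalize σ.eps x (DS d.ι x v) (d.ι x) = s at *
      rw [h2, hcv, d.cv_o_ι, d.cv_ι_ι, d.cv_ι_o, map_neg]
      ring
    simp only [conn, hN, d.co_cov_n hDS, h, lin_add, lin_sub, lin_mul_right, Pi.add_apply,
      Pi.smul_apply, smul_eq_mul, coefA, coefA', coefE, coefE']
    ring

theorem eps_nablaC (ψ : ∀ x : M, S x) {x : M} (u : CTangent x) (s : S x) :
    σ.eps x (nablaC DS ψ u) s
      = lin (fun k ↦ σ.eps x (DS ψ x (d.frame.vec k x)) s) (d.frame.coC u) := by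
  have h := d.frame.cext_eq_lin (f := fun v ↦ σ.eps x (DS ψ x v) s)
    (fun _ _ ↦ by simp only [map_add, add_apply])
    (fun _ _ ↦ by simp only [map_smul, smul_apply, Complex.real_smul]) u
  rw [← h, nablaC, map_add, add_apply, σ.eps_smul]
  rfl

theorem coC_l (x : M) : d.frame.coC (d.l x) = tetL := d.cv_o_o x

theorem coC_n (x : M) : d.frame.coC (d.n x) = tetN := d.cv_ι_ι x

theorem coC_m (x : M) : d.frame.coC (d.m x) = tetM := d.cv_o_ι x

theorem coC_mbar (x : M) : d.frame.coC (d.mbar x) = tetK := d.cv_ι_o x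

theorem rho_eq (x : M) : d.rho DS x = -d.coefB DS x tetK := by
  rw [rho, d.eps_nablaC, coC_mbar, coefB, lin_neg, neg_neg]

theorem tau_eq (x : M) : d.tau DS x = -d.coefB DS x tetN := by
  rw [tau, d.eps_nablaC, coC_n, coefB, lin_neg, neg_neg]

theorem epsilon_eq (x : M) : d.epsilon DS x = d.coefA DS x tetL := by
  rw [epsilon, d.eps_nablaC, coC_l, coefA]

theorem beta_eq (x : M) : d.beta DS x = d.coefA DS x tetM := by
  rw [beta, d.eps_nablaC, coC_m, coefA]

theorem rho'_eq (x : M) : d.rho' DS x = -d.coefE DS x tetM := by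
  rw [rho', d.eps_nablaC, coC_m, coefE]

theorem tau'_eq (x : M) : d.tau' DS x = -d.coefE DS x tetL := by
  rw [tau', d.eps_nablaC, coC_l, coefE]

theorem coefB_l (hsf : IsShearFreeRay σ DS d.o) (x : M) : d.coefB DS x tetL = 0 := by
  have h := hsf x (d.o x)
  have h2 : cvec (σ.sol x) (d.o x) (d.o x) = d.l x := rfl
  rw [h2, d.eps_nablaC, coC_l] at h
  rw [coefB, lin_neg, h, neg_zero]

theorem coefB_m (hsf : IsShearFreeRay σ DS d.o) (x : M) : d.coefB DS x tetM = 0 := by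
  have h := hsf x (d.ι x)
  have h2 : cvec (σ.sol x) (d.o x) (d.ι x) = d.m x := rfl
  rw [h2, d.eps_nablaC, coC_m] at h
  rw [coefB, lin_neg, h, neg_zero]

theorem weylSpinor_eq (hD : IsLeviCivita g D) (hE : IsEinstein g D) (x : M) (α β γ δ : S x) :
    d.weylSpinor D x α β γ δ
      = (mul4 (d.frame.weylComp D x) (d.frame.cv σ α (d.o x)) (d.frame.cv σ β (d.ι x))
            (d.frame.cv σ γ (d.o x)) (d.frame.cv σ δ (d.ι x))
          - mul4 (d.frame.weylComp D x) (d.frame.cv σ α (d.ι x)) (d.frame.cv σ β (d.o x))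
            (d.frame.cv σ γ (d.o x)) (d.frame.cv σ δ (d.ι x))
          - mul4 (d.frame.weylComp D x) (d.frame.cv σ α (d.o x)) (d.frame.cv σ β (d.ι x))
            (d.frame.cv σ γ (d.ι x)) (d.frame.cv σ δ (d.o x))
          + mul4 (d.frame.weylComp D x) (d.frame.cv σ α (d.ι x)) (d.frame.cv σ β (d.o x))
            (d.frame.cv σ γ (d.ι x)) (d.frame.cv σ δ (d.o x))) / 4 := by
  simp only [weylSpinor, d.frame.weylC_eq hD hE]
  rfl

theorem isWeylLike (hD : IsLeviCivita g D) (hE : IsEinstein g D) (x : M) :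
    IsWeylLike (d.frame.weylComp D x) tetL tetN tetM tetK :=
  (d.frame.isWeylComp_weylComp hD hE rfl x).isWeylLike

theorem psi₀_eq_zero (hD : IsLeviCivita g D) (hE : IsEinstein g D) (hrep : d.IsRepeatedPrincipal D)
    (x : M) : mul4 (d.frame.weylComp D x) tetL tetM tetL tetM = 0 := by
  have h := hrep x (d.o x)
  rw [d.weylSpinor_eq hD hE, d.cv_o_o, d.cv_o_ι] at h
  have hw := d.isWeylLike hD hE x
  rw [hw.swap_left tetL tetM tetL, hw.swap_left tetL tetM tetM, hw.swap_right tetL tetM tetL] at h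
  linear_combination h

theorem psi₁_eq_zero (hD : IsLeviCivita g D) (hE : IsEinstein g D) (hrep : d.IsRepeatedPrincipal D)
    (x : M) : mul4 (d.frame.weylComp D x) tetL tetN tetL tetM = 0 := by
  have h := hrep x (d.ι x)
  rw [d.weylSpinor_eq hD hE, d.cv_o_o, d.cv_o_ι, d.cv_ι_o, d.cv_ι_ι] at h
  have hw := d.isWeylLike hD hE x
  have ht := hw.trace tetL tetM
  have hp := hw.pair tetL tetM tetK tetM
  obtain ⟨_, _, _, _, _, _, _, _, _, _, _, _⟩ := hw.swap_mul4
  simp only [*, hw.self_left, hw.self_right] at h ht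
  linear_combination h - ht / 2

theorem Psi2_eq (hD : IsLeviCivita g D) (hE : IsEinstein g D) (x : M) :
    d.Psi2 D x = mul4 (d.frame.weylComp D x) tetL tetM tetK tetN := by
  rw [Psi2, d.weylSpinor_eq hD hE, d.cv_o_o, d.cv_o_ι, d.cv_ι_o, d.cv_ι_ι]
  have hw := d.isWeylLike hD hE x
  obtain ⟨_, _, _, _, _, _, _, _, _, _, _, _⟩ := hw.swap_mul4
  simp only [*]
  ring

theorem Psi3_eq (hD : IsLeviCivita g D) (hE : IsEinstein g D) (x : M) :
    d.Psi3 D x = mul4 (d.frame.weylComp D x) tetL tetN tetK tetN := by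
  rw [Psi3, d.weylSpinor_eq hD hE, d.cv_o_o, d.cv_o_ι, d.cv_ι_o, d.cv_ι_ι]
  have hw := d.isWeylLike hD hE x
  have hk := hw.kn_values.1
  obtain ⟨_, _, _, _, _, _, _, _, _, _, _, _⟩ := hw.swap_mul4
  simp only [*]
  ring

end SpinDyad

end Spin

section ComplexValued

variable {M : Type*} [TopologicalSpace M] [ChartedSpace E4 M]

theorem mvfderiv_mul_complex {p q : M → ℂ} {x : M} (hp : MDifferentiableAt (𝓡 4) 𝓘(ℝ, ℂ) p x)
    (hq : MDifferentiableAt (𝓡 4) 𝓘(ℝ, ℂ) q x) (v : TangentSpace (𝓡 4) x) :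
    mvfderiv (𝓡 4) (fun y ↦ p y * q y) x v
      = p x * mvfderiv (𝓡 4) q x v + q x * mvfderiv (𝓡 4) p x v := by
  have hF : MDifferentiableAt (𝓡 4) 𝓘(ℝ, ℂ × ℂ) (fun y ↦ (p y, q y)) x := hp.prodMk_space hq
  have h1 := mvfderiv_clm (ContinuousLinearMap.fst ℝ ℂ ℂ) hF v
  have h2 := mvfderiv_clm (ContinuousLinearMap.snd ℝ ℂ ℂ) hF v
  have h := mvfderiv_comp_fderiv (Φ := fun z : ℂ × ℂ ↦ z.1 * z.2)
    (differentiableAt_fst.mul differentiableAt_snd) hF v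
  rw [fderiv_fun_mul differentiableAt_fst differentiableAt_snd, fderiv_fst, fderiv_snd] at h
  simp only [add_apply, smul_apply, smul_eq_mul, ← h1, ← h2] at h
  exact h

theorem mdifferentiableAt_div_complex {p q : M → ℂ} {x : M}
    (hp : MDifferentiableAt (𝓡 4) 𝓘(ℝ, ℂ) p x) (hq : MDifferentiableAt (𝓡 4) 𝓘(ℝ, ℂ) q x)
    (h0 : q x ≠ 0) : MDifferentiableAt (𝓡 4) 𝓘(ℝ, ℂ) (fun y ↦ p y / (3 * q y)) x := by
  have hΦ : DifferentiableAt ℝ (fun z : ℂ × ℂ ↦ z.1 / (3 * z.2)) (p x, q x) := by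
    have h3 : (3 * (p x, q x).2 : ℂ) ≠ 0 := by simpa using h0
    have h4 : DifferentiableAt ℝ (fun z : ℂ × ℂ ↦ (3 * z.2)⁻¹) (p x, q x) :=
      (differentiableAt_snd.const_mul 3).inv h3
    simp only [div_eq_mul_inv]
    exact differentiableAt_fst.mul h4
  exact hΦ.mdifferentiableAt.comp x (hp.prodMk_space hq)

/-- A continuous cube root of a non-vanishing differentiable function is differentiable. -/
theorem mdifferentiableAt_cube_root {φ P : M → ℂ} {x : M}
    (hP : MDifferentiableAt (𝓡 4) 𝓘(ℝ, ℂ) P x) (hφ : ContinuousAt φ x)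
    (h : ∀ᶠ y in nhds x, φ y ^ 3 = P y) (h0 : P x ≠ 0) :
    MDifferentiableAt (𝓡 4) 𝓘(ℝ, ℂ) φ x := by
  have hx := h.self_of_nhds
  have hne : φ x ≠ 0 := fun hz ↦ h0 (by rw [← hx, hz]; norm_num)
  have hs : HasStrictDerivAt (fun z : ℂ ↦ z ^ 3) (3 * φ x ^ 2) (φ x) := by
    simpa using hasStrictDerivAt_pow 3 (φ x)
  have hne' : 3 * φ x ^ 2 ≠ 0 := by simp [hne]
  have hs' := hs.hasStrictFDerivAt_equiv hne'
  have hL := hs'.to_localInverse.hasFDerivAt.differentiableAt.restrictScalars ℝ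
  have he := hφ.eventually hs'.eventually_left_inverse
  rw [hx] at hL
  refine (hL.mdifferentiableAt.comp x hP).congr_of_eventuallyEq ?_
  filter_upwards [he, h] with y hy1 hy2
  simp only [Function.comp_apply]
  rw [← hy2, hy1]

theorem mvfderiv_cube_root {φ P : M → ℂ} {x : M} (hφ : MDifferentiableAt (𝓡 4) 𝓘(ℝ, ℂ) φ x)
    (h : ∀ᶠ y in nhds x, φ y ^ 3 = P y) (v : TangentSpace (𝓡 4) x) :
    mvfderiv (𝓡 4) P x v = 3 * φ x ^ 2 * mvfderiv (𝓡 4) φ x v := by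
  have h1 : mvfderiv (𝓡 4) (fun y ↦ φ y ^ 3) x v = mvfderiv (𝓡 4) P x v := by
    have hx := h.self_of_nhds
    have := Filter.EventuallyEq.mfderiv_eq (I := 𝓡 4) (I' := 𝓘(ℝ, ℂ)) h
    exact congrArg (fun L ↦ L v) this
  have h2 := mvfderiv_mul_complex hφ hφ
  have hφ2 : MDifferentiableAt (𝓡 4) 𝓘(ℝ, ℂ) (fun y ↦ φ y * φ y) x := hφ.mul hφ
  have h3 := mvfderiv_mul_complex hφ2 hφ v
  rw [← h1, show (fun y ↦ φ y ^ 3) = fun y ↦ φ y * φ y * φ y from funext fun y ↦ by ring, h3, h2]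
  ring

end ComplexValued

section Spin

variable {M : Type*} [TopologicalSpace M] [ChartedSpace E4 M] [IsManifold (𝓡 4) ∞ M]
  {S : M → Type*} [TopologicalSpace (TotalSpace C2 S)]
  [∀ x, AddCommGroup (S x)] [∀ x, Module ℂ (S x)] [∀ x, TopologicalSpace (S x)]
  [∀ x, IsTopologicalAddGroup (S x)] [∀ x, ContinuousSMul ℝ (S x)]
  [FiberBundle C2 S] [VectorBundle ℝ C2 S] [ContMDiffVectorBundle ∞ C2 S (𝓡 4)]
  {g : LorentzMetric M} {σ : SpinStructure S g} {D : Connection M} {DS : SpinorConnection S}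

namespace SpinDyad

variable (d : SpinDyad σ)

/-- The derivative of a complex function in the direction with components `z`. -/
def dirDeriv (ψ : M → ℂ) (x : M) (z : Fin 4 → ℂ) : ℂ :=
  lin (fun i ↦ mvfderiv (𝓡 4) ψ x (d.frame.vec i x)) z

theorem cext_mvfderiv (ψ : M → ℂ) {x : M} (α β : S x) :
    cext (mvfderiv (𝓡 4) ψ x) (cvec (σ.sol x) α β) = d.dirDeriv ψ x (d.frame.cv σ α β) :=
  d.frame.cext_eq_lin (fun _ _ ↦ map_add _ _ _)
    (fun _ _ ↦ by rw [map_smul, Complex.real_smul]) _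

theorem mdifferentiableAt_Psi2 (hD : IsLeviCivita g D) (hE : IsEinstein g D) (x : M) :
    MDifferentiableAt (𝓡 4) 𝓘(ℝ, ℂ) (d.Psi2 D) x := by
  rw [funext (d.Psi2_eq hD hE)]
  exact (mvfderiv_mul4 (fun i j p q ↦
    (mvfderiv_ofReal (d.frame.mdifferentiableAt_weylComp hD hE x i j p q)).1) _ _ _ _).1

theorem mdifferentiableAt_Psi3 (hD : IsLeviCivita g D) (hE : IsEinstein g D) (x : M) :
    MDifferentiableAt (𝓡 4) 𝓘(ℝ, ℂ) (d.Psi3 D) x := by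
  rw [funext (d.Psi3_eq hD hE)]
  exact (mvfderiv_mul4 (fun i j p q ↦
    (mvfderiv_ofReal (d.frame.mdifferentiableAt_weylComp hD hE x i j p q)).1) _ _ _ _).1

theorem dirDeriv_Psi2 (hD : IsLeviCivita g D) (hE : IsEinstein g D) (x : M) (z : Fin 4 → ℂ) :
    d.dirDeriv (d.Psi2 D) x z
      = lin (fun i ↦ mul4 (d.frame.dweylComp D x i) tetL tetM tetK tetN) z := by
  rw [dirDeriv, funext (d.Psi2_eq hD hE)]
  simp only [(mvfderiv_mul4 (c := d.frame.weylComp D) (fun i j p q ↦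
    (mvfderiv_ofReal (d.frame.mdifferentiableAt_weylComp hD hE x i j p q)).1) _ _ _ _).2]
  rfl

theorem dirDeriv_Psi3 (hD : IsLeviCivita g D) (hE : IsEinstein g D) (x : M) (z : Fin 4 → ℂ) :
    d.dirDeriv (d.Psi3 D) x z
      = lin (fun i ↦ mul4 (d.frame.dweylComp D x i) tetL tetN tetK tetN) z := by
  rw [dirDeriv, funext (d.Psi3_eq hD hE)]
  simp only [(mvfderiv_mul4 (c := d.frame.weylComp D) (fun i j p q ↦
    (mvfderiv_ofReal (d.frame.mdifferentiableAt_weylComp hD hE x i j p q)).1) _ _ _ _).2]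
  rfl

/-- The vacuum Bianchi identities of a type II dyad, in Newman–Penrose form. -/
theorem bianchi_identities (hD : IsLeviCivita g D) (hDS : IsSpinConnection σ D DS)
    (hE : IsEinstein g D) (hsf : IsShearFreeRay σ DS d.o) (hrep : d.IsRepeatedPrincipal D)
    (x : M) :
    d.dirDeriv (d.Psi2 D) x tetL = 3 * d.rho DS x * d.Psi2 D x ∧
    d.dirDeriv (d.Psi2 D) x tetM = 3 * d.tau DS x * d.Psi2 D x ∧
    d.dirDeriv (d.Psi2 D) x tetK = d.dirDeriv (d.Psi3 D) x tetL
      + 2 * (d.epsilon DS x - d.rho DS x) * d.Psi3 D x + 3 * d.tau' DS x * d.Psi2 D x ∧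
    d.dirDeriv (d.Psi2 D) x tetN = d.dirDeriv (d.Psi3 D) x tetM
      + 2 * (d.beta DS x - d.tau DS x) * d.Psi3 D x + 3 * d.rho' DS x * d.Psi2 D x := by
  have hII := d.frame.isTypeII hD hE rfl (d.psi₀_eq_zero hD hE hrep) (d.psi₁_eq_zero hD hE hrep) x
  have hΓ := d.isDyadConn hDS x
  obtain ⟨h1, h2⟩ := hII.bianchi_psi₂ hΓ (d.coefB_l hsf x) (d.coefB_m hsf x)
  obtain ⟨h3, h4⟩ := hII.bianchi_psi₃ hΓ (d.coefB_l hsf x) (d.coefB_m hsf x)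
  simp only [d.dirDeriv_Psi2 hD hE, d.dirDeriv_Psi3 hD hE, d.Psi2_eq hD hE, d.Psi3_eq hD hE,
    d.rho_eq, d.tau_eq, d.epsilon_eq, d.beta_eq, d.rho'_eq, d.tau'_eq]
  refine ⟨?_, ?_, ?_, ?_⟩
  · linear_combination h1
  · linear_combination h2
  · linear_combination -h3
  · linear_combination h4

theorem cext_lower {x : M} (α β γ δ : S x) :
    cext (lower g (cvec (σ.sol x) γ δ)) (cvec (σ.sol x) α β)
      = σ.eps x α γ * (starRingEnd ℂ) (σ.eps x β δ) := by
  rw [← σ.sol_metric]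
  unfold lower
  simp only [g.symm x _ (cvec (σ.sol x) γ δ).1, g.symm x _ (cvec (σ.sol x) γ δ).2, cext]

theorem cext_f (x : M) (α β : S x) : cext (d.f DS x) (cvec (σ.sol x) α β)
    = d.rho DS x * (σ.eps x α (d.ι x) * (starRingEnd ℂ) (σ.eps x β (d.ι x)))
      + d.rho' DS x * (σ.eps x α (d.o x) * (starRingEnd ℂ) (σ.eps x β (d.o x)))
      - d.tau' DS x * (σ.eps x α (d.o x) * (starRingEnd ℂ) (σ.eps x β (d.ι x)))
      - d.tau DS x * (σ.eps x α (d.ι x) * (starRingEnd ℂ) (σ.eps x β (d.o x))) := by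
  simp only [← cext_lower, f, l, n, m, mbar, cext]
  ring

theorem projC_eq (p w : ℤ) (ψ : M → ℂ) (x : M) (β : S x) :
    d.projC DS p w ψ x β = d.dirDeriv ψ x (d.frame.cv σ (d.o x) β)
      + (w * cext (d.f DS x) (cvec (σ.sol x) (d.o x) β)
        + p * (-(d.epsilon DS x + d.rho DS x) * (starRingEnd ℂ) (σ.eps x β (d.ι x))
          + (d.beta DS x + d.tau DS x) * (starRingEnd ℂ) (σ.eps x β (d.o x)))) * ψ x := by
  have hn := cext_lower (σ := σ) (d.o x) β (d.ι x) (d.ι x)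
  have hl := cext_lower (σ := σ) (d.o x) β (d.o x) (d.o x)
  have hm := cext_lower (σ := σ) (d.o x) β (d.o x) (d.ι x)
  have hk := cext_lower (σ := σ) (d.o x) β (d.ι x) (d.o x)
  rw [d.normalised, one_mul] at hn hk
  rw [σ.eps_alt, zero_mul] at hl hm
  rw [← d.cext_mvfderiv, ← hn, ← hk, projC]
  have e : ∀ u, cext (d.confGHP DS p w ψ x) u = cext (mvfderiv (𝓡 4) ψ x) u
      + (w * cext (d.f DS x) u + p * (-(d.epsilon DS x + d.rho DS x) * cext (lower g (d.n x)) u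
        + d.epsilon' DS x * cext (lower g (d.l x)) u - d.beta' DS x * cext (lower g (d.m x)) u
        + (d.beta DS x + d.tau DS x) * cext (lower g (d.mbar x)) u)) * ψ x := fun u ↦ by
    simp only [cext, confGHP, omega, B]
    ring
  rw [e]
  change _ + (_ + _ * (_ + _ * cext (lower g (cvec _ _ _)) _ - _ * cext (lower g (cvec _ _ _)) _
    + _)) * _ = _
  rw [hl, hm, n, mbar]
  ring

theorem cv_expand (x : M) (α β : S x) : d.frame.cv σ α β
    = (σ.eps x α (d.ι x) * (starRingEnd ℂ) (σ.eps x β (d.ι x))) • tetL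
      + (-(σ.eps x α (d.ι x) * (starRingEnd ℂ) (σ.eps x β (d.o x)))) • tetM
      + (-(σ.eps x α (d.o x) * (starRingEnd ℂ) (σ.eps x β (d.ι x)))) • tetK
      + (σ.eps x α (d.o x) * (starRingEnd ℂ) (σ.eps x β (d.o x))) • tetN := by
  have hα := d.expand x α
  have hβ := d.expand x β
  generalize σ.eps x α (d.ι x) = p at *
  generalize σ.eps x α (d.o x) = q at *
  generalize σ.eps x β (d.ι x) = p' at *
  generalize σ.eps x β (d.o x) = q' at *
  rw [hα, hβ]
  simp only [sub_eq_add_neg, ← neg_smul, ConstFrame.cv_add_left, ConstFrame.cv_add_right,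
    ConstFrame.cv_smul_left, ConstFrame.cv_smul_right, d.cv_o_o, d.cv_ι_ι, d.cv_o_ι, d.cv_ι_o,
    map_neg]
  module

theorem dirDeriv_cv (ψ : M → ℂ) (x : M) (α β : S x) : d.dirDeriv ψ x (d.frame.cv σ α β)
    = σ.eps x α (d.ι x) * (starRingEnd ℂ) (σ.eps x β (d.ι x)) * d.dirDeriv ψ x tetL
      - σ.eps x α (d.ι x) * (starRingEnd ℂ) (σ.eps x β (d.o x)) * d.dirDeriv ψ x tetM
      - σ.eps x α (d.o x) * (starRingEnd ℂ) (σ.eps x β (d.ι x)) * d.dirDeriv ψ x tetK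
      + σ.eps x α (d.o x) * (starRingEnd ℂ) (σ.eps x β (d.o x)) * d.dirDeriv ψ x tetN := by
  rw [d.cv_expand, dirDeriv, lin_vec_add, lin_vec_add, lin_vec_add, lin_vec_smul, lin_vec_smul,
    lin_vec_smul, lin_vec_smul]
  simp only [dirDeriv]
  ring

theorem dirDeriv_eta (hD : IsLeviCivita g D) (hE : IsEinstein g D) (hΨ : ∀ x, d.Psi2 D x ≠ 0)
    (x : M) (z : Fin 4 → ℂ) : d.dirDeriv (d.Psi3 D) x z
      = 3 * (d.Psi2 D x * d.dirDeriv (d.eta D) x z + d.eta D x * d.dirDeriv (d.Psi2 D) x z) := by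
  have h2 := d.mdifferentiableAt_Psi2 hD hE x
  have hη : MDifferentiableAt (𝓡 4) 𝓘(ℝ, ℂ) (d.eta D) x :=
    mdifferentiableAt_div_complex (d.mdifferentiableAt_Psi3 hD hE x) h2 (hΨ x)
  have hp : MDifferentiableAt (𝓡 4) 𝓘(ℝ, ℂ) (fun y ↦ d.Psi2 D y * d.eta D y) x := h2.mul hη
  have he : d.Psi3 D = fun y ↦ 3 * (d.Psi2 D y * d.eta D y) := funext fun y ↦ by
    have := hΨ y
    simp only [eta]
    field_simp
  have h : ∀ v, mvfderiv (𝓡 4) (d.Psi3 D) x v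
      = 3 * (d.Psi2 D x * mvfderiv (𝓡 4) (d.eta D) x v
        + d.eta D x * mvfderiv (𝓡 4) (d.Psi2 D) x v) := fun v ↦ by
    rw [he, ← mvfderiv_mul_complex h2 hη]
    exact mvfderiv_clm (ContinuousLinearMap.mul ℝ ℂ 3) hp v
  simp only [dirDeriv, h, lin_mul, lin_add]

theorem dirDeriv_cube_root (hD : IsLeviCivita g D) (hE : IsEinstein g D) {φ : M → ℂ} {x : M}
    (hφ : ContinuousAt φ x) (h : ∀ᶠ y in nhds x, φ y ^ 3 = d.Psi2 D y) (h0 : d.Psi2 D x ≠ 0)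
    (z : Fin 4 → ℂ) :
    d.dirDeriv (d.Psi2 D) x z = 3 * d.Psi2 D x * ((φ x)⁻¹ * d.dirDeriv φ x z) := by
  have hx := h.self_of_nhds
  have hne : φ x ≠ 0 := fun hz ↦ h0 (by rw [← hx, hz]; norm_num)
  have hd := mdifferentiableAt_cube_root (d.mdifferentiableAt_Psi2 hD hE x) hφ h h0
  simp only [dirDeriv, mvfderiv_cube_root hd h, lin_mul]
  rw [← hx]
  field_simp

end SpinDyad

end Spin

end GHP

end

theorem typeII_f_decomposition
    {M : Type*} [TopologicalSpace M] [ChartedSpace GHP.E4 M] [IsManifold (𝓡 4) ∞ M]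
    {S : M → Type*} [TopologicalSpace (TotalSpace GHP.C2 S)]
    [∀ x, AddCommGroup (S x)] [∀ x, Module ℂ (S x)] [∀ x, TopologicalSpace (S x)]
    [∀ x, IsTopologicalAddGroup (S x)] [∀ x, ContinuousSMul ℝ (S x)]
    [FiberBundle GHP.C2 S] [VectorBundle ℝ GHP.C2 S] [ContMDiffVectorBundle ∞ GHP.C2 S (𝓡 4)]
    (g : GHP.LorentzMetric M) (D : GHP.Connection M) (hD : GHP.IsLeviCivita g D)
    (σ : GHP.SpinStructure S g) (DS : GHP.SpinorConnection S) (hDS : GHP.IsSpinConnection σ D DS)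
    (hE : GHP.IsEinstein g D)
    (d : GHP.SpinDyad σ)
    (hsf : GHP.IsShearFreeRay σ DS d.o)
    (hrep : d.IsRepeatedPrincipal D)
    (hΨ : ∀ x, d.Psi2 D x ≠ 0)
    (U : Set M) (hU : IsOpen U) (φ : M → ℂ) (hφ : ContinuousOn φ U)
    (hφΨ : ∀ x ∈ U, φ x ^ 3 = d.Psi2 D x) :
    ∀ x ∈ U, ∀ α β : S x,
      GHP.cext (d.f DS x) (GHP.cvec (σ.sol x) α β)
        = (φ x)⁻¹ * GHP.cext (mvfderiv (𝓡 4) φ x) (GHP.cvec (σ.sol x) α β)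
          - σ.eps x (d.o x) α * d.projC DS (-2) (-1) (d.eta D) x β := by
  intro x hx α β
  have hev : ∀ᶠ y in nhds x, φ y ^ 3 = d.Psi2 D y :=
    Filter.eventually_of_mem (hU.mem_nhds hx) hφΨ
  have hc := d.dirDeriv_cube_root hD hE (hφ.continuousAt (hU.mem_nhds hx)) hev (hΨ x)
  have hη := d.dirDeriv_eta hD hE hΨ x
  have h3 : d.Psi3 D x = 3 * d.Psi2 D x * d.eta D x := by
    have := hΨ x
    simp only [GHP.SpinDyad.eta]
    field_simp
  obtain ⟨b1, b2, b3, b4⟩ := d.bianchi_identities hD hDS hE hsf hrep x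
  rw [hη] at b3 b4
  rw [h3, hc] at b3 b4
  rw [hc] at b1 b2
  have hL : (φ x)⁻¹ * d.dirDeriv φ x GHP.tetL = d.rho DS x :=
    mul_left_cancel₀ (mul_ne_zero three_ne_zero (hΨ x)) (by linear_combination b1)
  have hM : (φ x)⁻¹ * d.dirDeriv φ x GHP.tetM = d.tau DS x :=
    mul_left_cancel₀ (mul_ne_zero three_ne_zero (hΨ x)) (by linear_combination b2)
  rw [hc, hL] at b3
  rw [hc, hM] at b4
  have hK : (φ x)⁻¹ * d.dirDeriv φ x GHP.tetK = d.dirDeriv (d.eta D) x GHP.tetL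
      + (2 * d.epsilon DS x + d.rho DS x) * d.eta D x + d.tau' DS x :=
    mul_left_cancel₀ (mul_ne_zero three_ne_zero (hΨ x)) (by linear_combination b3)
  have hN : (φ x)⁻¹ * d.dirDeriv φ x GHP.tetN = d.dirDeriv (d.eta D) x GHP.tetM
      + (2 * d.beta DS x + d.tau DS x) * d.eta D x + d.rho' DS x :=
    mul_left_cancel₀ (mul_ne_zero three_ne_zero (hΨ x)) (by linear_combination b4)
  rw [d.projC_eq, d.cext_mvfderiv, d.dirDeriv_cv, d.dirDeriv_cv, d.cext_f, d.cext_f,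
    d.normalised, σ.eps_alt, σ.eps_skew x (d.o x) α]
  generalize (starRingEnd ℂ) (σ.eps x β (d.ι x)) = p'
  generalize (starRingEnd ℂ) (σ.eps x β (d.o x)) = q'
  push_cast
  linear_combination (-(σ.eps x α (d.ι x) * p')) * hL + (σ.eps x α (d.ι x) * q') * hM
    + (σ.eps x α (d.o x) * p') * hK - (σ.eps x α (d.o x) * q') * hN
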